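/- arXiv:2509.03328 — 10 statements merged into one kernel-verified Lean document; each statement's English description precedes it below -/
import Mathlib

section
/- There exists a unique probability measure π on ℕ^ℕ (with the product σ-algebra) such that for every integer N ≥ 1 and every h : ℕ → ℕ with h(0) = 0 and |h(j+1) − h(j)| = 1 for all j < N, one has π({g ∈ ℕ^ℕ : g(i) = h(i) for all 1 ≤ i ≤ N}) = (h(N) + 1)·2^{−N}. Moreover π(𝒳) = 1, where 𝒳 := {h : ℕ → ℕ : h(0) = 0 and |h(n+1) − h(n)| = 1 for all n ∈ ℕ} (coordinate 0 being fixed equal to 0 under π). -/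
open MeasureTheory
open scoped ENNReal

namespace ConditionedWalk

/-- The law of the direction of a step from height `k`, with `true` meaning up. -/
noncomputable def stepLaw (k : ℕ) : Measure Bool :=
  ENNReal.ofReal ((k + 2) / (2 * (k + 1))) • Measure.dirac true +
    ENNReal.ofReal (k / (2 * (k + 1))) • Measure.dirac false

instance isProbabilityMeasure_stepLaw (k : ℕ) : IsProbabilityMeasure (stepLaw k) := by
  constructor
  simp only [stepLaw, Measure.add_apply, Measure.smul_apply, measure_univ, smul_eq_mul, mul_one]
  rw [← ENNReal.ofReal_add (by positivity) (by positivity), ← ENNReal.ofReal_one]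
  congr 1
  field_simp
  ring

/-- The height after a step from height `k`; a step from `0` always goes up. -/
def step (k : ℕ) (b : Bool) : ℕ := if b ∨ k = 0 then k + 1 else k - 1

lemma abs_step_sub (k : ℕ) (b : Bool) : |(step k b : ℤ) - (k : ℤ)| = 1 := by
  unfold step
  split_ifs with h
  · simp
  · push Not at h
    rw [Nat.cast_sub (by lia)]
    simp

lemma stepLaw_step_eq {k m : ℕ} (h : |(m : ℤ) - (k : ℤ)| = 1) :
    stepLaw k {b | step k b = m} = ENNReal.ofReal ((m + 1) / (2 * (k + 1))) := by
  have hm : m = k + 1 ∨ k = m + 1 := by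
    rcases abs_eq (zero_le_one) |>.1 h with h | h <;> lia
  simp only [stepLaw, Measure.add_apply, Measure.smul_apply, smul_eq_mul,
    Measure.dirac_apply' _ (MeasurableSet.of_discrete)]
  rcases hm with rfl | rfl
  · rcases Nat.eq_zero_or_pos k with rfl | hk
    · simp [step]
    · have h1 : k ≠ 0 := by lia
      have h2 : k - 1 ≠ k + 1 := by lia
      simp [step, h1, h2]
      congr 2
      ring
  · have hm : m + 1 + 1 ≠ m := by lia
    simp [step, hm]

/-- The walk that reads its step at time `n` and height `k` off `ω (n, k)`. -/
def path (ω : ℕ × ℕ → Bool) : ℕ → ℕ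
  | 0 => 0
  | n + 1 => step (path ω n) (ω (n, path ω n))

lemma measurable_path : Measurable path := by
  refine measurable_pi_lambda _ fun n => ?_
  induction n with
  | zero => exact measurable_const
  | succ n ih =>
    have hf : Measurable fun p : (ℕ × ℕ → Bool) × ℕ => step p.2 (p.1 (n, p.2)) :=
      measurable_from_prod_countable_left fun k =>
        (Measurable.of_discrete (f := step k)).comp (measurable_pi_apply (n, k))
    exact hf.comp (measurable_id.prodMk ih)

lemma path_eq_iff {h : ℕ → ℕ} (h0 : h 0 = 0) (N : ℕ) (ω : ℕ × ℕ → Bool) :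
    (∀ i ≤ N, path ω i = h i) ↔ ∀ j < N, step (h j) (ω (j, h j)) = h (j + 1) := by
  induction N with
  | zero => simp [path, h0]
  | succ N ih =>
    rw [Nat.forall_lt_succ_right, ← ih]
    constructor
    · intro H
      refine ⟨fun i hi => H i (by lia), ?_⟩
      rw [← H N (by lia), ← H (N + 1) le_rfl, path]
    · rintro ⟨H, H'⟩ i hi
      rcases Nat.le_succ_iff.1 hi with hi | rfl
      · exact H i hi
      · rw [← H', path, H N le_rfl]

/-- The law of the simple random walk started at `0` conditioned to stay nonnegative. -/
noncomputable def law : Measure (ℕ → ℕ) :=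
  (Measure.infinitePi fun p : ℕ × ℕ => stepLaw p.2).map path

instance isProbabilityMeasure_law : IsProbabilityMeasure law :=
  Measure.isProbabilityMeasure_map measurable_path.aemeasurable

lemma prod_transition {h : ℕ → ℕ} (h0 : h 0 = 0) (N : ℕ) :
    ∏ j ∈ Finset.range N, (((h (j + 1) : ℝ) + 1) / (2 * (h j + 1))) = (h N + 1) / 2 ^ N := by
  induction N with
  | zero => simp [h0]
  | succ N ih =>
    rw [Finset.prod_range_succ, ih]
    field_simp
    ring

/-- The set of nonnegative nearest-neighbour paths started at `0`. -/
def walks : Set (ℕ → ℕ) := {h | h 0 = 0 ∧ ∀ n : ℕ, |((h (n + 1) : ℤ)) - (h n : ℤ)| = 1}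

lemma measurableSet_walks : MeasurableSet walks := by
  have (n : ℕ) : MeasurableSet {h : ℕ → ℕ | |((h (n + 1) : ℤ)) - (h n : ℤ)| = 1} := by
    have hf : Measurable fun h : ℕ → ℕ => (h (n + 1), h n) := by fun_prop
    exact hf (MeasurableSet.of_discrete (s := {p : ℕ × ℕ | |(p.1 : ℤ) - (p.2 : ℤ)| = 1}))
  have h0 : MeasurableSet {h : ℕ → ℕ | h 0 = 0} :=
    measurable_pi_apply 0 (measurableSet_singleton 0)
  rw [walks, Set.ofPred_and, Set.ofPred_forall]
  exact h0.inter (MeasurableSet.iInter this)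

lemma path_mem_walks (ω : ℕ × ℕ → Bool) : path ω ∈ walks :=
  ⟨rfl, fun _ => abs_step_sub _ _⟩

lemma law_walks : law walks = 1 := by
  rw [law, Measure.map_apply measurable_path measurableSet_walks,
    Set.eq_univ_of_forall (s := path ⁻¹' walks) path_mem_walks, measure_univ]

/-- The paths that agree with `h` up to time `N`. -/
def initialCylinder (N : ℕ) (h : ℕ → ℕ) : Set (ℕ → ℕ) := {g | ∀ i ≤ N, g i = h i}

lemma measurableSet_initialCylinder (N : ℕ) (h : ℕ → ℕ) :
    MeasurableSet (initialCylinder N h) := by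
  simp only [initialCylinder, Set.ofPred_forall]
  refine MeasurableSet.iInter fun i => MeasurableSet.iInter fun _ => ?_
  have hi : Measurable fun g : ℕ → ℕ => g i := measurable_pi_apply i
  exact hi (measurableSet_singleton (h i))

lemma law_initialCylinder {N : ℕ} {h : ℕ → ℕ} (h0 : h 0 = 0)
    (hs : ∀ j < N, |((h (j + 1) : ℤ)) - (h j : ℤ)| = 1) :
    law (initialCylinder N h) = ((h N : ℝ≥0∞) + 1) / 2 ^ N := by
  have hpre : path ⁻¹' initialCylinder N h =
      Set.pi ((Finset.range N).image fun j => (j, h j))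
        fun p => {b | step p.2 b = h (p.1 + 1)} := by
    ext ω
    simp [initialCylinder, path_eq_iff h0, Set.mem_pi]
  rw [law, Measure.map_apply measurable_path (measurableSet_initialCylinder N h), hpre,
    Measure.infinitePi_pi _ fun _ _ => MeasurableSet.of_discrete,
    Finset.prod_image fun i _ j _ hij => congrArg Prod.fst hij,
    Finset.prod_congr rfl fun j hj => stepLaw_step_eq (hs j (Finset.mem_range.1 hj)),
    ← ENNReal.ofReal_prod_of_nonneg fun _ _ => by positivity, prod_transition h0,
    ENNReal.ofReal_div_of_pos (by positivity), ENNReal.ofReal_add (by positivity) zero_le_one,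
    ENNReal.ofReal_pow zero_le_two]
  simp

/-- If `g` starts at `0`, agreement with `h` only has to be required at positive times. -/
lemma measure_initialCylinder_eq {π : Measure (ℕ → ℕ)} [IsProbabilityMeasure π]
    (hπ : π walks = 1) {h : ℕ → ℕ} (h0 : h 0 = 0) (N : ℕ) :
    π {g | ∀ i, 1 ≤ i → i ≤ N → g i = h i} = π (initialCylinder N h) := by
  refine measure_congr (Filter.eventuallyEq_set.2 ?_)
  filter_upwards [mem_ae_iff_prob_eq_one measurableSet_walks |>.2 hπ] with g hg
  refine ⟨fun H i hi => ?_, fun H i _ hi => H i hi⟩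
  rcases Nat.eq_zero_or_pos i with rfl | hpos
  · rw [hg.1, h0]
  · exact H i hpos hi

lemma measure_initialCylinder_eq_zero {π : Measure (ℕ → ℕ)} [IsProbabilityMeasure π]
    (hπ : π walks = 1) {h : ℕ → ℕ} {N : ℕ}
    (hh : ¬ (h 0 = 0 ∧ ∀ j < N, |((h (j + 1) : ℤ)) - (h j : ℤ)| = 1)) :
    π (initialCylinder N h) = 0 := by
  have hsub : initialCylinder N h ⊆ walksᶜ := by
    refine fun g hg hw => hh ⟨?_, fun j hj => ?_⟩
    · rw [← hg 0 (Nat.zero_le N), hw.1]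
    · rw [← hg j hj.le, ← hg (j + 1) hj, hw.2 j]
  exact measure_mono_null hsub ((prob_compl_eq_zero_iff measurableSet_walks).2 hπ)

lemma ext_of_initialCylinder {π ρ : Measure (ℕ → ℕ)} [IsFiniteMeasure π] [IsFiniteMeasure ρ]
    (H : ∀ N h, π (initialCylinder N h) = ρ (initialCylinder N h)) : π = ρ := by
  have hproj : IsProjectiveMeasureFamily (α := fun _ : ℕ => ℕ)
      fun I : Finset ℕ => ρ.map I.restrict := by
    intro I J hJI
    rw [Measure.map_map (by fun_prop) (by fun_prop), Finset.restrict₂_comp_restrict]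
  have hlim : IsProjectiveLimit (α := fun _ : ℕ => ℕ) ρ
      fun I : Finset ℕ => ρ.map I.restrict := fun _ => rfl
  refine IsProjectiveLimit.unique ((isProjectiveLimit_nat_iff hproj π).2 fun N => ?_) hlim
  refine Measure.ext_of_singleton fun a => ?_
  have hpre : Preorder.frestrictLe (π := fun _ : ℕ => ℕ) N ⁻¹' {a} =
      initialCylinder N fun i => if hi : i ∈ Finset.Iic N then a ⟨i, hi⟩ else 0 := by
    ext g
    simp only [Set.mem_preimage, Set.mem_singleton_iff, funext_iff, initialCylinder]
    refine ⟨fun H i hi => ?_, fun H i => ?_⟩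
    · rw [dif_pos (Finset.mem_Iic.2 hi), ← H]
      rfl
    · have := H i (Finset.mem_Iic.1 i.2)
      rwa [dif_pos i.2] at this
  change π.map (Preorder.frestrictLe N) {a} = ρ.map (Preorder.frestrictLe N) {a}
  rw [Measure.map_apply (by fun_prop) (measurableSet_singleton a),
    Measure.map_apply (by fun_prop) (measurableSet_singleton a), hpre, H]

end ConditionedWalk

open ConditionedWalk

/-- There exists a unique probability measure `π` on `ℕ^ℕ` whose cylinder probabilities
over coordinates `1, …, N` along nearest-neighbour paths started at `0` are
`(h N + 1) · 2⁻ᴺ`, and which is carried by the set `𝒳` of nonnegative nearest-neighbour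
paths started at `0`. -/
theorem stmt1 :
    ∃! π : Measure (ℕ → ℕ),
      IsProbabilityMeasure π ∧
      (∀ N : ℕ, 1 ≤ N → ∀ h : ℕ → ℕ, h 0 = 0 →
        (∀ j, j < N → |((h (j + 1) : ℤ)) - (h j : ℤ)| = 1) →
        π {g : ℕ → ℕ | ∀ i, 1 ≤ i → i ≤ N → g i = h i} = ((h N : ℝ≥0∞) + 1) / 2 ^ N) ∧
      π {h : ℕ → ℕ | h 0 = 0 ∧ ∀ n : ℕ, |((h (n + 1) : ℤ)) - (h n : ℤ)| = 1} = 1 := by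
  refine ⟨law, ⟨inferInstance, fun N _ h h0 hs => ?_, law_walks⟩, ?_⟩
  · rw [measure_initialCylinder_eq law_walks h0, law_initialCylinder h0 hs]
  rintro ρ ⟨_, hρ, hw⟩
  refine ext_of_initialCylinder fun N h => ?_
  by_cases hh : h 0 = 0 ∧ ∀ j < N, |((h (j + 1) : ℤ)) - (h j : ℤ)| = 1
  · rw [law_initialCylinder hh.1 hh.2, ← measure_initialCylinder_eq hw hh.1]
    rcases Nat.eq_zero_or_pos N with rfl | hN
    · have huniv : {g : ℕ → ℕ | ∀ i, 1 ≤ i → i ≤ 0 → g i = h i} = Set.univ :=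
        Set.eq_univ_of_forall fun g i hi hi' => by lia
      rw [huniv, measure_univ, hh.1]
      simp
    · exact hρ N hN h hh.1 hh.2
  · rw [measure_initialCylinder_eq_zero hw hh, measure_initialCylinder_eq_zero law_walks hh]
end

section
/- For every pair of bounded cylindrical functions f, g : 𝒳 → ℝ (i.e. functions that are measurable and depend only on finitely many coordinates), one has ∫_𝒳 (Lf)(h)·g(h) π(dh) = ∫_𝒳 f(h)·(Lg)(h) π(dh), where for h ∈ 𝒳 the generator is Lf(h) := Σ_{n≥1} 1{h(n) + Δh(n) ≥ 0}·(f(h^n) − f(h)), Δh(n) := h(n+1) + h(n−1) − 2h(n), and h^n denotes the path equal to h except that h^n(n) = h(n) + Δh(n). (For cylindrical f only finitely many summands are nonzero, so Lf is well defined.) -/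
open MeasureTheory
open scoped ENNReal

/-- The corner-flipped path: equal to `h` except at site `n`, where the corner is flipped. -/
noncomputable def flipAt (h : ℕ → ℕ) (n : ℕ) : ℕ → ℕ :=
  fun i => if i = n then h (n + 1) + h (n - 1) - h n else h i

/-- The generator of the corner-flip dynamics above a hard wall:
`Lf(h) = Σ_{n ≥ 1} 1{h(n) + Δh(n) ≥ 0} (f(hⁿ) - f(h))`. -/
noncomputable def gen (f : (ℕ → ℕ) → ℝ) (h : ℕ → ℕ) : ℝ :=
  ∑' n : ℕ,
    if 1 ≤ n ∧ 0 ≤ (h n : ℤ) + ((h (n + 1) : ℤ) + (h (n - 1) : ℤ) - 2 * (h n : ℤ)) then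
      f (flipAt h n) - f h
    else 0

/-- The set of nonnegative nearest-neighbour paths started at `0`. -/
def pathSet : Set (ℕ → ℕ) :=
  {h : ℕ → ℕ | h 0 = 0 ∧ ∀ n : ℕ, |((h (n + 1) : ℤ)) - (h n : ℤ)| = 1}

/-- The corner flip at `n`, performed only when it keeps the path nonnegative. -/
noncomputable def wallFlip (n : ℕ) (h : ℕ → ℕ) : ℕ → ℕ :=
  fun i => if i = n ∧ 1 ≤ n ∧ h n ≤ h (n + 1) + h (n - 1) then h (n + 1) + h (n - 1) - h n else h i

/-- `F h` only depends on the coordinates of `h` up to `N`. -/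
def DependsUpTo (N : ℕ) (F : (ℕ → ℕ) → ℝ) : Prop :=
  ∀ h h' : ℕ → ℕ, (∀ i, i ≤ N → h i = h' i) → F h = F h'

lemma DependsUpTo.mono {M N : ℕ} (hMN : M ≤ N) {F : (ℕ → ℕ) → ℝ} (hF : DependsUpTo M F) :
    DependsUpTo N F :=
  fun h h' hh => hF h h' fun i hi => hh i (hi.trans hMN)

lemma measurableSet_pathSet : MeasurableSet pathSet := by
  have h1 : MeasurableSet {h : ℕ → ℕ | h 0 = 0} :=
    measurableSet_eq_fun (measurable_pi_apply 0) measurable_const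
  have h2 : ∀ n : ℕ, MeasurableSet {h : ℕ → ℕ | |((h (n + 1) : ℤ)) - (h n : ℤ)| = 1} := by
    intro n
    have hm : Measurable fun h : ℕ → ℕ => (h (n + 1), h n) := by fun_prop
    exact hm (MeasurableSet.of_discrete (s := {p : ℕ × ℕ | |(p.1 : ℤ) - (p.2 : ℤ)| = 1}))
  have : pathSet = {h : ℕ → ℕ | h 0 = 0} ∩
      ⋂ n : ℕ, {h : ℕ → ℕ | |((h (n + 1) : ℤ)) - (h n : ℤ)| = 1} := by
    ext h
    simp [pathSet]
  rw [this]
  exact h1.inter (MeasurableSet.iInter h2)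

lemma wallFlip_wallFlip (n : ℕ) (h : ℕ → ℕ) : wallFlip n (wallFlip n h) = h := by
  funext i
  rcases n with _ | m
  · simp [wallFlip]
  · by_cases hi : i = m + 1
    · subst hi
      simp only [wallFlip]
      split_ifs <;> simp_all
      omega
    · simp [wallFlip, hi]

lemma wallFlip_mem_pathSet (n : ℕ) {h : ℕ → ℕ} (hh : h ∈ pathSet) : wallFlip n h ∈ pathSet := by
  obtain ⟨h0, hs⟩ := hh
  have hs' : ∀ k, h (k + 1) = h k + 1 ∨ h k = h (k + 1) + 1 := by
    intro k
    rcases (abs_eq zero_le_one).1 (hs k) with h1 | h1 <;> omega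
  rcases n with _ | m
  · simpa [wallFlip, pathSet] using And.intro h0 hs
  refine ⟨by simp [wallFlip, h0], fun k => ?_⟩
  rw [abs_eq zero_le_one]
  have e1 := hs' k
  have e2 := hs' m
  have e3 := hs' (m + 1)
  simp only [wallFlip, Nat.add_sub_cancel]
  by_cases hk : k = m
  · subst hk
    split_ifs <;> omega
  · by_cases hk' : k = m + 1
    · subst hk'
      split_ifs <;> omega
    · split_ifs <;> omega

lemma wallFlip_congr {n N : ℕ} (hn : n < N) {h h' : ℕ → ℕ} (hh : ∀ i, i ≤ N → h i = h' i) :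
    ∀ i, i ≤ N → wallFlip n h i = wallFlip n h' i := by
  intro i hi
  simp only [wallFlip, hh i hi, hh n hn.le, hh (n + 1) hn, hh (n - 1) (by omega)]

lemma measurable_wallFlip (n : ℕ) : Measurable (wallFlip n) := by
  refine measurable_pi_iff.2 fun i => ?_
  have hm : Measurable fun h : ℕ → ℕ => (h n, h (n + 1), h (n - 1), h i) := by fun_prop
  exact (Measurable.of_discrete (f := fun p : ℕ × ℕ × ℕ × ℕ =>
    if i = n ∧ 1 ≤ n ∧ p.1 ≤ p.2.1 + p.2.2.1 then p.2.1 + p.2.2.1 - p.1 else p.2.2.2)).comp hm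

lemma DependsUpTo.comp_wallFlip {n N : ℕ} (hn : n < N) {F : (ℕ → ℕ) → ℝ}
    (hF : DependsUpTo N F) : DependsUpTo N fun h => F (wallFlip n h) :=
  fun _ _ hh => hF _ _ (wallFlip_congr hn hh)

lemma gen_eq_sum {M : ℕ} {f : (ℕ → ℕ) → ℝ} (hf : DependsUpTo M f) (h : ℕ → ℕ) :
    gen f h = ∑ n ∈ Finset.range (M + 1), (f (wallFlip n h) - f h) := by
  have key : ∀ n : ℕ,
      (if 1 ≤ n ∧ 0 ≤ (h n : ℤ) + ((h (n + 1) : ℤ) + (h (n - 1) : ℤ) - 2 * (h n : ℤ)) then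
        f (flipAt h n) - f h else 0) = f (wallFlip n h) - f h := by
    intro n
    split_ifs with hc
    · have hc' : h n ≤ h (n + 1) + h (n - 1) := by omega
      have : wallFlip n h = flipAt h n := by
        funext i
        simp [wallFlip, flipAt, hc.1, hc']
      rw [this]
    · have : wallFlip n h = h := by
        funext i
        have : ¬ (1 ≤ n ∧ h n ≤ h (n + 1) + h (n - 1)) := fun h' => hc (by omega)
        simp [wallFlip, this]
      rw [this, sub_self]
  simp only [gen, key]
  refine tsum_eq_sum fun n hn => ?_
  rw [Finset.mem_range, not_lt] at hn
  rw [sub_eq_zero]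
  refine hf _ _ fun i hi => ?_
  have : i ≠ n := by omega
  simp [wallFlip, this]

/-- The first `N + 1` coordinates of a path. -/
def initSeg (N : ℕ) (h : ℕ → ℕ) : Fin (N + 1) → ℕ := fun i => h i

/-- Extension of a finite sequence by `0`. -/
def extendZero (N : ℕ) (a : Fin (N + 1) → ℕ) : ℕ → ℕ :=
  fun i => if hi : i < N + 1 then a ⟨i, hi⟩ else 0

lemma initSeg_eq_iff {N : ℕ} {h h' : ℕ → ℕ} :
    initSeg N h = initSeg N h' ↔ ∀ i, i ≤ N → h i = h' i :=
  ⟨fun H i hi => congrFun H ⟨i, Nat.lt_succ_of_le hi⟩,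
    fun H => funext fun i => H i (Nat.le_of_lt_succ i.2)⟩

lemma measurable_initSeg (N : ℕ) : Measurable (initSeg N) :=
  measurable_pi_iff.2 fun i => measurable_pi_apply (i : ℕ)

lemma DependsUpTo.extendZero_initSeg {N : ℕ} {F : (ℕ → ℕ) → ℝ} (hF : DependsUpTo N F)
    (h : ℕ → ℕ) : F (extendZero N (initSeg N h)) = F h :=
  hF _ _ fun i hi => by simp [extendZero, initSeg, Nat.lt_succ_of_le hi]

section Invariance

variable {π : Measure (ℕ → ℕ)}

lemma measure_initSeg_preimage (hsupp : ∀ᵐ h ∂π, h ∈ pathSet)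
    (hcyl : ∀ N : ℕ, 1 ≤ N → ∀ h ∈ pathSet,
      π {g : ℕ → ℕ | ∀ i, 1 ≤ i → i ≤ N → g i = h i} = ((h N : ℝ≥0∞) + 1) / 2 ^ N)
    {N : ℕ} (hN : 1 ≤ N) {h : ℕ → ℕ} (hh : h ∈ pathSet) :
    π {g | initSeg N g = initSeg N h} = ((h N : ℝ≥0∞) + 1) / 2 ^ N := by
  rw [← hcyl N hN h hh]
  refine measure_congr ?_
  filter_upwards [hsupp] with g hg
  refine propext (initSeg_eq_iff.trans ⟨fun H i _ hi => H i hi, fun H i hi => ?_⟩)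
  rcases Nat.eq_zero_or_pos i with rfl | hpos
  · rw [hg.1, hh.1]
  · exact H i hpos hi

lemma map_initSeg_map_wallFlip (hsupp : ∀ᵐ h ∂π, h ∈ pathSet)
    (hcyl : ∀ N : ℕ, 1 ≤ N → ∀ h ∈ pathSet,
      π {g : ℕ → ℕ | ∀ i, 1 ≤ i → i ≤ N → g i = h i} = ((h N : ℝ≥0∞) + 1) / 2 ^ N)
    {n N : ℕ} (hn : n < N) :
    π.map (fun h => initSeg N (wallFlip n h)) = π.map (initSeg N) := by
  have hm : Measurable fun h => initSeg N (wallFlip n h) :=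
    (measurable_initSeg N).comp (measurable_wallFlip n)
  refine Measure.ext_of_singleton fun a => ?_
  rw [Measure.map_apply hm (measurableSet_singleton a),
    Measure.map_apply (measurable_initSeg N) (measurableSet_singleton a)]
  by_cases ha : ∃ h ∈ pathSet, initSeg N h = a
  · obtain ⟨h, hh, rfl⟩ := ha
    have e : (fun g => initSeg N (wallFlip n g)) ⁻¹' {initSeg N h} =
        {g | initSeg N g = initSeg N (wallFlip n h)} := by
      ext g
      simp only [Set.mem_preimage, Set.mem_singleton_iff, Set.mem_ofPred_eq, initSeg_eq_iff]
      constructor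
      · intro H
        simpa only [wallFlip_wallFlip] using wallFlip_congr hn H
      · intro H
        simpa only [wallFlip_wallFlip] using wallFlip_congr hn H
    have e' : wallFlip n h N = h N := by simp [wallFlip, hn.ne']
    rw [e, measure_initSeg_preimage hsupp hcyl (by omega) (wallFlip_mem_pathSet n hh), e']
    exact (measure_initSeg_preimage hsupp hcyl (by omega) hh).symm
  · push Not at ha
    have h1 : π ((fun g => initSeg N (wallFlip n g)) ⁻¹' {a}) = 0 :=
      measure_mono_null (fun g hg hg' => ha _ (wallFlip_mem_pathSet n hg') hg) (mem_ae_iff.1 hsupp)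
    have h2 : π (initSeg N ⁻¹' {a}) = 0 :=
      measure_mono_null (fun g hg hg' => ha _ hg' hg) (mem_ae_iff.1 hsupp)
    rw [h1, h2]

lemma integral_comp_wallFlip (hsupp : ∀ᵐ h ∂π, h ∈ pathSet)
    (hcyl : ∀ N : ℕ, 1 ≤ N → ∀ h ∈ pathSet,
      π {g : ℕ → ℕ | ∀ i, 1 ≤ i → i ≤ N → g i = h i} = ((h N : ℝ≥0∞) + 1) / 2 ^ N)
    {n N : ℕ} (hn : n < N) {F : (ℕ → ℕ) → ℝ} (hF : DependsUpTo N F) :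
    ∫ h, F (wallFlip n h) ∂π = ∫ h, F h ∂π := by
  have hG : Measurable fun a => F (extendZero N a) := Measurable.of_discrete
  have hm : Measurable fun h => initSeg N (wallFlip n h) :=
    (measurable_initSeg N).comp (measurable_wallFlip n)
  calc ∫ h, F (wallFlip n h) ∂π
      = ∫ h, F (extendZero N (initSeg N (wallFlip n h))) ∂π := by
        simp only [hF.extendZero_initSeg]
    _ = ∫ a, F (extendZero N a) ∂(π.map fun h => initSeg N (wallFlip n h)) :=
        (integral_map hm.aemeasurable hG.aestronglyMeasurable).symm
    _ = ∫ a, F (extendZero N a) ∂(π.map (initSeg N)) := by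
        rw [map_initSeg_map_wallFlip hsupp hcyl hn]
    _ = ∫ h, F (extendZero N (initSeg N h)) ∂π :=
        integral_map (measurable_initSeg N).aemeasurable hG.aestronglyMeasurable
    _ = ∫ h, F h ∂π := by simp only [hF.extendZero_initSeg]

lemma integral_wallFlip_mul_comm (hsupp : ∀ᵐ h ∂π, h ∈ pathSet)
    (hcyl : ∀ N : ℕ, 1 ≤ N → ∀ h ∈ pathSet,
      π {g : ℕ → ℕ | ∀ i, 1 ≤ i → i ≤ N → g i = h i} = ((h N : ℝ≥0∞) + 1) / 2 ^ N)
    {n N : ℕ} (hn : n < N) {f g : (ℕ → ℕ) → ℝ} (hf : DependsUpTo N f) (hg : DependsUpTo N g) :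
    ∫ h, f (wallFlip n h) * g h ∂π = ∫ h, f h * g (wallFlip n h) ∂π := by
  have hF : DependsUpTo N fun h => f (wallFlip n h) * g h := fun h h' hh =>
    congrArg₂ (· * ·) (hf.comp_wallFlip hn h h' hh) (hg h h' hh)
  simpa only [wallFlip_wallFlip] using (integral_comp_wallFlip hsupp hcyl hn hF).symm

end Invariance

/-- Reversibility of `π` for the corner-flip dynamics: for bounded measurable cylindrical
functions `f, g`, one has `∫_𝒳 (Lf)·g dπ = ∫_𝒳 f·(Lg) dπ`. -/
theorem stmt3 (π : Measure (ℕ → ℕ)) [IsProbabilityMeasure π]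
    (hsupp : π {h : ℕ → ℕ | h 0 = 0 ∧ ∀ n : ℕ, |((h (n + 1) : ℤ)) - (h n : ℤ)| = 1} = 1)
    (hcyl : ∀ N : ℕ, 1 ≤ N → ∀ h : ℕ → ℕ, h 0 = 0 →
      (∀ n : ℕ, |((h (n + 1) : ℤ)) - (h n : ℤ)| = 1) →
      π {g : ℕ → ℕ | ∀ i, 1 ≤ i → i ≤ N → g i = h i} = ((h N : ℝ≥0∞) + 1) / 2 ^ N)
    (f g : (ℕ → ℕ) → ℝ)
    (hfmeas : Measurable f) (hgmeas : Measurable g)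
    (hfbdd : ∃ C : ℝ, ∀ h : ℕ → ℕ, |f h| ≤ C) (hgbdd : ∃ C : ℝ, ∀ h : ℕ → ℕ, |g h| ≤ C)
    (hfcyl : ∃ M : ℕ, ∀ h h' : ℕ → ℕ, (∀ i, i ≤ M → h i = h' i) → f h = f h')
    (hgcyl : ∃ M : ℕ, ∀ h h' : ℕ → ℕ, (∀ i, i ≤ M → h i = h' i) → g h = g h') :
    ∫ h in {h : ℕ → ℕ | h 0 = 0 ∧ ∀ n : ℕ, |((h (n + 1) : ℤ)) - (h n : ℤ)| = 1},
        gen f h * g h ∂π =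
    ∫ h in {h : ℕ → ℕ | h 0 = 0 ∧ ∀ n : ℕ, |((h (n + 1) : ℤ)) - (h n : ℤ)| = 1},
        f h * gen g h ∂π := by
  obtain ⟨Cf, hCf⟩ := hfbdd
  obtain ⟨Cg, hCg⟩ := hgbdd
  obtain ⟨Mf, hMf⟩ := hfcyl
  obtain ⟨Mg, hMg⟩ := hgcyl
  have hae : ∀ᵐ h ∂π, h ∈ pathSet := (mem_ae_iff_prob_eq_one measurableSet_pathSet).2 hsupp
  have hcyl' : ∀ N : ℕ, 1 ≤ N → ∀ h ∈ pathSet,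
      π {g : ℕ → ℕ | ∀ i, 1 ≤ i → i ≤ N → g i = h i} = ((h N : ℝ≥0∞) + 1) / 2 ^ N :=
    fun N hN h hh => hcyl N hN h hh.1 hh.2
  change ∫ h in pathSet, gen f h * g h ∂π = ∫ h in pathSet, f h * gen g h ∂π
  rw [Measure.restrict_eq_self_of_ae_mem hae]
  have hf : DependsUpTo (max Mf Mg) f := DependsUpTo.mono (le_max_left _ _) hMf
  have hg : DependsUpTo (max Mf Mg) g := DependsUpTo.mono (le_max_right _ _) hMg
  have hint : ∀ {u v : (ℕ → ℕ) → ℝ}, Measurable u → Measurable v →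
      (∀ h, |u h| ≤ Cf) → (∀ h, |v h| ≤ Cg) → Integrable (fun h => u h * v h) π := by
    intro u v hu hv hub hvb
    refine Integrable.of_bound (hu.mul hv).aestronglyMeasurable (Cf * Cg)
      (Filter.Eventually.of_forall fun h => ?_)
    rw [Real.norm_eq_abs, abs_mul]
    exact mul_le_mul (hub h) (hvb h) (abs_nonneg _) ((abs_nonneg _).trans (hub h))
  have hfg := hint hfmeas hgmeas hCf hCg
  have hfn : ∀ n, Integrable (fun h => f (wallFlip n h) * g h) π := fun n =>
    hint (hfmeas.comp (measurable_wallFlip n)) hgmeas (fun h => hCf _) hCg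
  have hgn : ∀ n, Integrable (fun h => f h * g (wallFlip n h)) π := fun n =>
    hint hfmeas (hgmeas.comp (measurable_wallFlip n)) hCf (fun h => hCg _)
  simp only [gen_eq_sum hf, gen_eq_sum hg, Finset.sum_mul, Finset.mul_sum, sub_mul, mul_sub]
  have hfs : ∀ n, Integrable (fun h => f (wallFlip n h) * g h - f h * g h) π := fun n =>
    (hfn n).sub hfg
  have hgs : ∀ n, Integrable (fun h => f h * g (wallFlip n h) - f h * g h) π := fun n =>
    (hgn n).sub hfg
  rw [integral_finsetSum _ fun n _ => hfs n, integral_finsetSum _ fun n _ => hgs n]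
  refine Finset.sum_congr rfl fun n hn => ?_
  rw [Finset.mem_range] at hn
  rw [integral_sub (hfn n) hfg, integral_sub (hgn n) hfg,
    integral_wallFlip_mul_comm hae hcyl' hn
      (hf.mono (Nat.le_succ _)) (hg.mono (Nat.le_succ _))]
end

section
/- For every k ∈ ℕ and every Schwartz function φ : ℝ → ℝ, the random variables Z_N := (1/N)·Σ_{n=0}^∞ 1{X_n = k}·φ(n/N) converge to 0 as N → ∞, both π-almost surely and in L¹(π). -/
open MeasureTheory Filter
open scoped ENNReal Topology

/-- A nonnegative solution of the recursion of the simple random walk on `ℕ` started at `0` and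
killed on leaving `ℕ` is summable in time at every site. -/
theorem summable_of_killed_walk_recursion (q : ℕ → ℕ → ℝ) (hq : ∀ n k, 0 ≤ q n k)
    (h00 : q 0 0 = 1) (h0 : ∀ k, q 0 (k + 1) = 0) (hz : ∀ n, q (n + 1) 0 = q n 1 / 2)
    (hs : ∀ n k, q (n + 1) (k + 1) = (q n k + q n (k + 2)) / 2) (k : ℕ) :
    Summable fun n => q n k := by
  have hvanish : ∀ n k, n < k → q n k = 0 := by
    intro n
    induction n with
    | zero =>
      intro k hk
      obtain ⟨j, rfl⟩ := Nat.exists_eq_add_of_lt hk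
      simpa using h0 j
    | succ n ih =>
      intro k hk
      obtain ⟨j, rfl⟩ : ∃ j, k = j + 1 := ⟨k - 1, by omega⟩
      rw [hs, ih j (by omega), ih (j + 2) (by omega)]
      simp
  have hmass : ∀ n K, ∑ i ∈ Finset.range (K + 1), q (n + 1) i =
      ∑ i ∈ Finset.range (K + 1), q n i - q n 0 / 2 + (q n (K + 1) - q n K) / 2 := by
    intro n K
    induction K with
    | zero => simp [hz]; ring
    | succ K ih => rw [Finset.sum_range_succ, ih, Finset.sum_range_succ _ (K + 1), hs]; ring
  have hbound : ∀ M, ∀ m ≤ M, ∑ n ∈ Finset.range m, q n 0 +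
      2 * ∑ i ∈ Finset.range (M + 1), q m i ≤ 2 := by
    intro M m
    induction m with
    | zero => intro _; simp [Finset.sum_range_succ', h0, h00]
    | succ m ih =>
      intro hm
      have := ih (by omega)
      rw [Finset.sum_range_succ, hmass, hvanish m (M + 1) (by omega)]
      linarith [hq m M]
  induction k with
  | zero =>
    refine summable_of_sum_range_le (c := 2) (fun n => hq n 0) fun M => ?_
    have := hbound M M le_rfl
    have := Finset.sum_nonneg fun i (_ : i ∈ Finset.range (M + 1)) => hq M i
    linarith
  | succ k ih =>
    refine Summable.of_nonneg_of_le (fun n => hq n _) (fun n => ?_)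
      (((summable_nat_add_iff 1).2 ih).mul_left 2)
    cases k with
    | zero => linarith [hz n]
    | succ k => linarith [hs n k, hq n k]

/-- The set of nearest-neighbour paths in `ℕ` started at `0`. -/
def walkPaths : Set (ℕ → ℕ) :=
  {h | h 0 = 0 ∧ ∀ n : ℕ, |((h (n + 1) : ℤ)) - (h n : ℤ)| = 1}

theorem measurableSet_apply_eq (n k : ℕ) : MeasurableSet {g : ℕ → ℕ | g n = k} :=
  measurableSet_eq_fun (measurable_pi_apply n) measurable_const

theorem measure_eq_one_of_ae_mem {Ω : Type*} [MeasurableSpace Ω] {μ : Measure Ω}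
    [IsProbabilityMeasure μ] {s : Set Ω} (hs : ∀ᵐ x ∂μ, x ∈ s) : μ s = 1 :=
  (measure_congr (eventuallyEq_univ.2 hs)).trans measure_univ

/-- Transition probabilities of a measure with the cylinder probabilities of the conditioned
walk. -/
theorem measure_transition (π : Measure (ℕ → ℕ)) [IsProbabilityMeasure π]
    (hX : ∀ᵐ h ∂π, h ∈ walkPaths)
    (hcyl : ∀ N : ℕ, 1 ≤ N → ∀ h ∈ walkPaths,
      π {g : ℕ → ℕ | ∀ i, 1 ≤ i → i ≤ N → g i = h i} = ((h N : ℝ≥0∞) + 1) / 2 ^ N)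
    (n k j : ℕ) (hkj : |(j : ℤ) - k| = 1) :
    π {g | g n = k ∧ g (n + 1) = j} =
      ((j : ℝ≥0∞) + 1) / (2 * ((k : ℝ≥0∞) + 1)) * π {g | g n = k} := by
  have hcyl' : ∀ N : ℕ, ∀ h ∈ walkPaths,
      π {g : ℕ → ℕ | ∀ i ≤ N, g i = h i} = ((h N : ℝ≥0∞) + 1) / 2 ^ N := by
    intro N h hh
    rcases Nat.eq_zero_or_pos N with rfl | hN
    · have : ∀ᵐ g ∂π, g ∈ {g : ℕ → ℕ | ∀ i ≤ 0, g i = h i} := by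
        filter_upwards [hX] with g hg
        simp [hg.1, hh.1]
      rw [measure_eq_one_of_ae_mem this]
      simp [hh.1]
    · rw [← hcyl N hN h hh]
      refine measure_congr ?_
      filter_upwards [hX] with g hg
      refine propext ⟨fun H i _ hi => H i hi, fun H i hi => ?_⟩
      rcases Nat.eq_zero_or_pos i with rfl | hi0
      · rw [hg.1, hh.1]
      · exact H i hi0 hi
  let r : (ℕ → ℕ) → (Fin (n + 1) → ℕ) := fun g i => g i
  have hr : Measurable r := measurable_pi_lambda _ fun i => measurable_pi_apply _
  let s : Set (Fin (n + 1) → ℕ) := {w | w (Fin.last n) = k}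
  let U : Set (ℕ → ℕ) := {g | g (n + 1) = j}
  have hU : MeasurableSet U := measurableSet_apply_eq (n + 1) j
  have hfib : ∀ w, MeasurableSet (r ⁻¹' {w}) := fun w => hr (measurableSet_singleton w)
  have e1 := tsum_measure_preimage_singleton (μ := π) s.to_countable (f := r) fun w _ => hfib w
  have e2 := tsum_measure_preimage_singleton (μ := π.restrict U) s.to_countable (f := r)
    fun w _ => hfib w
  have hs : {g : ℕ → ℕ | g n = k} = r ⁻¹' s := by ext g; simp [r, s]
  have hsU : {g : ℕ → ℕ | g n = k ∧ g (n + 1) = j} = r ⁻¹' s ∩ U := by ext g; simp [r, s, U]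
  rw [hsU, ← Measure.restrict_apply (hr s.to_countable.measurableSet), ← e2, hs, ← e1,
    ← ENNReal.tsum_mul_left]
  refine tsum_congr fun ⟨w, hw⟩ => ?_
  rw [Measure.restrict_apply (hfib w)]
  by_cases hne : π (r ⁻¹' {w}) = 0
  · rw [hne, mul_zero]
    exact measure_mono_null Set.inter_subset_left hne
  obtain ⟨h, hhw, hh⟩ : ∃ h, h ∈ r ⁻¹' {w} ∧ h ∈ walkPaths := by
    by_contra! H
    exact hne (measure_mono_null (fun g hg => H g hg) hX)
  have hhn : h n = k := by
    rw [← hw, ← hhw]; simp [r]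
  have hw1 : r ⁻¹' {w} = {g | ∀ i ≤ n, g i = h i} := by
    ext g
    rw [← hhw]
    simp only [Set.mem_preimage, Set.mem_singleton_iff, funext_iff, r, Set.mem_ofPred_eq]
    exact ⟨fun H i hi => H ⟨i, by omega⟩, fun H i => H i (by omega)⟩
  let h' : ℕ → ℕ := fun i => if i ≤ n then h i else if Even (i - n) then k else j
  have hh' : h' ∈ walkPaths := by
    refine ⟨by simp [h', hh.1], fun i => ?_⟩
    rcases lt_trichotomy i n with hi | rfl | hi
    · have := hh.2 i
      simpa [h', hi.le, Nat.succ_le_of_lt hi] using this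
    · simpa [h', hhn] using hkj
    · have h1 : ¬ i ≤ n := by omega
      have h2 : ¬ i + 1 ≤ n := by omega
      have h3 : i + 1 - n = (i - n) + 1 := by omega
      by_cases hp : Even (i - n)
      · simpa [h', h1, h2, h3, hp, Nat.even_add_one] using hkj
      · rw [abs_sub_comm] at hkj
        simpa [h', h1, h2, h3, hp, Nat.even_add_one] using hkj
  have hw2 : r ⁻¹' {w} ∩ U = {g | ∀ i ≤ n + 1, g i = h' i} := by
    rw [hw1]
    ext g
    simp only [Set.mem_inter_iff, Set.mem_ofPred_eq, U]
    constructor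
    · rintro ⟨H, H'⟩ i hi
      rcases Nat.lt_or_ge n i with hlt | hle
      · obtain rfl : i = n + 1 := by omega
        simp [h', H']
      · simp [h', hle, H i hle]
    · intro H
      refine ⟨fun i hi => ?_, ?_⟩
      · simpa [h', hi] using H i (by omega)
      · simpa [h'] using H (n + 1) le_rfl
  rw [hw2, hcyl' _ h' hh', hw1, hcyl' _ h hh, hhn]
  have : h' (n + 1) = j := by simp [h']
  rw [this, ← ENNReal.toReal_eq_toReal_iff' (by finiteness) (by finiteness)]
  simp only [ENNReal.toReal_div, ENNReal.toReal_mul, ENNReal.toReal_pow]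
  rw [ENNReal.toReal_add (by simp) (by simp), ENNReal.toReal_add (by simp) (by simp)]
  simp only [ENNReal.toReal_natCast, ENNReal.toReal_one, ENNReal.toReal_ofNat]
  field_simp
  ring

/-- The conditioned walk spends a finite expected time at every site. -/
theorem summable_measureReal_eq (π : Measure (ℕ → ℕ)) [IsProbabilityMeasure π]
    (hX : ∀ᵐ h ∂π, h ∈ walkPaths)
    (hcyl : ∀ N : ℕ, 1 ≤ N → ∀ h ∈ walkPaths,
      π {g : ℕ → ℕ | ∀ i, 1 ≤ i → i ≤ N → g i = h i} = ((h N : ℝ≥0∞) + 1) / 2 ^ N)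
    (k : ℕ) : Summable fun n => π.real {g | g n = k} := by
  have htrans : ∀ n k j : ℕ, |(j : ℤ) - k| = 1 →
      π.real {g | g n = k ∧ g (n + 1) = j} / ((j : ℝ) + 1) =
        π.real {g | g n = k} / ((k : ℝ) + 1) / 2 := by
    intro n k j hkj
    rw [measureReal_def, measure_transition π hX hcyl n k j hkj, ENNReal.toReal_mul,
      ENNReal.toReal_div, ENNReal.toReal_mul, ENNReal.toReal_add (by simp) (by simp),
      ENNReal.toReal_add (by simp) (by simp), ← measureReal_def]
    simp only [ENNReal.toReal_natCast, ENNReal.toReal_one, ENNReal.toReal_ofNat]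
    field_simp
  have hsum := summable_of_killed_walk_recursion
    (fun n k => π.real {g | g n = k} / ((k : ℝ) + 1)) (fun n k => by positivity) ?_ ?_ ?_ ?_ k
  · have := hsum.mul_right ((k : ℝ) + 1)
    refine this.congr fun n => ?_
    field_simp
  · have : ∀ᵐ g ∂π, g ∈ {g : ℕ → ℕ | g 0 = 0} := hX.mono fun g hg => hg.1
    simp [measureReal_def, measure_eq_one_of_ae_mem this]
  · intro k
    have : π {g : ℕ → ℕ | g 0 = k + 1} = 0 :=
      measure_eq_zero_iff_ae_notMem.2 (hX.mono fun g hg (hg' : g 0 = k + 1) => by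
          have := hg.1
          omega)
    simp [measureReal_def, this]
  · intro n
    have : π.real {g | g (n + 1) = 0} = π.real {g | g n = 1 ∧ g (n + 1) = 0} := by
      refine measureReal_congr ?_
      filter_upwards [hX] with g hg
      refine propext ⟨fun (H : g (n + 1) = 0) => ⟨?_, H⟩, fun H => H.2⟩
      have := hg.2 n
      grind
    have h2 := htrans n 1 0 (by simp)
    rw [← this] at h2
    exact h2
  · intro n k
    have : π.real {g | g (n + 1) = k + 1} = π.real {g | g n = k ∧ g (n + 1) = k + 1} +
        π.real {g | g n = k + 2 ∧ g (n + 1) = k + 1} := by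
      rw [← measureReal_union]
      · refine measureReal_congr ?_
        filter_upwards [hX] with g hg
        refine propext ⟨fun (H : g (n + 1) = k + 1) => ?_, fun H => ?_⟩
        · have := hg.2 n
          have : g n = k ∨ g n = k + 2 := by grind
          exact this.imp (fun h => ⟨h, H⟩) (fun h => ⟨h, H⟩)
        · exact H.elim And.right And.right
      · rw [Set.disjoint_left]
        rintro g ⟨h1, -⟩ ⟨h2, -⟩
        omega
      · exact (measurableSet_apply_eq n _).inter (measurableSet_apply_eq (n + 1) _)
    rw [this, add_div, htrans n k (k + 1) (by simp), htrans n (k + 2) (k + 1) (by simp)]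
    ring

/-- If `π {h | h n = k}` is summable in `n`, the occupation time of `k` has an integrable version
dominating all weighted occupation times. -/
theorem exists_integrable_occupation_bound (π : Measure (ℕ → ℕ)) [IsFiniteMeasure π] (k : ℕ)
    (hsum : Summable fun n => π.real {g | g n = k}) :
    ∃ V : (ℕ → ℕ) → ℝ, Integrable V π ∧ ∀ᵐ h ∂π, ∀ (f : ℕ → ℝ) (C : ℝ), (∀ n, |f n| ≤ C) →
      |∑' n : ℕ, if h n = k then f n else 0| ≤ C * V h := by
  let W : (ℕ → ℕ) → ℝ≥0∞ := fun h => ∑' n, ({g : ℕ → ℕ | g n = k}).indicator 1 h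
  have hmeas : ∀ n, MeasurableSet {g : ℕ → ℕ | g n = k} := fun n =>
    measurableSet_apply_eq n k
  have hWm : Measurable W := Measurable.tsum fun n => measurable_one.indicator (hmeas n)
  have hW : ∫⁻ h, W h ∂π ≠ ∞ := by
    rw [lintegral_tsum fun n => (measurable_one.indicator (hmeas n)).aemeasurable]
    simp_rw [lintegral_indicator_one (hmeas _)]
    simpa [measureReal_def, ENNReal.ofReal_toReal] using hsum.tsum_ofReal_ne_top
  refine ⟨fun h => (W h).toReal, integrable_toReal_of_lintegral_ne_top hWm.aemeasurable hW, ?_⟩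
  filter_upwards [ae_lt_top hWm hW] with h hh f C hf
  have hs := (ENNReal.summable_toReal hh.ne).mul_left C
  rw [ENNReal.tsum_toReal_eq (fun n => ne_top_of_le_ne_top hh.ne (ENNReal.le_tsum n)),
    ← tsum_mul_left]
  rw [← Real.norm_eq_abs]
  refine tsum_of_norm_bounded hs.hasSum fun n => ?_
  by_cases hn : h n = k
  · simpa [hn] using hf n
  · simp [hn]

/-- Transience: for every `k` and every Schwartz function `φ`,
`Z_N = (1/N) Σ_n 1{X_n = k} φ(n/N)` tends to `0` as `N → ∞`,
`π`-almost surely and in `L¹(π)`. -/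
theorem stmt4 (π : Measure (ℕ → ℕ)) [IsProbabilityMeasure π]
    (hsupp : π {h : ℕ → ℕ | h 0 = 0 ∧ ∀ n : ℕ, |((h (n + 1) : ℤ)) - (h n : ℤ)| = 1} = 1)
    (hcyl : ∀ N : ℕ, 1 ≤ N → ∀ h : ℕ → ℕ, h 0 = 0 →
      (∀ n : ℕ, |((h (n + 1) : ℤ)) - (h n : ℤ)| = 1) →
      π {g : ℕ → ℕ | ∀ i, 1 ≤ i → i ≤ N → g i = h i} = ((h N : ℝ≥0∞) + 1) / 2 ^ N)
    (k : ℕ) (φ : SchwartzMap ℝ ℝ) :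
    (∀ᵐ h ∂π, Tendsto
        (fun N : ℕ => (1 / (N : ℝ)) * ∑' n : ℕ, if h n = k then φ ((n : ℝ) / N) else 0)
        atTop (𝓝 0)) ∧
    Tendsto
      (fun N : ℕ =>
        ∫ h, |(1 / (N : ℝ)) * ∑' n : ℕ, if h n = k then φ ((n : ℝ) / N) else 0| ∂π)
      atTop (𝓝 0) := by
  have hmeas : MeasurableSet walkPaths := by
    refine (measurableSet_apply_eq 0 0).inter ?_
    change MeasurableSet {h : ℕ → ℕ | ∀ n : ℕ, |((h (n + 1) : ℤ)) - (h n : ℤ)| = 1}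
    rw [Set.ofPred_forall]
    refine MeasurableSet.iInter fun n => ?_
    have : Measurable fun h : ℕ → ℕ => (h (n + 1), h n) := by fun_prop
    exact this (MeasurableSet.of_discrete (s := {p : ℕ × ℕ | |(p.1 : ℤ) - p.2| = 1}))
  have hX : ∀ᵐ h ∂π, h ∈ walkPaths := (mem_ae_iff_prob_eq_one hmeas).2 hsupp
  obtain ⟨V, hV, hbound⟩ := exists_integrable_occupation_bound π k
    (summable_measureReal_eq π hX (fun N hN h hh => hcyl N hN h hh.1 hh.2) k)
  obtain ⟨C, -, hC⟩ := φ.decay 0 0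
  have hle : ∀ᵐ h ∂π, ∀ N : ℕ,
      |(1 / (N : ℝ)) * ∑' n : ℕ, if h n = k then φ ((n : ℝ) / N) else 0| ≤
        1 / (N : ℝ) * (C * V h) := by
    filter_upwards [hbound] with h hh N
    rw [abs_mul, abs_of_nonneg (by positivity : (0 : ℝ) ≤ 1 / N)]
    gcongr
    exact hh _ C fun n => by simpa using hC ((n : ℝ) / N)
  have hlim : ∀ c : ℝ, Tendsto (fun N : ℕ => 1 / (N : ℝ) * c) atTop (𝓝 0) := fun c => by
    simpa using tendsto_one_div_atTop_nhds_zero_nat.mul_const c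
  constructor
  · filter_upwards [hle] with h hh
    exact squeeze_zero_norm hh (hlim _)
  · refine squeeze_zero (fun N => integral_nonneg fun h => abs_nonneg _) (fun N => ?_)
      (hlim (∫ h, C * V h ∂π))
    rw [← integral_const_mul]
    exact integral_mono_of_nonneg (Eventually.of_forall fun h => abs_nonneg _)
      ((hV.const_mul C).const_mul _) (hle.mono fun h hh => hh N)
end

section
/- For every Schwartz function φ : ℝ → ℝ, the random variables (1/N)·Σ_{n=1}^∞ 1{ΔX_n ≠ 0}·φ(n/N) converge, as N → ∞, to (1/2)·∫_0^∞ φ(x) dx in L¹(π). -/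
open MeasureTheory Filter
open scoped ENNReal Topology

/-- The paths that agree with `w` up to time `n`. -/
def cyl (n : ℕ) (w : ℕ → ℕ) : Set (ℕ → ℕ) := {g | ∀ i ≤ n, g i = w i}

/-- `w` starts at `0` and its first `n` steps are `±1`. -/
def IsWalk (n : ℕ) (w : ℕ → ℕ) : Prop :=
  w 0 = 0 ∧ ∀ i < n, w (i + 1) = w i + 1 ∨ w i = w (i + 1) + 1

/-- `π` is the law of the simple random walk conditioned to stay nonnegative. -/
structure IsConditionedWalk (π : Measure (ℕ → ℕ)) : Prop where
  ae_isWalk : ∀ᵐ g ∂π, ∀ n, IsWalk n g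
  real_cyl : ∀ n w, IsWalk n w → π.real (cyl n w) = ((w n : ℝ) + 1) / 2 ^ n

/-- Indicator of a corner at time `n + 1`. -/
noncomputable def corner (n : ℕ) (g : ℕ → ℕ) : ℝ := if g (n + 2) = g n then 1 else 0

/-- Indicator of a visit to `0` at time `n`. -/
noncomputable def atZero (n : ℕ) (g : ℕ → ℕ) : ℝ := if g n = 0 then 1 else 0

/-- The corner indicator at time `n + 1`, minus its conditional expectation given the path up to
time `n`. -/
noncomputable def centered (n : ℕ) (g : ℕ → ℕ) : ℝ := corner n g - 1 / 2 + 1 / 4 * atZero n g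

theorem measurableSet_cyl (n : ℕ) (w : ℕ → ℕ) : MeasurableSet (cyl n w) := by
  have : cyl n w = ⋂ i ∈ Set.Iic n, (fun g : ℕ → ℕ => g i) ⁻¹' {w i} := by
    ext g; simp [cyl]
  rw [this]
  exact MeasurableSet.biInter (Set.to_countable _)
    fun i _ => measurable_pi_apply i (measurableSet_singleton _)

theorem measurable_corner (n : ℕ) : Measurable (corner n) :=
  Measurable.ite (measurableSet_eq_fun (measurable_pi_apply _) (measurable_pi_apply _))
    measurable_const measurable_const

theorem measurable_atZero (n : ℕ) : Measurable (atZero n) :=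
  Measurable.ite (measurableSet_eq_fun (measurable_pi_apply _) measurable_const)
    measurable_const measurable_const

theorem measurable_centered (n : ℕ) : Measurable (centered n) :=
  ((measurable_corner n).sub_const _).add ((measurable_atZero n).const_mul _)

theorem corner_nonneg (n : ℕ) (g : ℕ → ℕ) : 0 ≤ corner n g := by unfold corner; split_ifs <;> simp

theorem corner_le_one (n : ℕ) (g : ℕ → ℕ) : corner n g ≤ 1 := by unfold corner; split_ifs <;> simp

theorem atZero_nonneg (n : ℕ) (g : ℕ → ℕ) : 0 ≤ atZero n g := by unfold atZero; split_ifs <;> simp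

theorem atZero_le_one (n : ℕ) (g : ℕ → ℕ) : atZero n g ≤ 1 := by unfold atZero; split_ifs <;> simp

theorem abs_centered_le_one (n : ℕ) (g : ℕ → ℕ) : |centered n g| ≤ 1 := by
  have := corner_nonneg n g
  have := corner_le_one n g
  have := atZero_nonneg n g
  have := atZero_le_one n g
  rw [centered, abs_le]
  constructor <;> linarith

theorem integrable_centered (π : Measure (ℕ → ℕ)) [IsProbabilityMeasure π] (n : ℕ) :
    Integrable (centered n) π :=
  .of_bound (measurable_centered n).aestronglyMeasurable 1
    (.of_forall fun g => abs_centered_le_one n g)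

theorem integrable_atZero (π : Measure (ℕ → ℕ)) [IsProbabilityMeasure π] (n : ℕ) :
    Integrable (atZero n) π :=
  .of_bound (measurable_atZero n).aestronglyMeasurable 1
    (.of_forall fun g => by
      rw [Real.norm_of_nonneg (atZero_nonneg n g)]; exact atZero_le_one n g)

theorem IsWalk.update {n : ℕ} {w : ℕ → ℕ} (h : IsWalk n w) {a : ℕ}
    (ha : a = w n + 1 ∨ w n = a + 1) : IsWalk (n + 1) (Function.update w (n + 1) a) := by
  refine ⟨by simpa [Function.update] using h.1, fun i hi => ?_⟩
  have := h.2 i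
  rcases Nat.lt_succ_iff_lt_or_eq.mp hi with h' | rfl
  · rw [Function.update_of_ne (by omega), Function.update_of_ne (by omega)]
    exact this h'
  · rw [Function.update_self, Function.update_of_ne (by omega)]
    exact ha

theorem isWalk_of_update {n : ℕ} {w : ℕ → ℕ} {a : ℕ}
    (h : IsWalk (n + 1) (Function.update w (n + 1) a)) : a = w n + 1 ∨ w n = a + 1 := by
  simpa using h.2 n (by omega)

theorem IsWalk.congr {n : ℕ} {g w : ℕ → ℕ} (hg : IsWalk n g) (h : g ∈ cyl n w) : IsWalk n w := by
  refine ⟨by rw [← h 0 (by omega)]; exact hg.1, fun i hi => ?_⟩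
  rw [← h i (by omega), ← h (i + 1) (by omega)]
  exact hg.2 i hi

theorem isWalk_of_isWalk_update {n : ℕ} {w : ℕ → ℕ} {a : ℕ}
    (h : IsWalk (n + 1) (Function.update w (n + 1) a)) : IsWalk n w :=
  IsWalk.congr ⟨h.1, fun i hi => h.2 i (by omega)⟩
    fun i hi => Function.update_of_ne (by omega) _ _

theorem integral_mul_eq_zero {π : Measure (ℕ → ℕ)} {n : ℕ} {F H : (ℕ → ℕ) → ℝ}
    (hFH : Integrable (fun g => F g * H g) π) (hH : ∀ w, ∀ g ∈ cyl n w, H g = H w)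
    (hF : ∀ w, ∫ g in cyl n w, F g ∂π = 0) : ∫ g, F g * H g ∂π = 0 := by
  let e : (Fin (n + 1) → ℕ) → ℕ → ℕ := fun v i => if h : i < n + 1 then v ⟨i, h⟩ else 0
  have hU : (⋃ v, cyl n (e v)) = Set.univ := by
    refine Set.eq_univ_of_forall fun g => Set.mem_iUnion.2 ⟨fun i => g i, fun i hi => ?_⟩
    simp [e, hi]
  have hdisj : Pairwise (Function.onFun Disjoint fun v => cyl n (e v)) := by
    intro v v' hvv'
    refine Set.disjoint_left.2 fun g hg hg' => hvv' (funext fun i => ?_)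
    have := (hg i (by omega)).symm.trans (hg' i (by omega))
    simpa [e, Nat.le_of_lt_succ i.isLt] using this
  rw [← setIntegral_univ, ← hU, integral_iUnion (fun v => measurableSet_cyl n _) hdisj
    hFH.integrableOn]
  refine (tsum_congr fun v => ?_).trans tsum_zero
  rw [setIntegral_congr_fun (g := fun g => F g * H (e v)) (measurableSet_cyl n _)
    fun g hg => by simp only [hH (e v) g hg], integral_mul_const, hF, zero_mul]

theorem integrable_inv_add_one (π : Measure (ℕ → ℕ)) [IsProbabilityMeasure π] (n : ℕ) :
    Integrable (fun g : ℕ → ℕ => ((g n : ℝ) + 1)⁻¹) π := by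
  refine .of_bound ((measurable_from_nat (f := fun k : ℕ => ((k : ℝ) + 1)⁻¹)).comp
    (measurable_pi_apply n)).aestronglyMeasurable 1 (.of_forall fun g => ?_)
  rw [Real.norm_of_nonneg (by positivity)]
  exact inv_le_one_of_one_le₀ (by linarith [(g n).cast_nonneg (α := ℝ)])

theorem abs_sum_mul_centered_le {c : ℕ → ℝ} (M : ℕ) (g : ℕ → ℕ) :
    |∑ n ∈ Finset.range M, c n * centered n g| ≤ ∑ n ∈ Finset.range M, |c n| :=
  (Finset.abs_sum_le_sum_abs _ _).trans <| Finset.sum_le_sum fun n _ => by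
    rw [abs_mul]
    exact mul_le_of_le_one_right (abs_nonneg _) (abs_centered_le_one n g)

theorem measurable_sum_mul_centered (c : ℕ → ℝ) (M : ℕ) :
    Measurable fun g => ∑ n ∈ Finset.range M, c n * centered n g :=
  Finset.measurable_fun_sum _ fun n _ => (measurable_centered n).const_mul _

theorem integrable_centered_mul_sum (π : Measure (ℕ → ℕ)) [IsProbabilityMeasure π]
    (c : ℕ → ℝ) (n M : ℕ) :
    Integrable (fun g => centered n g * ∑ n ∈ Finset.range M, c n * centered n g) π := by
  refine .of_bound ((measurable_centered n).mul
    (measurable_sum_mul_centered c M)).aestronglyMeasurable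
    (1 * ∑ n ∈ Finset.range M, |c n|) (.of_forall fun g => ?_)
  rw [norm_mul]
  exact mul_le_mul (abs_centered_le_one n g) (abs_sum_mul_centered_le M g) (norm_nonneg _)
    zero_le_one

theorem integrable_sum_mul_centered_sq (π : Measure (ℕ → ℕ)) [IsProbabilityMeasure π]
    (c : ℕ → ℝ) (M : ℕ) :
    Integrable (fun g => (∑ n ∈ Finset.range M, c n * centered n g) ^ 2) π := by
  refine .of_bound ((measurable_sum_mul_centered c M).pow_const 2).aestronglyMeasurable
    ((∑ n ∈ Finset.range M, |c n|) ^ 2) (.of_forall fun g => ?_)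
  rw [norm_pow]
  exact pow_le_pow_left₀ (norm_nonneg _) (abs_sum_mul_centered_le M g) 2

theorem sum_mul_centered_congr (c : ℕ → ℝ) (M : ℕ) (w : ℕ → ℕ) (g : ℕ → ℕ)
    (hg : g ∈ cyl (M + 1) w) :
    ∑ n ∈ Finset.range M, c n * centered n g = ∑ n ∈ Finset.range M, c n * centered n w := by
  refine Finset.sum_congr rfl fun n hn => ?_
  have hn := Finset.mem_range.1 hn
  simp only [centered, corner, atZero, hg n (by omega), hg (n + 2) (by omega)]

theorem abs_mul_corner_sub_half_le (c : ℕ → ℝ) (n : ℕ) (g : ℕ → ℕ) :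
    |c n * (corner n g - 1 / 2)| ≤ |c n| := by
  rw [abs_mul]
  refine mul_le_of_le_one_right (abs_nonneg _) (abs_le.2 ?_)
  have := corner_nonneg n g
  have := corner_le_one n g
  constructor <;> linarith

theorem measurable_sum_mul_corner_sub_half (c : ℕ → ℝ) (M : ℕ) :
    Measurable fun g => ∑ n ∈ Finset.range M, c n * (corner n g - 1 / 2) :=
  Finset.measurable_fun_sum _ fun n _ => ((measurable_corner n).sub_const _).const_mul _

theorem hasSum_mul_corner_sub_half {c : ℕ → ℝ} (hs : Summable fun n => |c n|) (g : ℕ → ℕ) :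
    HasSum (fun n => c n * (corner n g - 1 / 2)) (∑' n, c n * (corner n g - 1 / 2)) :=
  (Summable.of_norm_bounded hs fun n => abs_mul_corner_sub_half_le c n g).hasSum

theorem integrable_tsum_corner_sub_half (π : Measure (ℕ → ℕ)) [IsProbabilityMeasure π]
    {c : ℕ → ℝ} (hs : Summable fun n => |c n|) :
    Integrable (fun g => ∑' n, c n * (corner n g - 1 / 2)) π := by
  refine .of_bound (measurable_of_tendsto_metrizable (measurable_sum_mul_corner_sub_half c)
    (tendsto_pi_nhds.2 fun g => (hasSum_mul_corner_sub_half hs g).tendsto_sum_nat)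
    ).aestronglyMeasurable (∑' n, |c n|) (.of_forall fun g => ?_)
  exact tsum_of_norm_bounded hs.hasSum fun n => abs_mul_corner_sub_half_le c n g

namespace IsConditionedWalk

variable {π : Measure (ℕ → ℕ)}

theorem measure_cyl_eq_zero (hπ : IsConditionedWalk π) {n : ℕ} {w : ℕ → ℕ} (h : ¬ IsWalk n w) :
    π (cyl n w) = 0 := by
  rw [measure_eq_zero_iff_ae_notMem]
  filter_upwards [hπ.ae_isWalk] with g hg hgw
  exact h ((hg n).congr hgw)

theorem setIntegral_cyl_of_not_isWalk (hπ : IsConditionedWalk π) {n : ℕ} {w : ℕ → ℕ}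
    (h : ¬ IsWalk n w) (F : (ℕ → ℕ) → ℝ) : ∫ g in cyl n w, F g ∂π = 0 := by
  rw [Measure.restrict_eq_zero.2 (hπ.measure_cyl_eq_zero h), integral_zero_measure]

theorem setIntegral_cyl_of_eqOn (hπ : IsConditionedWalk π) {n : ℕ} {w : ℕ → ℕ} (h : IsWalk n w)
    {F : (ℕ → ℕ) → ℝ} {c : ℝ} (hF : ∀ g ∈ cyl n w, F g = c) :
    ∫ g in cyl n w, F g ∂π = ((w n : ℝ) + 1) / 2 ^ n * c := by
  rw [setIntegral_congr_fun (g := fun _ => c) (measurableSet_cyl n w) hF, setIntegral_const,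
    hπ.real_cyl n w h, smul_eq_mul]

theorem setIntegral_cyl_split (hπ : IsConditionedWalk π) (n : ℕ) (w : ℕ → ℕ)
    {F : (ℕ → ℕ) → ℝ} (hF : Integrable F π) :
    ∫ g in cyl n w, F g ∂π =
      (∫ g in cyl (n + 1) (Function.update w (n + 1) (w n + 1)), F g ∂π) +
        ∫ g in cyl (n + 1) (Function.update w (n + 1) (w n - 1)), F g ∂π := by
  rw [← setIntegral_union _ (measurableSet_cyl _ _) hF.integrableOn hF.integrableOn]
  · refine setIntegral_congr_set ?_
    filter_upwards [hπ.ae_isWalk] with g hg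
    have hs := (hg (n + 1)).2 n (by omega)
    have key : ∀ a, g ∈ cyl (n + 1) (Function.update w (n + 1) a) ↔
        g ∈ cyl n w ∧ g (n + 1) = a := by
      intro a
      refine ⟨fun h => ⟨fun i hi => ?_, ?_⟩, fun h i hi => ?_⟩
      · rw [h i (by omega), Function.update_of_ne (by omega)]
      · rw [h (n + 1) le_rfl, Function.update_self]
      · rcases Nat.lt_or_eq_of_le hi with h' | rfl
        · rw [Function.update_of_ne (by omega), h.1 i (by omega)]
        · rw [Function.update_self, h.2]
    refine propext (Iff.trans ?_ (or_congr (key _) (key _)).symm)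
    refine ⟨fun h => ?_, fun h => h.elim And.left And.left⟩
    have := h n le_rfl
    rcases hs with h1 | h1
    · exact .inl ⟨h, by omega⟩
    · exact .inr ⟨h, by omega⟩
  · refine Set.disjoint_left.2 fun g hg hg' => ?_
    have h1 := hg (n + 1) le_rfl
    have h2 := hg' (n + 1) le_rfl
    rw [Function.update_self] at h1 h2
    omega

theorem setIntegral_centered [IsProbabilityMeasure π] (hπ : IsConditionedWalk π) (n : ℕ)
    (w : ℕ → ℕ) : ∫ g in cyl n w, centered n g ∂π = 0 := by
  by_cases hw : IsWalk n w
  swap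
  · exact hπ.setIntegral_cyl_of_not_isWalk hw _
  have hI := integrable_centered π n
  have val : ∀ a b g, g ∈ cyl (n + 1 + 1) (Function.update (Function.update w (n + 1) a)
      (n + 1 + 1) b) → centered n g =
        (if b = w n then 1 else 0) - 1 / 2 + 1 / 4 * (if w n = 0 then 1 else 0) := by
    intro a b g hg
    have h0 := hg n (by omega)
    have h2 := hg (n + 2) le_rfl
    rw [Function.update_of_ne (by omega), Function.update_of_ne (by omega)] at h0
    rw [Function.update_self] at h2
    simp [centered, corner, atZero, h0, h2]
  have hU := hw.update (.inl rfl)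
  have hUU := hU.update (.inl rfl)
  have hUD := hU.update (a := w n) (.inr (by simp))
  rw [hπ.setIntegral_cyl_split n w hI, hπ.setIntegral_cyl_split (n + 1) _ hI,
    hπ.setIntegral_cyl_split (n + 1) _ hI]
  simp only [Function.update_self, Nat.add_sub_cancel] at hUU ⊢
  rw [hπ.setIntegral_cyl_of_eqOn hUU (val _ _), hπ.setIntegral_cyl_of_eqOn hUD (val _ _)]
  rcases Nat.eq_zero_or_pos (w n) with h0 | h0
  · have hD : ∀ b, ¬ IsWalk (n + 1 + 1) (Function.update (Function.update w (n + 1) (w n - 1))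
        (n + 1 + 1) b) := by
      intro b hb
      have := isWalk_of_update (isWalk_of_isWalk_update hb)
      omega
    rw [hπ.setIntegral_cyl_of_not_isWalk (hD _), hπ.setIntegral_cyl_of_not_isWalk (hD _)]
    simp [h0]
    field_simp
    norm_num
  · obtain ⟨k, hk⟩ : ∃ k, w n = k + 1 := ⟨w n - 1, by omega⟩
    have hD := hw.update (a := k) (.inr hk)
    simp only [hk, Nat.add_sub_cancel] at *
    have hDU := hD.update (.inl rfl)
    simp only [Function.update_self] at hDU
    rw [hπ.setIntegral_cyl_of_eqOn hDU (val _ _)]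
    rcases Nat.eq_zero_or_pos k with hk0 | hk0
    · have hDD : ¬ IsWalk (n + 1 + 1) (Function.update (Function.update w (n + 1) k)
          (n + 1 + 1) (k - 1)) := by
        intro hb
        have := isWalk_of_update hb
        simp [hk0] at this
      rw [hπ.setIntegral_cyl_of_not_isWalk hDD]
      simp [hk0]
      field_simp
      norm_num
    · obtain ⟨j, rfl⟩ : ∃ j, k = j + 1 := ⟨k - 1, by omega⟩
      have hDD := hD.update (a := j) (.inr (by simp))
      simp only [Nat.add_sub_cancel]
      rw [hπ.setIntegral_cyl_of_eqOn hDD (val _ _)]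
      have h1 : j + 1 + 1 + 1 + 1 ≠ j + 1 + 1 := by omega
      have h2 : j ≠ j + 1 + 1 := by omega
      simp only [Function.update_self, h1, h2, if_false, if_true, Nat.succ_ne_zero]
      push_cast
      field_simp
      ring

theorem integral_centered_mul [IsProbabilityMeasure π] (hπ : IsConditionedWalk π) {n : ℕ}
    {H : (ℕ → ℕ) → ℝ} (hFH : Integrable (fun g => centered n g * H g) π)
    (hH : ∀ w, ∀ g ∈ cyl n w, H g = H w) : ∫ g, centered n g * H g ∂π = 0 :=
  integral_mul_eq_zero hFH hH (hπ.setIntegral_centered n)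

theorem integral_inv_add_one_succ [IsProbabilityMeasure π] (hπ : IsConditionedWalk π) (n : ℕ) :
    ∫ g, ((g (n + 1) : ℝ) + 1)⁻¹ ∂π = ∫ g, ((g n : ℝ) + 1)⁻¹ ∂π - 1 / 2 * ∫ g, atZero n g ∂π := by
  have h1 := integrable_inv_add_one π (n + 1)
  have h0 := integrable_inv_add_one π n
  have hz := (integrable_atZero π n).const_mul (1 / 2)
  have hI : Integrable (fun g : ℕ → ℕ => ((g (n + 1) : ℝ) + 1)⁻¹ -
      (((g n : ℝ) + 1)⁻¹ - 1 / 2 * atZero n g)) π := h1.sub (h0.sub hz)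
  have key : ∫ g, (((g (n + 1) : ℝ) + 1)⁻¹ - (((g n : ℝ) + 1)⁻¹ - 1 / 2 * atZero n g)) * 1 ∂π
      = 0 := by
    refine integral_mul_eq_zero (n := n) (H := fun _ => 1) (by simpa using hI)
      (fun _ _ _ => rfl) fun w => ?_
    by_cases hw : IsWalk n w
    swap
    · exact hπ.setIntegral_cyl_of_not_isWalk hw _
    have val : ∀ a g, g ∈ cyl (n + 1) (Function.update w (n + 1) a) →
        ((g (n + 1) : ℝ) + 1)⁻¹ - (((g n : ℝ) + 1)⁻¹ - 1 / 2 * atZero n g) =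
        ((a : ℝ) + 1)⁻¹ - (((w n : ℝ) + 1)⁻¹ - 1 / 2 * if w n = 0 then 1 else 0) := by
      intro a g hg
      have h0 := hg n (by omega)
      have h1 := hg (n + 1) le_rfl
      rw [Function.update_of_ne (by omega)] at h0
      rw [Function.update_self] at h1
      simp [atZero, h0, h1]
    rw [hπ.setIntegral_cyl_split n w hI,
      hπ.setIntegral_cyl_of_eqOn (hw.update (.inl rfl)) (val _)]
    rcases Nat.eq_zero_or_pos (w n) with h0 | h0
    · have hD : ¬ IsWalk (n + 1) (Function.update w (n + 1) (w n - 1)) := by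
        intro hb
        have := isWalk_of_update hb
        omega
      rw [hπ.setIntegral_cyl_of_not_isWalk hD]
      simp [h0]
      norm_num
    · obtain ⟨k, hk⟩ : ∃ k, w n = k + 1 := ⟨w n - 1, by omega⟩
      have hD := hw.update (a := k) (.inr hk)
      simp only [hk, Nat.add_sub_cancel] at *
      rw [hπ.setIntegral_cyl_of_eqOn hD (val _)]
      simp
      field_simp
      ring
  simp only [mul_one] at key
  have e1 := integral_sub h1 (h0.sub hz)
  have e2 := integral_sub h0 hz
  simp only [Pi.sub_apply] at e1
  rw [key, e2, integral_const_mul] at e1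
  linarith

theorem sum_integral_atZero_le [IsProbabilityMeasure π] (hπ : IsConditionedWalk π) (M : ℕ) :
    ∑ n ∈ Finset.range M, ∫ g, atZero n g ∂π ≤ 2 := by
  have h : ∀ M, ∑ n ∈ Finset.range M, ∫ g, atZero n g ∂π =
      2 * (∫ g, ((g 0 : ℝ) + 1)⁻¹ ∂π - ∫ g, ((g M : ℝ) + 1)⁻¹ ∂π) := by
    intro M
    induction M with
    | zero => simp
    | succ M ih => rw [Finset.sum_range_succ, ih, hπ.integral_inv_add_one_succ]; ring
  have h0 : ∫ g, ((g 0 : ℝ) + 1)⁻¹ ∂π ≤ ∫ _, (1 : ℝ) ∂π :=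
    integral_mono (integrable_inv_add_one π 0) (integrable_const _) fun g =>
      inv_le_one_of_one_le₀ (by linarith [(g 0).cast_nonneg (α := ℝ)])
  have hM : 0 ≤ ∫ g, ((g M : ℝ) + 1)⁻¹ ∂π := integral_nonneg fun g => by positivity
  rw [h]
  simp only [integral_const, probReal_univ, smul_eq_mul, mul_one] at h0
  linarith

theorem abs_integral_centered_mul_sum_le [IsProbabilityMeasure π] (hπ : IsConditionedWalk π)
    {c : ℕ → ℝ} {C : ℝ} (hc : ∀ n, |c n| ≤ C) (M : ℕ) :
    |∫ g, centered M g * ∑ n ∈ Finset.range M, c n * centered n g ∂π| ≤ C := by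
  have hC : 0 ≤ C := (abs_nonneg _).trans (hc 0)
  cases M with
  | zero => simpa using hC
  | succ K =>
    have hI := integrable_centered_mul_sum π c (K + 1) K
    have hI' : Integrable (fun g => centered (K + 1) g * (c K * centered K g)) π := by
      convert (integrable_centered_mul_sum π c (K + 1) (K + 1)).sub hI using 1
      ext g
      simp [Finset.sum_range_succ, mul_add]
    simp only [Finset.sum_range_succ, mul_add]
    rw [integral_add hI hI', hπ.integral_centered_mul hI (sum_mul_centered_congr c K), zero_add]
    rw [← Real.norm_eq_abs]
    refine (norm_integral_le_of_norm_le_const (C := C) (.of_forall fun g => ?_)).trans_eq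
      (by rw [probReal_univ, mul_one])
    rw [norm_mul, norm_mul]
    calc _ ≤ 1 * (C * 1) := by
          gcongr
          exacts [abs_centered_le_one _ g, hc K, abs_centered_le_one _ g]
      _ = C := by ring

theorem integral_sum_mul_centered_sq_le [IsProbabilityMeasure π] (hπ : IsConditionedWalk π)
    {c : ℕ → ℝ} {C : ℝ} (hc : ∀ n, |c n| ≤ C) (M : ℕ) :
    ∫ g, (∑ n ∈ Finset.range M, c n * centered n g) ^ 2 ∂π ≤
      3 * C * ∑ n ∈ Finset.range M, |c n| := by
  induction M with
  | zero => simp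
  | succ M ih =>
    have hX := integrable_centered_mul_sum π c M M
    have hS := integrable_sum_mul_centered_sq π c M
    have hXc : Integrable (fun g => 2 * c M *
        (centered M g * ∑ n ∈ Finset.range M, c n * centered n g) + |c M| ^ 2) π :=
      (hX.const_mul _).add (integrable_const _)
    have hle : ∫ g, (∑ n ∈ Finset.range (M + 1), c n * centered n g) ^ 2 ∂π ≤
        ∫ g, ((∑ n ∈ Finset.range M, c n * centered n g) ^ 2 +
          (2 * c M * (centered M g * ∑ n ∈ Finset.range M, c n * centered n g) +
            |c M| ^ 2)) ∂π := by
      refine integral_mono (integrable_sum_mul_centered_sq π c _)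
        (hS.add hXc) fun g => ?_
      have h1 : (c M * centered M g) ^ 2 ≤ |c M| ^ 2 := by
        rw [← sq_abs (c M * _), abs_mul]
        exact pow_le_pow_left₀ (by positivity)
          (mul_le_of_le_one_right (abs_nonneg _) (abs_centered_le_one M g)) 2
      simp only [Finset.sum_range_succ]
      nlinarith
    rw [integral_add hS hXc,
      integral_add (hX.const_mul _) (integrable_const _), integral_const_mul] at hle
    simp only [integral_const, probReal_univ, smul_eq_mul, one_mul] at hle
    have h2 : c M * ∫ g, centered M g * ∑ n ∈ Finset.range M, c n * centered n g ∂π ≤ |c M| * C :=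
      (le_abs_self _).trans <| by
        rw [abs_mul]
        exact mul_le_mul_of_nonneg_left (hπ.abs_integral_centered_mul_sum_le hc M) (abs_nonneg _)
    have h3 : |c M| ^ 2 ≤ |c M| * C := by
      rw [sq]; exact mul_le_mul_of_nonneg_left (hc M) (abs_nonneg _)
    rw [Finset.sum_range_succ]
    linarith

theorem integral_abs_sum_corner_sub_le [IsProbabilityMeasure π] (hπ : IsConditionedWalk π)
    {c : ℕ → ℝ} {C : ℝ} (hc : ∀ n, |c n| ≤ C) {a : ℝ} (ha : 0 < a) (M : ℕ) :
    ∫ g, |∑ n ∈ Finset.range M, c n * (corner n g - 1 / 2)| ∂π ≤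
      a + 3 * C * (∑ n ∈ Finset.range M, |c n|) / a + C / 2 := by
  have hC : 0 ≤ C := (abs_nonneg _).trans (hc 0)
  have hS := (integrable_sum_mul_centered_sq π c M).div_const a
  have hZ : Integrable (fun g => ∑ n ∈ Finset.range M, atZero n g) π :=
    integrable_finsetSum _ fun n _ => integrable_atZero π n
  have hle : ∀ g, |∑ n ∈ Finset.range M, c n * (corner n g - 1 / 2)| ≤
      a + (∑ n ∈ Finset.range M, c n * centered n g) ^ 2 / a +
        C / 4 * ∑ n ∈ Finset.range M, atZero n g := by
    intro g
    have e : ∑ n ∈ Finset.range M, c n * (corner n g - 1 / 2) =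
        ∑ n ∈ Finset.range M, c n * centered n g -
          ∑ n ∈ Finset.range M, c n * (1 / 4 * atZero n g) := by
      rw [← Finset.sum_sub_distrib]
      exact Finset.sum_congr rfl fun n _ => by rw [centered]; ring
    have h1 : ∀ x : ℝ, |x| ≤ a + x ^ 2 / a := by
      intro x
      rw [← sq_abs, ← sub_nonneg]
      have : a + |x| ^ 2 / a - |x| = ((a - |x| / 2) ^ 2 + 3 / 4 * |x| ^ 2) / a := by
        field_simp; ring
      rw [this]; positivity
    have h2 : |∑ n ∈ Finset.range M, c n * (1 / 4 * atZero n g)| ≤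
        C / 4 * ∑ n ∈ Finset.range M, atZero n g := by
      rw [Finset.mul_sum]
      refine (Finset.abs_sum_le_sum_abs _ _).trans (Finset.sum_le_sum fun n _ => ?_)
      have := atZero_nonneg n g
      rw [abs_mul, abs_of_nonneg (by positivity : 0 ≤ 1 / 4 * atZero n g)]
      calc _ ≤ C * (1 / 4 * atZero n g) := by gcongr; exact hc n
        _ = _ := by ring
    rw [e]
    exact (abs_sub _ _).trans (add_le_add (h1 _) h2)
  have hI : Integrable (fun g => a + (∑ n ∈ Finset.range M, c n * centered n g) ^ 2 / a) π :=
    (integrable_const a).add hS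
  refine (integral_mono_of_nonneg (.of_forall fun g => abs_nonneg _)
    (hI.add (hZ.const_mul (C / 4))) (.of_forall hle)).trans ?_
  simp only [Pi.add_apply]
  rw [integral_add hI (hZ.const_mul _), integral_add (integrable_const a) hS,
    integral_const_mul, integral_div, integral_finsetSum _ fun n _ => integrable_atZero π n]
  simp only [integral_const, probReal_univ, smul_eq_mul, one_mul]
  have := hπ.sum_integral_atZero_le M
  have h3 : C / 4 * ∑ n ∈ Finset.range M, ∫ g, atZero n g ∂π ≤ C / 4 * 2 := by gcongr
  have h4 := hπ.integral_sum_mul_centered_sq_le hc M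
  gcongr
  linarith

theorem integral_abs_tsum_corner_sub_le [IsProbabilityMeasure π] (hπ : IsConditionedWalk π)
    {c : ℕ → ℝ} {C : ℝ} (hc : ∀ n, |c n| ≤ C) (hs : Summable fun n => |c n|) {a : ℝ}
    (ha : 0 < a) :
    ∫ g, |∑' n, c n * (corner n g - 1 / 2)| ∂π ≤ a + 3 * C * (∑' n, |c n|) / a + C / 2 := by
  have hC : 0 ≤ C := (abs_nonneg _).trans (hc 0)
  refine le_of_tendsto (x := atTop)
    (tendsto_integral_of_dominated_convergence
      (F := fun M g => |∑ n ∈ Finset.range M, c n * (corner n g - 1 / 2)|)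
      (fun _ => ∑' n, |c n|) (fun M => ?_) (integrable_const _) (fun M => .of_forall fun g => ?_)
      (.of_forall fun g => ?_)) (.of_forall fun M => ?_)
  · exact (measurable_sum_mul_corner_sub_half c M).abs.aestronglyMeasurable
  · rw [Real.norm_eq_abs, abs_abs]
    exact (Finset.abs_sum_le_sum_abs _ _).trans
      ((Finset.sum_le_sum fun n _ => abs_mul_corner_sub_half_le c n g).trans
        (hs.sum_le_tsum _ fun n _ => abs_nonneg _))
  · exact (hasSum_mul_corner_sub_half hs g).tendsto_sum_nat.abs
  · refine (hπ.integral_abs_sum_corner_sub_le hc ha M).trans ?_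
    have := hs.sum_le_tsum (Finset.range M) fun n _ => abs_nonneg _
    gcongr

end IsConditionedWalk

theorem integral_Ioi_floor_eq_tsum (G : ℕ → ℝ)
    (hG : IntegrableOn (fun x : ℝ => G ⌊x⌋₊) (Set.Ioi 0)) :
    ∫ x in Set.Ioi (0 : ℝ), G ⌊x⌋₊ = ∑' n, G n := by
  have hU : (⋃ n : ℕ, Set.Ico (n : ℝ) (n + 1)) = Set.Ici 0 := by
    ext x
    simp only [Set.mem_iUnion, Set.mem_Ico, Set.mem_Ici]
    exact ⟨fun ⟨n, h, _⟩ => n.cast_nonneg.trans h,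
      fun h => ⟨⌊x⌋₊, Nat.floor_le h, Nat.lt_floor_add_one x⟩⟩
  have hfl : ∀ n : ℕ, ∀ x ∈ Set.Ico (n : ℝ) (n + 1), ⌊x⌋₊ = n := fun n x hx =>
    (Nat.floor_eq_iff (n.cast_nonneg.trans hx.1)).2 hx
  rw [← integrableOn_Ici_iff_integrableOn_Ioi, ← hU] at hG
  rw [← integral_Ici_eq_integral_Ioi, ← hU, integral_iUnion (fun _ => measurableSet_Ico) _ hG]
  · refine tsum_congr fun n => ?_
    rw [setIntegral_congr_fun (g := fun _ => G n) measurableSet_Ico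
      fun x hx => by simp only [hfl n x hx]]
    simp
  · intro m n hmn
    exact Set.disjoint_left.2 fun x hx hx' => hmn ((hfl m x hx).symm.trans (hfl n x hx'))

theorem tendsto_riemann_sum_Ioi {f : ℝ → ℝ} (hf : Continuous f) {K : ℝ}
    (hK : ∀ x, |f x| ≤ K * (1 + x ^ 2)⁻¹) :
    Tendsto (fun N : ℕ => 1 / (N : ℝ) * ∑' m : ℕ, f (((m + 1 : ℕ) : ℝ) / N)) atTop
      (𝓝 (∫ x in Set.Ioi (0 : ℝ), f x)) := by
  have hK0 : 0 ≤ K := by simpa using (abs_nonneg _).trans (hK 0)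
  have hdom : IntegrableOn (fun x : ℝ => K * (1 + x ^ 2)⁻¹) (Set.Ioi 0) :=
    (integrable_inv_one_add_sq.const_mul K).integrableOn
  let F : ℕ → ℝ → ℝ := fun N x => f (((⌊N * x⌋₊ + 1 : ℕ) : ℝ) / N)
  have hmeas : ∀ N, Measurable (F N) := fun N =>
    hf.measurable.comp (((measurable_from_nat (f := fun k : ℕ => ((k + 1 : ℕ) : ℝ))).comp
      (Nat.measurable_floor.comp (measurable_const_mul _))).div_const _)
  have hbound : ∀ N : ℕ, 1 ≤ N → ∀ x ∈ Set.Ioi (0 : ℝ), ‖F N x‖ ≤ K * (1 + x ^ 2)⁻¹ := by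
    intro N hN x hx
    have hx : 0 < x := hx
    have hN' : (0 : ℝ) < N := by exact_mod_cast hN
    have hle : x ≤ ((⌊N * x⌋₊ + 1 : ℕ) : ℝ) / N := by
      rw [le_div_iff₀ hN', mul_comm]
      push_cast
      exact (Nat.lt_floor_add_one _).le
    refine (hK _).trans ?_
    gcongr
  have hlim : Tendsto (fun N => ∫ x in Set.Ioi (0 : ℝ), F N x) atTop
      (𝓝 (∫ x in Set.Ioi (0 : ℝ), f x)) := by
    refine tendsto_integral_filter_of_dominated_convergence (fun x => K * (1 + x ^ 2)⁻¹)
      (.of_forall fun N => (hmeas N).aestronglyMeasurable) ?_ hdom ?_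
    · filter_upwards [eventually_ge_atTop 1] with N hN
      exact (ae_restrict_mem measurableSet_Ioi).mono (hbound N hN)
    · refine (ae_restrict_mem measurableSet_Ioi).mono fun x hx => ?_
      refine (hf.tendsto x).comp ?_
      have h1 := (tendsto_nat_floor_mul_div_atTop (R := ℝ) (le_of_lt hx)).comp
        tendsto_natCast_atTop_atTop
      have h2 := h1.add tendsto_one_div_atTop_nhds_zero_nat
      rw [add_zero] at h2
      refine h2.congr fun N => ?_
      simp only [Function.comp]
      push_cast
      rw [add_div, mul_comm]
  refine hlim.congr' ?_
  filter_upwards [eventually_ge_atTop 1] with N hN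
  have hN' : (0 : ℝ) < N := by exact_mod_cast hN
  have hint : IntegrableOn (F N) (Set.Ioi 0) :=
    hdom.mono' (hmeas N).aestronglyMeasurable
      ((ae_restrict_mem measurableSet_Ioi).mono (hbound N hN))
  let G : ℕ → ℝ := fun m => f (((m + 1 : ℕ) : ℝ) / N)
  have hGint : IntegrableOn (fun y : ℝ => G ⌊y⌋₊) (Set.Ioi 0) := by
    have := (integrableOn_Ioi_comp_mul_left_iff (fun y : ℝ => G ⌊y⌋₊) 0 hN').1 hint
    rwa [mul_zero] at this
  have := integral_comp_mul_left_Ioi (fun y : ℝ => G ⌊y⌋₊) 0 hN'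
  rw [mul_zero, integral_Ioi_floor_eq_tsum G hGint, smul_eq_mul, ← one_div] at this
  exact this

theorem SchwartzMap.exists_abs_le_mul_inv_one_add_sq (φ : SchwartzMap ℝ ℝ) :
    ∃ K, ∀ x, |φ x| ≤ K * (1 + x ^ 2)⁻¹ := by
  obtain ⟨A, -, hA⟩ := φ.decay 0 0
  obtain ⟨B, -, hB⟩ := φ.decay 2 0
  refine ⟨A + B, fun x => ?_⟩
  have h1 := hA x
  have h2 := hB x
  simp only [norm_iteratedFDeriv_zero, Real.norm_eq_abs, pow_zero, one_mul, sq_abs] at h1 h2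
  rw [← div_eq_mul_inv, le_div_iff₀ (by positivity)]
  linarith

theorem summable_abs_comp_div {f : ℝ → ℝ} {K : ℝ} (hK : ∀ x, |f x| ≤ K * (1 + x ^ 2)⁻¹) {N : ℕ}
    (hN : 1 ≤ N) : Summable fun m : ℕ => |f (((m + 1 : ℕ) : ℝ) / N)| := by
  have hK0 : 0 ≤ K := by simpa using (abs_nonneg _).trans (hK 0)
  have hN' : (0 : ℝ) < N := by exact_mod_cast hN
  have h := ((summable_nat_add_iff 1).2 (Real.summable_one_div_nat_pow.2 one_lt_two)).mul_left
    (K * (N : ℝ) ^ 2)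
  refine Summable.of_nonneg_of_le (fun _ => abs_nonneg _) (fun m => (hK _).trans ?_) h
  rw [mul_assoc]
  refine mul_le_mul_of_nonneg_left ?_ hK0
  have hm : (0 : ℝ) < ((m + 1 : ℕ) : ℝ) := by positivity
  calc (1 + (((m + 1 : ℕ) : ℝ) / N) ^ 2)⁻¹ ≤ ((((m + 1 : ℕ) : ℝ) / N) ^ 2)⁻¹ := by
        gcongr; linarith
    _ = _ := by field_simp

theorem isConditionedWalk_of_cylinder (π : Measure (ℕ → ℕ)) [IsProbabilityMeasure π]
    (hsupp : π {h : ℕ → ℕ | h 0 = 0 ∧ ∀ n : ℕ, |((h (n + 1) : ℤ)) - (h n : ℤ)| = 1} = 1)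
    (hcyl : ∀ N : ℕ, 1 ≤ N → ∀ h : ℕ → ℕ, h 0 = 0 →
      (∀ n : ℕ, |((h (n + 1) : ℤ)) - (h n : ℤ)| = 1) →
      π {g : ℕ → ℕ | ∀ i, 1 ≤ i → i ≤ N → g i = h i} = ((h N : ℝ≥0∞) + 1) / 2 ^ N) :
    IsConditionedWalk π := by
  have hmeas : MeasurableSet
      {h : ℕ → ℕ | h 0 = 0 ∧ ∀ n : ℕ, |((h (n + 1) : ℤ)) - (h n : ℤ)| = 1} := by
    have : {h : ℕ → ℕ | h 0 = 0 ∧ ∀ n : ℕ, |((h (n + 1) : ℤ)) - (h n : ℤ)| = 1} =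
        {h | h 0 = 0} ∩ ⋂ n : ℕ, {h | |((h (n + 1) : ℤ)) - (h n : ℤ)| = 1} := by
      ext h; simp
    rw [this]
    refine (measurableSet_eq_fun (measurable_pi_apply _) measurable_const).inter
      (MeasurableSet.iInter fun n => measurableSet_eq_fun ?_ measurable_const)
    have hpair : Measurable fun h : ℕ → ℕ => (h (n + 1), h n) :=
      (measurable_pi_apply _).prodMk (measurable_pi_apply _)
    exact (Measurable.of_discrete (f := fun p : ℕ × ℕ => |(p.1 : ℤ) - p.2|)).comp hpair
  have hae : ∀ᵐ g ∂π, ∀ n, IsWalk n g := by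
    filter_upwards [(mem_ae_iff_prob_eq_one hmeas).2 hsupp] with g hg n
    refine ⟨hg.1, fun i _ => ?_⟩
    have := hg.2 i
    rw [abs_eq zero_le_one] at this
    omega
  refine ⟨hae, fun n w hw => ?_⟩
  rcases Nat.eq_zero_or_pos n with rfl | hn
  · have : π (cyl 0 w) = 1 := by
      rw [← mem_ae_iff_prob_eq_one (measurableSet_cyl 0 w)]
      filter_upwards [hae] with g hg i hi
      rw [Nat.le_zero.1 hi, hw.1, (hg 0).1]
    simp [Measure.real, this, hw.1]
  · let w' : ℕ → ℕ := fun i => if i ≤ n then w i else w n + (i - n)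
    have hw' : ∀ i ≤ n, w' i = w i := fun i hi => if_pos hi
    have key := hcyl n hn w' (by rw [hw' 0 (by omega), hw.1]) fun i => by
      rw [abs_eq zero_le_one]
      rcases lt_or_ge i n with hi | hi
      · rw [hw' i (by omega), hw' (i + 1) (by omega)]
        have := hw.2 i hi
        omega
      · left
        have h1 : w' (i + 1) = w n + (i + 1 - n) := if_neg (by omega)
        have h2 : w' i = w n + (i - n) := by
          rcases Nat.lt_or_eq_of_le hi with h | rfl
          · exact if_neg (by omega)
          · rw [hw' n le_rfl]; omega
        rw [h1, h2]
        omega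
    have hset : cyl n w =ᵐ[π] {g : ℕ → ℕ | ∀ i, 1 ≤ i → i ≤ n → g i = w' i} := by
      filter_upwards [hae] with g hg
      refine propext ⟨fun h i _ hi => (h i hi).trans (hw' i hi).symm, fun h i hi => ?_⟩
      rcases Nat.eq_zero_or_pos i with rfl | h1
      · rw [(hg 0).1, hw.1]
      · exact (h i h1 hi).trans (hw' i hi)
    rw [Measure.real, measure_congr hset, key, hw' n le_rfl, ENNReal.toReal_div, ENNReal.toReal_pow,
      ENNReal.toReal_add (by simp) (by simp)]
    simp

theorem IsConditionedWalk.ae_tsum_corner {π : Measure (ℕ → ℕ)} (hπ : IsConditionedWalk π)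
    (f : ℕ → ℝ) (hf : Summable fun m => |f (m + 1)|) :
    ∀ᵐ h ∂π, (∑' n : ℕ, if 1 ≤ n ∧ h (n + 1) + h (n - 1) ≠ 2 * h n then f n else 0) =
      ∑' m, f (m + 1) * corner m h := by
  filter_upwards [hπ.ae_isWalk] with h hh
  have hterm : ∀ m, (if 1 ≤ m + 1 ∧ h (m + 1 + 1) + h (m + 1 - 1) ≠ 2 * h (m + 1)
      then f (m + 1) else 0) = f (m + 1) * corner m h := by
    intro m
    have h1 := (hh (m + 2)).2 m (by omega)
    have h2 := (hh (m + 2)).2 (m + 1) (by omega)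
    simp only [corner, Nat.add_sub_cancel, mul_ite, mul_one, mul_zero]
    refine if_congr ⟨fun h3 => ?_, fun h3 => ?_⟩ rfl rfl
    · have := h3.2
      change h (m + 1 + 1) = h m
      omega
    · have h3 : h (m + 1 + 1) = h m := h3
      omega
  have hs : Summable fun m => f (m + 1) * corner m h :=
    .of_norm_bounded hf fun m => by
      rw [norm_mul, Real.norm_of_nonneg (corner_nonneg m h)]
      exact mul_le_of_le_one_right (abs_nonneg _) (corner_le_one m h)
  rw [Summable.tsum_eq_zero_add]
  · simp only [hterm]
    simp
  · exact (summable_nat_add_iff 1).1 (by simpa only [hterm] using hs)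

/-- Average number of corners under the invariant measure: for every Schwartz `φ`,
`(1/N) Σ_{n ≥ 1} 1{ΔX_n ≠ 0} φ(n/N) → (1/2) ∫_0^∞ φ(x) dx` in `L¹(π)` as `N → ∞`. -/
theorem stmt5 (π : Measure (ℕ → ℕ)) [IsProbabilityMeasure π]
    (hsupp : π {h : ℕ → ℕ | h 0 = 0 ∧ ∀ n : ℕ, |((h (n + 1) : ℤ)) - (h n : ℤ)| = 1} = 1)
    (hcyl : ∀ N : ℕ, 1 ≤ N → ∀ h : ℕ → ℕ, h 0 = 0 →
      (∀ n : ℕ, |((h (n + 1) : ℤ)) - (h n : ℤ)| = 1) →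
      π {g : ℕ → ℕ | ∀ i, 1 ≤ i → i ≤ N → g i = h i} = ((h N : ℝ≥0∞) + 1) / 2 ^ N)
    (φ : SchwartzMap ℝ ℝ) :
    Tendsto
      (fun N : ℕ =>
        ∫ h, |(1 / (N : ℝ)) *
            (∑' n : ℕ, if 1 ≤ n ∧ h (n + 1) + h (n - 1) ≠ 2 * h n then φ ((n : ℝ) / N) else 0)
          - (1 / 2) * ∫ x in Set.Ioi (0 : ℝ), φ x| ∂π)
      atTop (𝓝 0) := by
  have hπ := isConditionedWalk_of_cylinder π hsupp hcyl
  obtain ⟨K, hK⟩ := φ.exists_abs_le_mul_inv_one_add_sq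
  have hK0 : 0 ≤ K := by simpa using (abs_nonneg _).trans (hK 0)
  have hφK : ∀ x, |φ x| ≤ K := fun x => (hK x).trans <|
    mul_le_of_le_one_right hK0 (inv_le_one_of_one_le₀ (by nlinarith [sq_nonneg x]))
  set I := ∫ x in Set.Ioi (0 : ℝ), φ x
  set J := ∫ x in Set.Ioi (0 : ℝ), |φ x|
  have hR : Tendsto (fun N : ℕ => 1 / (N : ℝ) * ∑' m : ℕ, φ (((m + 1 : ℕ) : ℝ) / N)) atTop
      (𝓝 I) := tendsto_riemann_sum_Ioi φ.continuous hK
  have hR' : Tendsto (fun N : ℕ => 1 / (N : ℝ) * ∑' m : ℕ, |φ (((m + 1 : ℕ) : ℝ) / N)|) atTop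
      (𝓝 J) := tendsto_riemann_sum_Ioi (f := fun x => |φ x|) φ.continuous.abs
        fun x => by simpa using hK x
  have hsqrt : Tendsto (fun N : ℕ => 1 / √(N : ℝ)) atTop (𝓝 0) :=
    tendsto_const_nhds.div_atTop (Real.tendsto_sqrt_atTop.comp tendsto_natCast_atTop_atTop)
  have hb : Tendsto (fun N : ℕ => 1 / √(N : ℝ) +
      3 * K * (1 / (N : ℝ) * ∑' m : ℕ, |φ (((m + 1 : ℕ) : ℝ) / N)|) * (1 / √(N : ℝ)) +
      K / 2 * (1 / (N : ℝ)) +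
      1 / 2 * |1 / (N : ℝ) * ∑' m : ℕ, φ (((m + 1 : ℕ) : ℝ) / N) - I|) atTop (𝓝 0) := by
    have := ((hsqrt.add ((hR'.const_mul (3 * K)).mul hsqrt)).add
      (tendsto_one_div_atTop_nhds_zero_nat.const_mul (K / 2))).add
      ((hR.sub_const I).abs.const_mul (1 / 2))
    simpa using this
  refine squeeze_zero' (.of_forall fun N => integral_nonneg fun h => abs_nonneg _) ?_ hb
  filter_upwards [eventually_ge_atTop 1] with N hN
  have hN' : (0 : ℝ) < N := by exact_mod_cast hN
  let c : ℕ → ℝ := fun m => φ (((m + 1 : ℕ) : ℝ) / N)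
  have hs : Summable fun m => |c m| := summable_abs_comp_div hK hN
  have hcK : ∀ m, |c m| ≤ K := fun m => hφK _
  have hcs : Summable c := hs.of_abs
  have hcorner : ∀ g, Summable fun m => c m * corner m g := fun g =>
    .of_norm_bounded hs fun m => by
      rw [norm_mul, Real.norm_of_nonneg (corner_nonneg m g)]
      exact mul_le_of_le_one_right (abs_nonneg _) (corner_le_one m g)
  have hsub : ∀ g, ∑' m, c m * (corner m g - 1 / 2) =
      ∑' m, c m * corner m g - 1 / 2 * ∑' m, c m := by
    intro g
    simp only [mul_sub]
    rw [(hcorner g).tsum_sub (hcs.mul_right _), tsum_mul_right, mul_comm (1 / 2 : ℝ)]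
  have hmain := hπ.integral_abs_tsum_corner_sub_le hcK hs (Real.sqrt_pos.2 hN')
  have hint : Integrable (fun g => |∑' m, c m * (corner m g - 1 / 2)|) π :=
    (integrable_tsum_corner_sub_half π hs).abs
  calc _ ≤ ∫ g, (1 / (N : ℝ) * |∑' m, c m * (corner m g - 1 / 2)| +
          1 / 2 * |1 / (N : ℝ) * ∑' m, c m - I|) ∂π := by
        refine integral_mono_of_nonneg (.of_forall fun g => abs_nonneg _)
          ((hint.const_mul _).add (integrable_const _)) ?_
        filter_upwards [hπ.ae_tsum_corner (fun n => φ ((n : ℝ) / N)) hs] with g hg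
        rw [hg]
        have : 1 / (N : ℝ) * ∑' m, c m * corner m g - 1 / 2 * I =
            1 / (N : ℝ) * ∑' m, c m * (corner m g - 1 / 2) +
              1 / 2 * (1 / (N : ℝ) * ∑' m, c m - I) := by rw [hsub]; ring
        change |1 / (N : ℝ) * ∑' m, c m * corner m g - 1 / 2 * I| ≤ _
        rw [this]
        refine (abs_add_le _ _).trans_eq ?_
        rw [abs_mul, abs_mul, abs_of_pos (by positivity : 0 < 1 / (N : ℝ)),
          abs_of_pos (by norm_num : (0 : ℝ) < 1 / 2)]
    _ = 1 / (N : ℝ) * ∫ g, |∑' m, c m * (corner m g - 1 / 2)| ∂π +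
          1 / 2 * |1 / (N : ℝ) * ∑' m, c m - I| := by
        rw [integral_add (hint.const_mul _) (integrable_const _), integral_const_mul]
        simp
    _ ≤ 1 / (N : ℝ) * (√(N : ℝ) + 3 * K * (∑' m, |c m|) / √(N : ℝ) + K / 2) +
          1 / 2 * |1 / (N : ℝ) * ∑' m, c m - I| := by gcongr
    _ = _ := by
        have h1 : 1 / (N : ℝ) * √(N : ℝ) = 1 / √(N : ℝ) := by
          rw [one_div, inv_mul_eq_div, Real.sqrt_div_self']
        rw [mul_add, mul_add, h1]
        simp only [c]
        ring
end

section
/- For all integers n ≥ m ≥ 0 and every real c ≥ 0, π(X_m − X_n ≥ c) ≤ π(X_n − X_m ≥ c); that is, the negative part of the increment X_n − X_m is stochastically dominated by its positive part. -/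
open MeasureTheory
open scoped ENNReal

namespace ConditionedWalk

/-- The set of trajectories of nearest-neighbour walks on `ℕ` started at `0`. -/
def paths : Set (ℕ → ℕ) :=
  {h | h 0 = 0 ∧ ∀ n : ℕ, |((h (n + 1) : ℤ)) - (h n : ℤ)| = 1}

/-- The trajectory is one higher at time `N + 1` than at time `N`. -/
def upStep (N : ℕ) : Set (ℕ → ℕ) := {g | g (N + 1) = g N + 1}

/-- The trajectory is one lower at time `N + 1` than at time `N`. -/
def downStep (N : ℕ) : Set (ℕ → ℕ) := {g | g (N + 1) + 1 = g N}

/-- The trajectory which follows `h` up to time `N`, sits at `v` at time `N + 1` and increases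
from then on. -/
def extend (h : ℕ → ℕ) (N v : ℕ) : ℕ → ℕ := fun i => if i ≤ N then h i else v + (i - (N + 1))

lemma extend_mem_paths {h : ℕ → ℕ} (hh : h ∈ paths) {N v : ℕ} (hv : |(v : ℤ) - h N| = 1) :
    extend h N v ∈ paths := by
  refine ⟨by simp [extend, hh.1], fun n => ?_⟩
  rcases lt_trichotomy n N with hn | rfl | hn
  · simpa [extend, hn.le, Nat.succ_le_of_lt hn] using hh.2 n
  · simpa [extend] using hv
  · have h1 : ¬ n + 1 ≤ N := by omega
    have h2 : ¬ n ≤ N := by omega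
    have h3 : n + 1 - (N + 1) = (n - (N + 1)) + 1 := by omega
    simp only [extend, h1, h2, if_false, h3]
    push_cast
    ring_nf
    simp

/-- The upper tail `P(S_j ≥ d)` of the simple symmetric random walk on `ℤ`. -/
noncomputable def walkTail : ℕ → ℤ → ℝ
  | 0, d => if d ≤ 0 then 1 else 0
  | j + 1, d => (walkTail j (d - 1) + walkTail j (d + 1)) / 2

lemma walkTail_antitone (j : ℕ) : Antitone (walkTail j) := by
  induction j with
  | zero =>
    intro a b hab
    simp only [walkTail]
    split_ifs <;> first | omega | norm_num
  | succ j ih =>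
    intro a b hab
    have h1 := ih (show a - 1 ≤ b - 1 by omega)
    have h2 := ih (show a + 1 ≤ b + 1 by omega)
    simp only [walkTail]
    linarith

lemma measurableSet_paths : MeasurableSet paths := by
  have h0 : MeasurableSet {h : ℕ → ℕ | h 0 = 0} :=
    measurableSet_eq_fun (measurable_pi_apply 0) measurable_const
  have h1 (n : ℕ) : MeasurableSet {h : ℕ → ℕ | |((h (n + 1) : ℤ)) - (h n : ℤ)| = 1} := by
    have : Measurable fun h : ℕ → ℕ => (h (n + 1), h n) :=
      (measurable_pi_apply _).prodMk (measurable_pi_apply _)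
    exact this (MeasurableSet.of_discrete (s := {p : ℕ × ℕ | |(p.1 : ℤ) - p.2| = 1}))
  have : paths = {h : ℕ → ℕ | h 0 = 0} ∩
      ⋂ n, {h : ℕ → ℕ | |((h (n + 1) : ℤ)) - (h n : ℤ)| = 1} := by
    ext h
    simp [paths]
  rw [this]
  exact h0.inter (MeasurableSet.iInter h1)

lemma measurableSet_upStep (N : ℕ) : MeasurableSet (upStep N) :=
  measurableSet_eq_fun (measurable_pi_apply _) ((measurable_pi_apply N).add_const 1)

variable {π : Measure (ℕ → ℕ)}

/-- A comparison of the masses of two events holds if it holds on every cylinder of length `N`. -/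
lemma measure_le_of_cylinders {S T : Set (ℕ → ℕ)} (N : ℕ)
    (hST : ∀ p : ℕ → ℕ, π ({g | ∀ i ≤ N, g i = p i} ∩ S) ≤ π ({g | ∀ i ≤ N, g i = p i} ∩ T)) :
    π S ≤ π T := by
  let r : (ℕ → ℕ) → (Fin (N + 1) → ℕ) := fun g i => g i
  have hr : Measurable r := measurable_pi_lambda _ fun i => measurable_pi_apply _
  have hfib (p : Fin (N + 1) → ℕ) : MeasurableSet (r ⁻¹' {p}) := hr (measurableSet_singleton p)
  have hsum (S : Set (ℕ → ℕ)) : π S = ∑' p : (Set.univ : Set (Fin (N + 1) → ℕ)),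
      π (r ⁻¹' {(p : Fin (N + 1) → ℕ)} ∩ S) := by
    have := tsum_measure_preimage_singleton (μ := π.restrict S) (f := r) Set.countable_univ
      fun p _ => hfib p
    simp only [Set.preimage_univ, Measure.restrict_apply_univ] at this
    rw [← this]
    exact tsum_congr fun p => Measure.restrict_apply (hfib p)
  rw [hsum S, hsum T]
  refine ENNReal.tsum_le_tsum fun ⟨p, _⟩ => ?_
  have hp : r ⁻¹' {p} = {g | ∀ i ≤ N, g i = if hi : i < N + 1 then p ⟨i, hi⟩ else 0} := by
    ext g
    simp only [r, Set.mem_preimage, Set.mem_singleton_iff, funext_iff, Set.mem_ofPred_eq]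
    constructor
    · intro h i hi
      rw [dif_pos (Nat.lt_succ_of_le hi)]
      exact h ⟨i, _⟩
    · rintro h ⟨i, hi⟩
      simpa [hi] using h i (Nat.le_of_lt_succ hi)
  simp only [hp]
  exact hST _

section

variable (hae : ∀ᵐ g ∂π, g ∈ paths)
  (hcyl : ∀ N : ℕ, 1 ≤ N → ∀ h ∈ paths,
    π {g : ℕ → ℕ | ∀ i, 1 ≤ i → i ≤ N → g i = h i} = ((h N : ℝ≥0∞) + 1) / 2 ^ N)

include hae hcyl in
lemma measure_cylinder_inter {h : ℕ → ℕ} (hh : h ∈ paths) {N v : ℕ}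
    (hv : |(v : ℤ) - h N| = 1) :
    π ({g | ∀ i ≤ N, g i = h i} ∩ {g | g (N + 1) = v}) = ((v : ℝ≥0∞) + 1) / 2 ^ (N + 1) := by
  have hcyl' := hcyl (N + 1) (by omega) _ (extend_mem_paths hh hv)
  rw [show extend h N v (N + 1) = v by simp [extend]] at hcyl'
  rw [← hcyl']
  refine measure_congr ?_
  filter_upwards [hae] with g hg
  refine propext ⟨fun ⟨h1, h2⟩ i _ hi => ?_, fun H => ⟨fun i hi => ?_, ?_⟩⟩
  · rcases Nat.le_succ_iff.1 hi with hi' | rfl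
    · simpa [extend, hi'] using h1 i hi'
    · simpa [extend] using h2
  · rcases Nat.eq_zero_or_pos i with rfl | hpos
    · rw [hg.1, hh.1]
    · simpa [extend, hi] using H i hpos (by omega)
  · simpa [extend] using H (N + 1) (by omega) le_rfl

include hae hcyl in
/-- Given the past, an upward step is at least as likely as a downward one. -/
lemma measure_downStep_le_upStep {A : Set (ℕ → ℕ)} {N : ℕ} (hA : DependsOn (· ∈ A) (Set.Iic N)) :
    π (A ∩ downStep N) ≤ π (A ∩ upStep N) := by
  refine measure_le_of_cylinders N fun p => ?_
  by_cases hp : ∃ h ∈ paths, h ∈ A ∧ ∀ i ≤ N, h i = p i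
  · obtain ⟨h, hh, hhA, hhp⟩ := hp
    have hcylA : {g | ∀ i ≤ N, g i = p i} ∩ A = {g | ∀ i ≤ N, g i = h i} := by
      ext g
      constructor
      · exact fun hg i hi => (hg.1 i hi).trans (hhp i hi).symm
      · refine fun hg => ⟨fun i hi => (hg i hi).trans (hhp i hi), ?_⟩
        exact (hA fun i hi => hg i hi : (g ∈ A) = (h ∈ A)).mpr hhA
    rw [← Set.inter_assoc, ← Set.inter_assoc, hcylA]
    have hup : {g | ∀ i ≤ N, g i = h i} ∩ upStep N =
        {g | ∀ i ≤ N, g i = h i} ∩ {g | g (N + 1) = h N + 1} := by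
      ext g
      refine and_congr_right fun hg => ?_
      simp [upStep, hg N le_rfl]
    rw [hup, measure_cylinder_inter hae hcyl hh (by simp)]
    rcases Nat.eq_zero_or_pos (h N) with h0 | hpos
    · have hdown : {g | ∀ i ≤ N, g i = h i} ∩ downStep N = ∅ := by
        ext g
        simp only [Set.mem_inter_iff, Set.mem_empty_iff_false, iff_false, not_and]
        intro hg
        simp [downStep, hg N le_rfl, h0]
      simp [hdown]
    · have hdown : {g | ∀ i ≤ N, g i = h i} ∩ downStep N =
          {g | ∀ i ≤ N, g i = h i} ∩ {g | g (N + 1) = h N - 1} := by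
        ext g
        refine and_congr_right fun hg => ?_
        have := hg N le_rfl
        simp only [downStep, Set.mem_ofPred_eq]
        omega
      rw [hdown, measure_cylinder_inter hae hcyl hh (by
        rw [Nat.cast_sub hpos]; simp)]
      gcongr
      omega
  · refine le_of_eq_of_le (measure_mono_null ?_ (ae_iff.1 hae)) zero_le
    exact fun g hg hgp => hp ⟨g, hgp, hg.2.1, hg.1⟩

end

lemma dependsOn_inter_step {A T : Set (ℕ → ℕ)} {N : ℕ} (hA : DependsOn (· ∈ A) (Set.Iic N))
    (hT : ∀ g h : ℕ → ℕ, g N = h N → g (N + 1) = h (N + 1) → (g ∈ T ↔ h ∈ T)) :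
    DependsOn (· ∈ A ∩ T) (Set.Iic (N + 1)) := by
  intro g h hgh
  have h1 : (g ∈ A) = (h ∈ A) := hA fun i hi => hgh i (le_trans hi (Nat.le_succ N))
  have h2 := hT g h (hgh N (Nat.le_succ N)) (hgh (N + 1) Set.self_mem_Iic)
  simp only [Set.mem_inter_iff, h1, h2]

lemma dependsOn_inter_upStep {A : Set (ℕ → ℕ)} {N : ℕ} (hA : DependsOn (· ∈ A) (Set.Iic N)) :
    DependsOn (· ∈ A ∩ upStep N) (Set.Iic (N + 1)) :=
  dependsOn_inter_step hA fun g h h1 h2 => by simp [upStep, h1, h2]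

lemma dependsOn_inter_downStep {A : Set (ℕ → ℕ)} {N : ℕ} (hA : DependsOn (· ∈ A) (Set.Iic N)) :
    DependsOn (· ∈ A ∩ downStep N) (Set.Iic (N + 1)) :=
  dependsOn_inter_step hA fun g h h1 h2 => by simp [downStep, h1, h2]

section

variable [IsProbabilityMeasure π] (hae : ∀ᵐ g ∂π, g ∈ paths)

include hae in
lemma measureReal_split_step (A : Set (ℕ → ℕ)) (N : ℕ) :
    π.real A = π.real (A ∩ upStep N) + π.real (A ∩ downStep N) := by
  rw [← measureReal_inter_add_sdiff (s := A) (measurableSet_upStep N)]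
  congr 1
  refine measureReal_congr ?_
  filter_upwards [hae] with g hg
  refine propext (and_congr_right fun _ => ?_)
  have := hg.2 N
  rw [abs_eq zero_le_one] at this
  change ¬ (g (N + 1) = g N + 1) ↔ g (N + 1) + 1 = g N
  omega

variable (hstep : ∀ (N : ℕ) (A : Set (ℕ → ℕ)), DependsOn (· ∈ A) (Set.Iic N) →
  π (A ∩ downStep N) ≤ π (A ∩ upStep N))

include hae hstep in
/-- The increments of the walk stochastically dominate those of the simple random walk. -/
lemma walkTail_mul_le (j : ℕ) : ∀ (N : ℕ) (A : Set (ℕ → ℕ)) (d : ℤ),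
    DependsOn (· ∈ A) (Set.Iic N) →
    walkTail j d * π.real A ≤ π.real (A ∩ {g | (g N : ℤ) + d ≤ g (N + j)}) := by
  induction j with
  | zero =>
    intro N A d _
    by_cases hd : d ≤ 0 <;> simp [walkTail, hd]
  | succ j ih =>
    intro N A d hA
    have hdu : π.real (A ∩ downStep N) ≤ π.real (A ∩ upStep N) :=
      ENNReal.toReal_mono (measure_ne_top _ _) (hstep N A hA)
    have hup := ih (N + 1) _ (d - 1) (dependsOn_inter_upStep hA)
    have hdown := ih (N + 1) _ (d + 1) (dependsOn_inter_downStep hA)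
    have htail := walkTail_antitone j (show d - 1 ≤ d + 1 by omega)
    have eup : A ∩ upStep N ∩ {g | (g (N + 1) : ℤ) + (d - 1) ≤ g (N + 1 + j)} =
        A ∩ {g | (g N : ℤ) + d ≤ g (N + (j + 1))} ∩ upStep N := by
      rw [Set.inter_right_comm A _ (upStep N)]
      ext g
      refine and_congr_right fun hg => ?_
      have : g (N + 1) = g N + 1 := hg.2
      simp only [Set.mem_ofPred_eq, show N + 1 + j = N + (j + 1) by omega]
      omega
    have edown : A ∩ downStep N ∩ {g | (g (N + 1) : ℤ) + (d + 1) ≤ g (N + 1 + j)} =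
        A ∩ {g | (g N : ℤ) + d ≤ g (N + (j + 1))} ∩ downStep N := by
      rw [Set.inter_right_comm A _ (downStep N)]
      ext g
      refine and_congr_right fun hg => ?_
      have : g (N + 1) + 1 = g N := hg.2
      simp only [Set.mem_ofPred_eq, show N + 1 + j = N + (j + 1) by omega]
      omega
    rw [eup] at hup
    rw [edown] at hdown
    rw [measureReal_split_step hae (A ∩ {g | (g N : ℤ) + d ≤ g (N + (j + 1))}) N,
      measureReal_split_step hae A N, walkTail]
    nlinarith

include hae hstep in
/-- The decrements of the walk are stochastically dominated by those of the simple random walk. -/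
lemma le_walkTail_mul (j : ℕ) : ∀ (N : ℕ) (A : Set (ℕ → ℕ)) (d : ℤ),
    DependsOn (· ∈ A) (Set.Iic N) →
    π.real (A ∩ {g | (g (N + j) : ℤ) + d ≤ g N}) ≤ walkTail j d * π.real A := by
  induction j with
  | zero =>
    intro N A d _
    by_cases hd : d ≤ 0 <;> simp [walkTail, hd]
  | succ j ih =>
    intro N A d hA
    have hdu : π.real (A ∩ downStep N) ≤ π.real (A ∩ upStep N) :=
      ENNReal.toReal_mono (measure_ne_top _ _) (hstep N A hA)
    have hup := ih (N + 1) _ (d + 1) (dependsOn_inter_upStep hA)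
    have hdown := ih (N + 1) _ (d - 1) (dependsOn_inter_downStep hA)
    have htail := walkTail_antitone j (show d - 1 ≤ d + 1 by omega)
    have eup : A ∩ upStep N ∩ {g | (g (N + 1 + j) : ℤ) + (d + 1) ≤ g (N + 1)} =
        A ∩ {g | (g (N + (j + 1)) : ℤ) + d ≤ g N} ∩ upStep N := by
      rw [Set.inter_right_comm A _ (upStep N)]
      ext g
      refine and_congr_right fun hg => ?_
      have : g (N + 1) = g N + 1 := hg.2
      simp only [Set.mem_ofPred_eq, show N + 1 + j = N + (j + 1) by omega]
      omega
    have edown : A ∩ downStep N ∩ {g | (g (N + 1 + j) : ℤ) + (d - 1) ≤ g (N + 1)} =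
        A ∩ {g | (g (N + (j + 1)) : ℤ) + d ≤ g N} ∩ downStep N := by
      rw [Set.inter_right_comm A _ (downStep N)]
      ext g
      refine and_congr_right fun hg => ?_
      have : g (N + 1) + 1 = g N := hg.2
      simp only [Set.mem_ofPred_eq, show N + 1 + j = N + (j + 1) by omega]
      omega
    rw [eup] at hup
    rw [edown] at hdown
    rw [measureReal_split_step hae (A ∩ {g | (g (N + (j + 1)) : ℤ) + d ≤ g N}) N,
      measureReal_split_step hae A N, walkTail]
    nlinarith

end

end ConditionedWalk

open ConditionedWalk in
/-- Stochastic domination of the negative part of the increment `X_n - X_m` by its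
positive part: for `n ≥ m` and `c ≥ 0`, `π(X_m - X_n ≥ c) ≤ π(X_n - X_m ≥ c)`. -/
theorem stmt8 (π : Measure (ℕ → ℕ)) [IsProbabilityMeasure π]
    (hsupp : π {h : ℕ → ℕ | h 0 = 0 ∧ ∀ n : ℕ, |((h (n + 1) : ℤ)) - (h n : ℤ)| = 1} = 1)
    (hcyl : ∀ N : ℕ, 1 ≤ N → ∀ h : ℕ → ℕ, h 0 = 0 →
      (∀ n : ℕ, |((h (n + 1) : ℤ)) - (h n : ℤ)| = 1) →
      π {g : ℕ → ℕ | ∀ i, 1 ≤ i → i ≤ N → g i = h i} = ((h N : ℝ≥0∞) + 1) / 2 ^ N)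
    (n m : ℕ) (hmn : m ≤ n) (c : ℝ) (hc : 0 ≤ c) :
    π {h : ℕ → ℕ | c ≤ (h m : ℝ) - (h n : ℝ)} ≤ π {h : ℕ → ℕ | c ≤ (h n : ℝ) - (h m : ℝ)} := by
  have hae : ∀ᵐ g ∂π, g ∈ paths :=
    (mem_ae_iff_prob_eq_one measurableSet_paths).2 hsupp
  have hstep : ∀ (N : ℕ) (A : Set (ℕ → ℕ)), DependsOn (· ∈ A) (Set.Iic N) →
      π (A ∩ downStep N) ≤ π (A ∩ upStep N) := fun N A hA =>
    measure_downStep_le_upStep hae (fun N hN h hh => hcyl N hN h hh.1 hh.2) hA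
  obtain ⟨j, rfl⟩ := Nat.exists_eq_add_of_le hmn
  have hceil (a b : ℕ) : c ≤ (a : ℝ) - b ↔ (b : ℤ) + ⌈c⌉ ≤ a := by
    rw [← le_sub_iff_add_le', Int.ceil_le]
    push_cast
    rfl
  have huniv : DependsOn (· ∈ (Set.univ : Set (ℕ → ℕ))) (Set.Iic m) := fun _ _ _ => rfl
  have hlow := walkTail_mul_le hae hstep j m Set.univ ⌈c⌉ huniv
  have hupp := le_walkTail_mul hae hstep j m Set.univ ⌈c⌉ huniv
  rw [Set.univ_inter] at hlow hupp
  simp only [hceil]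
  exact (ENNReal.toReal_le_toReal (measure_ne_top _ _) (measure_ne_top _ _)).1 (hupp.trans hlow)
end

section
/- Fix an integer k ≥ 1 and suppose a > 0 is such that ∫ X_n^{2k} dπ ≤ a·n^k for every n ∈ ℕ. Then for all n, m ∈ ℕ, ∫ (X_n − X_m)^{2k} dπ ≤ 2a·|n − m|^k. -/
open MeasureTheory
open scoped ENNReal

/-- Averaging operator of a nearest-neighbour walk on `ℤ` with up-probabilities `u`. -/
noncomputable def walkStep (u : ℤ → ℝ) : (ℤ → ℝ) →ₗ[ℝ] (ℤ → ℝ) where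
  toFun g d := u d * g (d + 1) + (1 - u d) * g (d - 1)
  map_add' f g := by ext d; simp only [Pi.add_apply]; ring
  map_smul' c g := by ext d; simp only [Pi.smul_apply, smul_eq_mul, RingHom.id_apply]; ring

lemma walkStep_apply (u g : ℤ → ℝ) (d : ℤ) :
    walkStep u g d = u d * g (d + 1) + (1 - u d) * g (d - 1) := rfl

/-- Monotonicity along each of the two parity classes is preserved by `walkStep`. -/
lemma walkStep_le_add_two {u g : ℤ → ℝ} (h0 : ∀ d, 0 ≤ u d) (h1 : ∀ d, u d ≤ 1)
    (hg : ∀ d, g d ≤ g (d + 2)) (d : ℤ) : walkStep u g d ≤ walkStep u g (d + 2) := by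
  have e1 := hg (d - 1)
  have e2 := hg (d + 1)
  rw [show d - 1 + 2 = d + 1 by ring] at e1
  rw [walkStep_apply, walkStep_apply, show d + 2 - 1 = d + 1 by ring,
    show d + 2 + 1 = d + 1 + 2 by ring]
  nlinarith [mul_nonneg (sub_nonneg.2 (h1 d)) (sub_nonneg.2 e1),
    mul_nonneg (h0 (d + 2)) (sub_nonneg.2 e2)]

lemma walkStep_mono {u f g : ℤ → ℝ} (h0 : ∀ d, 0 ≤ u d) (h1 : ∀ d, u d ≤ 1) (hfg : f ≤ g) :
    walkStep u f ≤ walkStep u g := fun d =>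
  add_le_add (mul_le_mul_of_nonneg_left (hfg _) (h0 d))
    (mul_le_mul_of_nonneg_left (hfg _) (sub_nonneg.2 (h1 d)))

lemma walkStep_pow_mono {u f g : ℤ → ℝ} (h0 : ∀ d, 0 ≤ u d) (h1 : ∀ d, u d ≤ 1) (hfg : f ≤ g)
    (r : ℕ) : (walkStep u ^ r) f ≤ (walkStep u ^ r) g := by
  induction r with
  | zero => simpa using hfg
  | succ r ih =>
    rw [pow_succ', Module.End.mul_apply, Module.End.mul_apply]
    exact walkStep_mono h0 h1 ih

lemma walkStep_pow_le_add_two {u g : ℤ → ℝ} (h0 : ∀ d, 0 ≤ u d) (h1 : ∀ d, u d ≤ 1)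
    (hg : ∀ d, g d ≤ g (d + 2)) (r : ℕ) (d : ℤ) :
    (walkStep u ^ r) g d ≤ (walkStep u ^ r) g (d + 2) := by
  induction r generalizing d with
  | zero => simpa using hg d
  | succ r ih =>
    rw [pow_succ', Module.End.mul_apply]
    exact walkStep_le_add_two h0 h1 ih d

/-- Stochastic comparison of two nearest-neighbour walks with ordered up-probabilities. -/
lemma walkStep_pow_le_walkStep_pow {u v g : ℤ → ℝ} (h0 : ∀ d, 0 ≤ u d) (h1 : ∀ d, v d ≤ 1)
    (huv : ∀ d, u d ≤ v d) (hg : ∀ d, g d ≤ g (d + 2)) (r : ℕ) :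
    (walkStep u ^ r) g ≤ (walkStep v ^ r) g := by
  have hv0 : ∀ d, 0 ≤ v d := fun d => (h0 d).trans (huv d)
  induction r with
  | zero => simp
  | succ r ih =>
    rw [pow_succ', pow_succ', Module.End.mul_apply, Module.End.mul_apply]
    refine (walkStep_mono h0 (fun d => (huv d).trans (h1 d)) ih).trans fun d => ?_
    have e := walkStep_pow_le_add_two hv0 h1 hg r (d - 1)
    rw [show d - 1 + 2 = d + 1 by ring] at e
    rw [walkStep_apply, walkStep_apply]
    nlinarith [mul_nonneg (sub_nonneg.2 (huv d)) (sub_nonneg.2 e)]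

lemma walkStep_pow_shift (u g : ℤ → ℝ) (x : ℤ) (r : ℕ) (d : ℤ) :
    (walkStep u ^ r) (fun y => g (y - x)) (d + x) = (walkStep (fun y => u (y + x)) ^ r) g d := by
  induction r generalizing d with
  | zero => simp
  | succ r ih =>
    rw [pow_succ', pow_succ', Module.End.mul_apply, Module.End.mul_apply, walkStep_apply,
      walkStep_apply, ← ih, ← ih]
    ring_nf

lemma walkStep_half_pow_comp_neg (g : ℤ → ℝ) (r : ℕ) (d : ℤ) :
    (walkStep (fun _ => 1 / 2) ^ r) (fun y => g (-y)) d
      = (walkStep (fun _ => 1 / 2) ^ r) g (-d) := by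
  induction r generalizing d with
  | zero => simp
  | succ r ih =>
    rw [pow_succ', Module.End.mul_apply, Module.End.mul_apply, walkStep_apply,
      walkStep_apply, ih, ih]
    ring_nf

/-- Up-probabilities of the simple random walk conditioned to stay nonnegative, extended by `1`
to the negative integers. -/
noncomputable def condUp (y : ℤ) : ℝ := if y ≤ 0 then 1 else ((y : ℝ) + 2) / (2 * (y + 1))

lemma condUp_natCast (n : ℕ) : condUp n = ((n : ℝ) + 2) / (2 * (n + 1)) := by
  unfold condUp
  split_ifs with h
  · obtain rfl : n = 0 := by omega
    norm_num
  · simp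

lemma half_le_condUp (y : ℤ) : 1 / 2 ≤ condUp y := by
  unfold condUp
  split_ifs with h
  · norm_num
  · have : (0 : ℝ) < y := by exact_mod_cast not_le.1 h
    rw [div_le_div_iff₀ (by norm_num) (by positivity)]
    linarith

lemma condUp_antitone : Antitone condUp := by
  intro x y hxy
  unfold condUp
  split_ifs with h h' h'
  · exact le_rfl
  · omega
  · have : (0 : ℝ) < y := by exact_mod_cast not_le.1 h
    rw [div_le_one (by positivity)]
    linarith
  · have hy : (0 : ℝ) < y := by exact_mod_cast not_le.1 h
    have hx : (0 : ℝ) < x := by exact_mod_cast not_le.1 h'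
    have hxy' : (x : ℝ) ≤ y := by exact_mod_cast hxy
    rw [div_le_div_iff₀ (by positivity) (by positivity)]
    nlinarith

lemma condUp_le_one (y : ℤ) : condUp y ≤ 1 := by
  have h := condUp_antitone (min_le_left y 0)
  have h' : condUp (min y 0) = 1 := if_pos (min_le_right _ _)
  exact h.trans h'.le

lemma condUp_nonneg (y : ℤ) : 0 ≤ condUp y := by linarith [half_le_condUp y]

/-- The even moments of the increment of the conditioned walk started at `x` are at most twice the
corresponding moments of the walk started at `0`. -/
lemma walkStep_condUp_pow_sub_pow_le (k : ℕ) (hk : 1 ≤ k) (r x : ℕ) :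
    (walkStep condUp ^ r) (fun y => ((y : ℝ) - x) ^ (2 * k)) x
      ≤ 2 * (walkStep condUp ^ r) (fun y => (y : ℝ) ^ (2 * k)) 0 := by
  set g : ℤ → ℝ := fun y => (y : ℝ) ^ (2 * k) with hgdef
  set p : ℤ → ℝ := fun y => (max (y : ℝ) 0) ^ (2 * k) with hpdef
  set q : ℤ → ℝ := fun y => p (-y) with hqdef
  set v : ℤ → ℝ := fun y => condUp (y + x) with hvdef
  have hk' : 2 * k ≠ 0 := by omega
  have hgpq : g = p + q := by
    ext y
    simp only [hgdef, hpdef, hqdef, Pi.add_apply, Int.cast_neg]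
    rcases le_total (y : ℝ) 0 with h | h
    · rw [max_eq_right h, max_eq_left (by linarith), zero_pow hk', zero_add,
        (even_two_mul k).neg_pow]
    · rw [max_eq_left h, max_eq_right (by linarith), zero_pow hk', add_zero]
  have hp_mono : Monotone p := fun y z hyz =>
    pow_le_pow_left₀ (le_max_right _ _) (max_le_max (by exact_mod_cast hyz) le_rfl) _
  have hp2 : ∀ d, p d ≤ p (d + 2) := fun d => hp_mono (by omega)
  have hq2 : ∀ d, (-q) d ≤ (-q) (d + 2) := fun d => neg_le_neg (hp_mono (by omega))
  have hpg : p ≤ g := by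
    rw [hgpq]
    exact le_add_of_nonneg_right fun y => pow_nonneg (le_max_right _ _) _
  have hv0 : ∀ d, 0 ≤ v d := fun d => condUp_nonneg _
  have hv1 : ∀ d, v d ≤ 1 := fun d => condUp_le_one _
  have hp0 : (walkStep condUp ^ r) p 0 ≤ (walkStep condUp ^ r) g 0 :=
    walkStep_pow_mono condUp_nonneg condUp_le_one hpg r 0
  have hvp : (walkStep v ^ r) p 0 ≤ (walkStep condUp ^ r) p 0 :=
    walkStep_pow_le_walkStep_pow hv0 condUp_le_one
      (fun d => condUp_antitone (by omega)) hp2 r 0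
  have hsp : (walkStep (fun _ => 1 / 2) ^ r) p 0 ≤ (walkStep condUp ^ r) p 0 :=
    walkStep_pow_le_walkStep_pow (fun _ => by norm_num) condUp_le_one half_le_condUp hp2 r 0
  have hvq : (walkStep (fun _ => 1 / 2) ^ r) (-q) 0 ≤ (walkStep v ^ r) (-q) 0 :=
    walkStep_pow_le_walkStep_pow (fun _ => by norm_num) hv1 (fun d => half_le_condUp _) hq2 r 0
  have hqs : (walkStep (fun _ => 1 / 2) ^ r) q 0 = (walkStep (fun _ => 1 / 2) ^ r) p 0 :=
    walkStep_half_pow_comp_neg p r 0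
  rw [map_neg, map_neg, Pi.neg_apply, Pi.neg_apply] at hvq
  have hshift := walkStep_pow_shift condUp g x r 0
  rw [zero_add] at hshift
  simp only [hgdef, Int.cast_sub, Int.cast_natCast] at hshift
  rw [hshift]
  change (walkStep v ^ r) g 0 ≤ _
  have hsum : (walkStep v ^ r) g 0 = (walkStep v ^ r) p 0 + (walkStep v ^ r) q 0 := by
    rw [hgpq, map_add, Pi.add_apply]
  rw [hsum]
  linarith

/-- Nearest-neighbour paths in `ℕ` started at `0`. -/
def IsNatWalk (h : ℕ → ℕ) : Prop :=
  h 0 = 0 ∧ ∀ n : ℕ, |((h (n + 1) : ℤ)) - (h n : ℤ)| = 1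

lemma IsNatWalk.succ_eq {h : ℕ → ℕ} (hh : IsNatWalk h) (n : ℕ) :
    h (n + 1) = h n + 1 ∨ h (n + 1) + 1 = h n := by
  have := hh.2 n
  rcases (abs_eq (by norm_num)).1 this with e | e <;> omega

lemma IsNatWalk.le {h : ℕ → ℕ} (hh : IsNatWalk h) (n : ℕ) : h n ≤ n := by
  induction n with
  | zero => exact hh.1.le
  | succ n ih => rcases hh.succ_eq n with e | e <;> omega

/-- Follow `h` up to time `n`, then go up forever. -/
def upAfter (h : ℕ → ℕ) (n i : ℕ) : ℕ := if i ≤ n then h i else h n + (i - n)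

lemma IsNatWalk.upAfter {h : ℕ → ℕ} (hh : IsNatWalk h) (n : ℕ) : IsNatWalk (upAfter h n) := by
  refine ⟨by simp [_root_.upAfter, hh.1], fun i => ?_⟩
  unfold _root_.upAfter
  rcases lt_trichotomy i n with hi | rfl | hi
  · rw [if_pos (by omega), if_pos hi.le]
    exact hh.2 i
  · simp
  · rw [if_neg (by omega), if_neg (by omega), show i + 1 - n = i - n + 1 by omega]
    push_cast
    ring_nf
    simp

lemma measurableSet_isNatWalk : MeasurableSet {h : ℕ → ℕ | IsNatWalk h} := by
  have hset : {h : ℕ → ℕ | IsNatWalk h} = {h | h 0 = 0} ∩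
      ⋂ n : ℕ, {h : ℕ → ℕ | |((h (n + 1) : ℤ)) - (h n : ℤ)| = 1} := by
    ext; simp [IsNatWalk]
  rw [hset]
  refine MeasurableSet.inter (measurableSet_eq_fun (measurable_pi_apply 0) measurable_const)
    (MeasurableSet.iInter fun n => ?_)
  have : Measurable fun h : ℕ → ℕ => (h (n + 1), h n) := by fun_prop
  exact this (MeasurableSet.of_discrete (s := {p : ℕ × ℕ | |(p.1 : ℤ) - (p.2 : ℤ)| = 1}))

/-- Integrability of functions of two coordinates of a nearest-neighbour path. -/
lemma integrable_of_isNatWalk {π : Measure (ℕ → ℕ)} [IsProbabilityMeasure π]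
    (hw : ∀ᵐ h ∂π, IsNatWalk h) (F : ℕ → ℕ → ℝ) (m n : ℕ) :
    Integrable (fun h : ℕ → ℕ => F (h m) (h n)) π := by
  have hmeas : Measurable fun h : ℕ → ℕ => F (h m) (h n) := by
    have h1 : Measurable fun h : ℕ → ℕ => (h m, h n) := by fun_prop
    exact (measurable_of_countable fun p : ℕ × ℕ => F p.1 p.2).comp h1
  refine Integrable.of_bound hmeas.aestronglyMeasurable
    (∑ p ∈ Finset.range (m + 1) ×ˢ Finset.range (n + 1), |F p.1 p.2|) ?_
  filter_upwards [hw] with h hh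
  exact Finset.single_le_sum (f := fun p : ℕ × ℕ => |F p.1 p.2|) (a := (h m, h n))
    (fun _ _ => abs_nonneg _)
    (by simp [hh.le m, hh.le n])

/-- One-step Markov property on a cylinder. -/
lemma setIntegral_cylinder_succ {π : Measure (ℕ → ℕ)} [IsProbabilityMeasure π]
    (hw : ∀ᵐ h ∂π, IsNatWalk h)
    (hcyl : ∀ N : ℕ, ∀ h : ℕ → ℕ, IsNatWalk h →
      π.real {g : ℕ → ℕ | ∀ i ≤ N, g i = h i} = ((h N : ℝ) + 1) / 2 ^ N)
    (G : ℕ → ℤ → ℝ) {m n : ℕ} (hmn : m ≤ n) {h : ℕ → ℕ} (hh : IsNatWalk h) :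
    ∫ g in {g : ℕ → ℕ | ∀ i ≤ n, g i = h i}, G (g m) (g (n + 1) : ℕ) ∂π
      = ∫ g in {g : ℕ → ℕ | ∀ i ≤ n, g i = h i}, walkStep condUp (G (g m)) (g n : ℕ) ∂π := by
  set C : Set (ℕ → ℕ) := {g | ∀ i ≤ n, g i = h i} with hC
  set U : Set (ℕ → ℕ) := {g | g (n + 1) = h n + 1} with hU
  have hCm : MeasurableSet C := by
    rw [show C = ⋂ i, ⋂ (_ : i ≤ n), {g : ℕ → ℕ | g i = h i} by ext; simp [hC]]
    exact MeasurableSet.iInter fun i => MeasurableSet.iInter fun _ =>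
      measurableSet_eq_fun (measurable_pi_apply i) measurable_const
  have hUm : MeasurableSet U :=
    measurableSet_eq_fun (measurable_pi_apply (n + 1)) measurable_const
  have hCU : C ∩ U = {g : ℕ → ℕ | ∀ i ≤ n + 1, g i = upAfter h n i} := by
    ext g
    simp only [hC, hU, Set.mem_inter_iff, Set.mem_ofPred_eq, upAfter]
    constructor
    · rintro ⟨h1, h2⟩ i hi
      split_ifs with h'
      · exact h1 i h'
      · obtain rfl : i = n + 1 := by omega
        rw [h2]; omega
    · intro H
      refine ⟨fun i hi => by simpa [hi] using H i (by omega), by simpa using H (n + 1) le_rfl⟩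
  have hpC := hcyl n h hh
  have hpCU : π.real (C ∩ U) = ((h n : ℝ) + 2) / 2 ^ (n + 1) := by
    rw [hCU, hcyl (n + 1) _ (hh.upAfter n)]
    simp [upAfter]
    ring
  have hpD : π.real (C \ U) = π.real C - π.real (C ∩ U) := by
    rw [← measureReal_inter_add_sdiff (s := C) hUm]; ring
  have hint : Integrable (fun g : ℕ → ℕ => G (g m) (g (n + 1) : ℕ)) π :=
    integrable_of_isNatWalk hw (fun i j => G i (j : ℕ)) m (n + 1)
  have hup : ∫ g in C ∩ U, G (g m) (g (n + 1) : ℕ) ∂π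
      = π.real (C ∩ U) * G (h m) ((h n : ℤ) + 1) := by
    rw [setIntegral_congr_fun (g := fun _ => G (h m) ((h n : ℤ) + 1)) (hCm.inter hUm)]
    · simp
    · intro g hg
      have e1 : g m = h m := hg.1 m hmn
      have e2 : g (n + 1) = h n + 1 := hg.2
      simp [e1, e2]
  have hdown : ∫ g in C \ U, G (g m) (g (n + 1) : ℕ) ∂π
      = π.real (C \ U) * G (h m) ((h n : ℤ) - 1) := by
    rw [setIntegral_congr_ae (g := fun _ => G (h m) ((h n : ℤ) - 1)) (hCm.diff hUm)]
    · simp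
    · filter_upwards [hw] with g hgw hg
      have e1 : g m = h m := hg.1 m hmn
      have e2 : g n = h n := hg.1 n le_rfl
      have e3 : g (n + 1) ≠ h n + 1 := hg.2
      have e4 : ((g (n + 1) : ℕ) : ℤ) = (h n : ℤ) - 1 := by
        rcases hgw.succ_eq n with e | e <;> omega
      rw [e1, e4]
  have hright : ∫ g in C, walkStep condUp (G (g m)) (g n : ℕ) ∂π
      = π.real C * walkStep condUp (G (h m)) (h n : ℕ) := by
    rw [setIntegral_congr_fun (g := fun _ => walkStep condUp (G (h m)) (h n : ℕ)) hCm]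
    · simp
    · intro g hg
      have e1 : g m = h m := hg m hmn
      have e2 : g n = h n := hg n le_rfl
      simp [e1, e2]
  rw [hright, ← integral_inter_add_sdiff hUm hint.integrableOn, hup, hdown, hpD, hpCU, hpC,
    walkStep_apply, condUp_natCast, pow_succ]
  have : (h n : ℝ) + 1 ≠ 0 := by positivity
  field_simp

/-- One-step Markov property. -/
lemma integral_succ_eq {π : Measure (ℕ → ℕ)} [IsProbabilityMeasure π]
    (hw : ∀ᵐ h ∂π, IsNatWalk h)
    (hcyl : ∀ N : ℕ, ∀ h : ℕ → ℕ, IsNatWalk h →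
      π.real {g : ℕ → ℕ | ∀ i ≤ N, g i = h i} = ((h N : ℝ) + 1) / 2 ^ N)
    (G : ℕ → ℤ → ℝ) {m n : ℕ} (hmn : m ≤ n) :
    ∫ g, G (g m) (g (n + 1) : ℕ) ∂π = ∫ g, walkStep condUp (G (g m)) (g n : ℕ) ∂π := by
  let T : (ℕ → ℕ) → (Fin (n + 1) → ℕ) := fun g i => g i
  have hT : Measurable T := by fun_prop
  have hTm : ∀ p, MeasurableSet (T ⁻¹' {p}) := fun p => hT (measurableSet_singleton p)
  have hdisj : Pairwise (Function.onFun Disjoint fun p => T ⁻¹' {p}) := fun p q hpq =>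
    Disjoint.preimage T (Set.disjoint_singleton.2 hpq)
  have hcover : (⋃ p, T ⁻¹' {p}) = Set.univ := by ext; simp
  have hsplit : ∀ F : (ℕ → ℕ) → ℝ, Integrable F π →
      ∫ g, F g ∂π = ∑' p, ∫ g in T ⁻¹' {p}, F g ∂π := fun F hF => by
    rw [← integral_iUnion hTm hdisj hF.integrableOn, hcover, setIntegral_univ]
  rw [hsplit _ (integrable_of_isNatWalk hw (fun i j => G i (j : ℕ)) m (n + 1)),
    hsplit _ (integrable_of_isNatWalk hw (fun i j => walkStep condUp (G i) (j : ℕ)) m n)]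
  refine tsum_congr fun p => ?_
  by_cases hp : ∃ h, IsNatWalk h ∧ T h = p
  · obtain ⟨h, hh, rfl⟩ := hp
    have : T ⁻¹' {T h} = {g : ℕ → ℕ | ∀ i ≤ n, g i = h i} := by
      ext g
      simp only [Set.mem_preimage, Set.mem_singleton_iff, Set.mem_ofPred_eq, T, funext_iff]
      exact ⟨fun H i hi => H ⟨i, by omega⟩, fun H i => H i (by omega)⟩
    rw [this]
    exact setIntegral_cylinder_succ hw hcyl G hmn hh
  · have h0 : π (T ⁻¹' {p}) = 0 := by
      refine measure_mono_null (fun g hg => ?_) (ae_iff.1 hw)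
      exact fun hgw => hp ⟨g, hgw, hg⟩
    rw [Measure.restrict_eq_zero.2 h0, integral_zero_measure, integral_zero_measure]

/-- Markov property over `r` steps. -/
lemma integral_add_eq {π : Measure (ℕ → ℕ)} [IsProbabilityMeasure π]
    (hw : ∀ᵐ h ∂π, IsNatWalk h)
    (hcyl : ∀ N : ℕ, ∀ h : ℕ → ℕ, IsNatWalk h →
      π.real {g : ℕ → ℕ | ∀ i ≤ N, g i = h i} = ((h N : ℝ) + 1) / 2 ^ N)
    (G : ℕ → ℤ → ℝ) (m r : ℕ) :
    ∫ g, G (g m) (g (m + r) : ℕ) ∂π = ∫ g, (walkStep condUp ^ r) (G (g m)) (g m : ℕ) ∂π := by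
  induction r generalizing G with
  | zero => simp
  | succ r ih =>
    rw [← add_assoc, integral_succ_eq hw hcyl G (Nat.le_add_right m r),
      ih fun x => walkStep condUp (G x)]
    simp only [pow_succ, Module.End.mul_apply]

/-- Moment estimate on the increments: if `∫ X_n^{2k} dπ ≤ a n^k` for all `n`, then
`∫ (X_n - X_m)^{2k} dπ ≤ 2a |n - m|^k` for all `n, m`. -/
theorem stmt10 (π : Measure (ℕ → ℕ)) [IsProbabilityMeasure π]
    (hsupp : π {h : ℕ → ℕ | h 0 = 0 ∧ ∀ n : ℕ, |((h (n + 1) : ℤ)) - (h n : ℤ)| = 1} = 1)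
    (hcyl : ∀ N : ℕ, 1 ≤ N → ∀ h : ℕ → ℕ, h 0 = 0 →
      (∀ n : ℕ, |((h (n + 1) : ℤ)) - (h n : ℤ)| = 1) →
      π {g : ℕ → ℕ | ∀ i, 1 ≤ i → i ≤ N → g i = h i} = ((h N : ℝ≥0∞) + 1) / 2 ^ N)
    (k : ℕ) (hk : 1 ≤ k) (a : ℝ) (ha : 0 < a)
    (hmom : ∀ n : ℕ, ∫ h, ((h n : ℝ)) ^ (2 * k) ∂π ≤ a * (n : ℝ) ^ k) :
    ∀ n m : ℕ, ∫ h, ((h n : ℝ) - (h m : ℝ)) ^ (2 * k) ∂π ≤ 2 * a * |(n : ℝ) - (m : ℝ)| ^ k := by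
  have hw : ∀ᵐ h ∂π, IsNatWalk h :=
    (mem_ae_iff_prob_eq_one measurableSet_isNatWalk).2 hsupp
  have hcyl' : ∀ N : ℕ, ∀ h : ℕ → ℕ, IsNatWalk h →
      π.real {g : ℕ → ℕ | ∀ i ≤ N, g i = h i} = ((h N : ℝ) + 1) / 2 ^ N := by
    intro N h hh
    rcases Nat.eq_zero_or_pos N with rfl | hN
    · have : π {g : ℕ → ℕ | ∀ i ≤ 0, g i = h i} = 1 := by
        refine (measure_congr ?_).trans measure_univ
        filter_upwards [hw] with g hg
        refine propext ⟨fun _ => trivial, fun _ i hi => ?_⟩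
        rw [Nat.le_zero.1 hi, hg.1, hh.1]
      rw [Measure.real, this, hh.1]
      simp
    · have hae : {g : ℕ → ℕ | ∀ i ≤ N, g i = h i}
          =ᵐ[π] {g : ℕ → ℕ | ∀ i, 1 ≤ i → i ≤ N → g i = h i} := by
        filter_upwards [hw] with g hg
        refine propext ⟨fun H i _ hi => H i hi, fun H i hi => ?_⟩
        rcases Nat.eq_zero_or_pos i with rfl | h1
        · rw [hg.1, hh.1]
        · exact H i h1 hi
      rw [measureReal_congr hae, Measure.real, hcyl N hN h hh.1 hh.2, ENNReal.toReal_div,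
        ENNReal.toReal_add (by simp) (by simp)]
      simp
  have key : ∀ m r : ℕ, ∫ h, ((h (m + r) : ℝ) - (h m : ℝ)) ^ (2 * k) ∂π
      ≤ 2 * a * (r : ℝ) ^ k := by
    intro m r
    have h0 : ∫ h, ((h r : ℝ)) ^ (2 * k) ∂π
        = (walkStep condUp ^ r) (fun y => (y : ℝ) ^ (2 * k)) 0 := by
      have e := integral_add_eq hw hcyl' (fun _ y => (y : ℝ) ^ (2 * k)) 0 r
      simp only [zero_add, Int.cast_natCast] at e
      rw [e, integral_congr_ae (g := fun _ =>
        (walkStep condUp ^ r) (fun y => (y : ℝ) ^ (2 * k)) 0)]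
      · simp
      · filter_upwards [hw] with g hg
        simp [hg.1]
    have e := integral_add_eq hw hcyl' (fun x y => ((y : ℝ) - x) ^ (2 * k)) m r
    simp only [Int.cast_natCast] at e
    rw [e]
    have hmr := hmom r
    rw [h0] at hmr
    calc _ ≤ ∫ _, 2 * (walkStep condUp ^ r) (fun y => (y : ℝ) ^ (2 * k)) 0 ∂π :=
          integral_mono (integrable_of_isNatWalk hw (fun i j =>
            (walkStep condUp ^ r) (fun y => ((y : ℝ) - i) ^ (2 * k)) (j : ℕ)) m m)
            (integrable_const _) fun g => walkStep_condUp_pow_sub_pow_le k hk r (g m)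
      _ = 2 * (walkStep condUp ^ r) (fun y => (y : ℝ) ^ (2 * k)) 0 := by simp
      _ ≤ 2 * a * (r : ℝ) ^ k := by linarith
  intro n m
  rcases le_total m n with hmn | hmn
  · obtain ⟨r, rfl⟩ := Nat.exists_eq_add_of_le hmn
    simpa using key m r
  · obtain ⟨r, rfl⟩ := Nat.exists_eq_add_of_le hmn
    have hsymm : ∀ h : ℕ → ℕ, ((h n : ℝ) - (h (n + r) : ℝ)) ^ (2 * k)
        = ((h (n + r) : ℝ) - (h n : ℝ)) ^ (2 * k) := fun h => by
      rw [← neg_sub, (even_two_mul k).neg_pow]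
    simpa [hsymm] using key n r
end

section
/- Let k ≥ 1 be an integer, let a, b > 0, and let (Y_n)_{n∈ℕ} be real random variables on a probability space satisfying E[|Y_n|^{2k}] ≤ a·n^k and E[|Y_n − Y_m|^{2k}] ≤ b·|n − m|^k for all n, m ∈ ℕ. Define the piecewise linear interpolation Ȳ_x := (⌈x⌉ − x)·Y_{⌊x⌋} + (x − ⌊x⌋)·Y_{⌈x⌉} for x ∈ [0,∞) (with Ȳ_x = Y_x when x is an integer). Then for all x, y ∈ [0,∞): E[|Ȳ_x|^{2k}] ≤ a·x^k and E[|Ȳ_x − Ȳ_y|^{2k}] ≤ b·|x − y|^k. -/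
open MeasureTheory

open scoped ENNReal

section MomentBounds

variable {Ω : Type*} [MeasurableSpace Ω] {μ : Measure Ω}

theorem lpNorm_natCast_pow {f : Ω → ℝ} {q : ℕ} (hq : q ≠ 0) (hf : AEStronglyMeasurable f μ) :
    lpNorm f (q : ℝ≥0∞) μ ^ q = ∫ ω, |f ω| ^ q ∂μ := by
  rw [lpNorm_eq_integral_norm_rpow_toReal (by exact_mod_cast hq) (by simp) hf]
  simp only [ENNReal.toReal_natCast, Real.rpow_natCast, Real.norm_eq_abs]
  exact Real.rpow_inv_natCast_pow (integral_nonneg fun ω => by positivity) hq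

theorem memLp_natCast_of_integrable_abs_pow {f : Ω → ℝ} {q : ℕ} (hq : q ≠ 0)
    (hf : AEStronglyMeasurable f μ) (hint : Integrable (fun ω => |f ω| ^ q) μ) :
    MemLp f (q : ℝ≥0∞) μ := by
  rw [← integrable_norm_rpow_iff hf (by exact_mod_cast hq) (by simp)]
  simpa using hint

theorem integral_abs_pow_le_iff_lpNorm_le {f : Ω → ℝ} {k : ℕ} (hk : 1 ≤ k)
    (hf : AEStronglyMeasurable f μ) {c p : ℝ} (hc : 0 ≤ c) (hp : 0 ≤ p) :
    ∫ ω, |f ω| ^ (2 * k) ∂μ ≤ c * p ^ k ↔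
      lpNorm f (2 * k : ℕ) μ ≤ c ^ ((2 * k : ℕ) : ℝ)⁻¹ * √p := by
  have hq : 2 * k ≠ 0 := by omega
  have hC : (c ^ ((2 * k : ℕ) : ℝ)⁻¹ * √p) ^ (2 * k) = c * p ^ k := by
    rw [mul_pow, Real.rpow_inv_natCast_pow hc hq, pow_mul, Real.sq_sqrt hp]
  rw [← lpNorm_natCast_pow hq hf, ← hC]
  exact pow_le_pow_iff_left₀ lpNorm_nonneg (by positivity) hq

/-- By the Minkowski inequality and the concavity of the square root, moment bounds of order
`2 * k` that grow like the `k`-th power of a parameter are stable under convex combinations. -/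
theorem integral_abs_convexComb_pow_le {f g : Ω → ℝ} {k : ℕ} (hk : 1 ≤ k)
    (hf : MemLp f (2 * k : ℕ) μ) (hg : MemLp g (2 * k : ℕ) μ) {c p q v w : ℝ} (hc : 0 ≤ c)
    (hp : 0 ≤ p) (hq : 0 ≤ q) (hv : 0 ≤ v) (hw : 0 ≤ w) (hvw : v + w = 1)
    (hfp : ∫ ω, |f ω| ^ (2 * k) ∂μ ≤ c * p ^ k) (hgq : ∫ ω, |g ω| ^ (2 * k) ∂μ ≤ c * q ^ k) :
    ∫ ω, |v * f ω + w * g ω| ^ (2 * k) ∂μ ≤ c * (v * p + w * q) ^ k := by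
  have hk1 : (1 : ℝ≥0∞) ≤ (2 * k : ℕ) := by
    have : 1 ≤ 2 * k := by omega
    exact_mod_cast this
  rw [integral_abs_pow_le_iff_lpNorm_le hk hf.1 hc hp] at hfp
  rw [integral_abs_pow_le_iff_lpNorm_le hk hg.1 hc hq] at hgq
  refine (integral_abs_pow_le_iff_lpNorm_le hk ((hf.const_smul v).add (hg.const_smul w)).1 hc
    (by positivity)).2 ?_
  set C := c ^ ((2 * k : ℕ) : ℝ)⁻¹
  have hC0 : 0 ≤ C := by positivity
  have hsqrt : v * √p + w * √q ≤ √(v * p + w * q) :=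
    Real.strictConcaveOn_sqrt.concaveOn.2 hp hq hv hw hvw
  calc lpNorm (v • f + w • g) (2 * k : ℕ) μ
      ≤ lpNorm (v • f) (2 * k : ℕ) μ + lpNorm (w • g) (2 * k : ℕ) μ :=
        lpNorm_add_le (hf.const_smul v) hk1
    _ = v * lpNorm f (2 * k : ℕ) μ + w * lpNorm g (2 * k : ℕ) μ := by
        simp [lpNorm_const_smul, abs_of_nonneg hv, abs_of_nonneg hw]
    _ ≤ v * (C * √p) + w * (C * √q) := by gcongr
    _ = C * (v * √p + w * √q) := by ring
    _ ≤ C * √(v * p + w * q) := by gcongr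

end MomentBounds


/-- Moment bounds lift to the piecewise linear interpolation: if
`E[|Y_n|^{2k}] ≤ a n^k` and `E[|Y_n - Y_m|^{2k}] ≤ b |n - m|^k`, then the same bounds
hold for the piecewise linear interpolation `Ȳ` at all real times `x, y ≥ 0`. -/
theorem stmt11 {Ω : Type*} [MeasurableSpace Ω] (μ : Measure Ω) [IsProbabilityMeasure μ]
    (k : ℕ) (hk : 1 ≤ k) (a b : ℝ) (ha : 0 < a) (hb : 0 < b)
    (Y : ℕ → Ω → ℝ) (hmeas : ∀ n, Measurable (Y n))
    (hint : ∀ n, Integrable (fun ω => |Y n ω| ^ (2 * k)) μ)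
    (hmom : ∀ n : ℕ, ∫ ω, |Y n ω| ^ (2 * k) ∂μ ≤ a * (n : ℝ) ^ k)
    (hinc : ∀ n m : ℕ, ∫ ω, |Y n ω - Y m ω| ^ (2 * k) ∂μ ≤ b * |(n : ℝ) - (m : ℝ)| ^ k)
    (Ybar : ℝ → Ω → ℝ)
    (hYbar : ∀ x : ℝ, 0 ≤ x → ∀ ω,
      Ybar x ω = if (⌊x⌋₊ : ℝ) = x then Y ⌊x⌋₊ ω
        else ((⌈x⌉₊ : ℝ) - x) * Y ⌊x⌋₊ ω + (x - (⌊x⌋₊ : ℝ)) * Y ⌈x⌉₊ ω) :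
    ∀ x y : ℝ, 0 ≤ x → 0 ≤ y →
      (∫ ω, |Ybar x ω| ^ (2 * k) ∂μ ≤ a * x ^ k) ∧
      (∫ ω, |Ybar x ω - Ybar y ω| ^ (2 * k) ∂μ ≤ b * |x - y| ^ k) := by
  have hq : 2 * k ≠ 0 := by omega
  have hY (n : ℕ) : MemLp (Y n) (2 * k : ℕ) μ :=
    memLp_natCast_of_integrable_abs_pow hq (hmeas n).aestronglyMeasurable (hint n)
  have hfl (x : ℝ) (hx : 0 ≤ x) : 0 ≤ (⌊x⌋₊ : ℝ) + 1 - x ∧ 0 ≤ x - ⌊x⌋₊ :=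
    ⟨by linarith [Nat.lt_floor_add_one x], by linarith [Nat.floor_le hx]⟩
  have hbar (x : ℝ) (hx : 0 ≤ x) (ω : Ω) : Ybar x ω =
      ((⌊x⌋₊ : ℝ) + 1 - x) * Y ⌊x⌋₊ ω + (x - ⌊x⌋₊) * Y (⌊x⌋₊ + 1) ω := by
    rw [hYbar x hx ω]
    split_ifs with h
    · rw [h]; ring
    · have hceil : ⌈x⌉₊ = ⌊x⌋₊ + 1 := by
        refine le_antisymm (Nat.ceil_le_floor_add_one x) (Nat.lt_ceil.2 ?_)
        exact lt_of_le_of_ne (Nat.floor_le hx) h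
      rw [hceil]; push_cast; rfl
  have hbarLp (x : ℝ) (hx : 0 ≤ x) : MemLp (Ybar x) (2 * k : ℕ) μ := by
    rw [funext (hbar x hx)]
    exact ((hY _).const_mul _).add ((hY _).const_mul _)
  have hnode (n : ℕ) (x : ℝ) (hx : 0 ≤ x) (hxn : ⌊x⌋₊ + 1 ≤ n) :
      ∫ ω, |Y n ω - Ybar x ω| ^ (2 * k) ∂μ ≤ b * (n - x) ^ k := by
    have hxn' : (⌊x⌋₊ : ℝ) + 1 ≤ n := by exact_mod_cast hxn
    have h₁ := hinc n ⌊x⌋₊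
    have h₂ := hinc n (⌊x⌋₊ + 1)
    push_cast at h₂
    rw [abs_of_nonneg (by linarith)] at h₁ h₂
    have h := integral_abs_convexComb_pow_le hk ((hY n).sub (hY ⌊x⌋₊))
      ((hY n).sub (hY (⌊x⌋₊ + 1))) hb.le (by linarith) (by linarith)
      (hfl x hx).1 (hfl x hx).2 (by ring) h₁ h₂
    convert h using 4 with ω
    · congr 1
      simp only [hbar x hx, Pi.sub_apply]
      ring
    · ring
  have hincr (x y : ℝ) (hx : 0 ≤ x) (hxy : x ≤ y) :
      ∫ ω, |Ybar y ω - Ybar x ω| ^ (2 * k) ∂μ ≤ b * (y - x) ^ k := by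
    have hy := hx.trans hxy
    rcases (Nat.floor_mono hxy).eq_or_lt with hfloor | hfloor
    · have h₁ := hinc (⌊x⌋₊ + 1) ⌊x⌋₊
      push_cast at h₁
      rw [add_sub_cancel_left, abs_one] at h₁
      have hle : y ≤ ⌊x⌋₊ + 1 := hfloor ▸ (Nat.lt_floor_add_one y).le
      have h := integral_abs_convexComb_pow_le (v := y - x) (w := 1 - (y - x)) (q := 0) hk
        ((hY (⌊x⌋₊ + 1)).sub (hY ⌊x⌋₊)) (MemLp.zero (ε := ℝ)) hb.le zero_le_one le_rfl
        (by linarith) (by linarith [(hfl x hx).2]) (by ring) h₁ (by simp [hq]; positivity)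
      convert h using 4 with ω
      · congr 1
        simp only [hbar x hx, hbar y hy, ← hfloor, Pi.sub_apply, Pi.zero_apply]
        ring
      · ring
    · have hlt : x < ⌊y⌋₊ := (Nat.floor_lt hx).1 hfloor
      have h₁ := hnode ⌊y⌋₊ x hx hfloor
      have h₂ := hnode (⌊y⌋₊ + 1) x hx (by omega)
      push_cast at h₂
      have h := integral_abs_convexComb_pow_le hk ((hY ⌊y⌋₊).sub (hbarLp x hx))
        ((hY (⌊y⌋₊ + 1)).sub (hbarLp x hx)) hb.le (by linarith) (by linarith)
        (hfl y hy).1 (hfl y hy).2 (by ring) h₁ h₂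
      convert h using 4 with ω
      · congr 1
        simp only [hbar y hy, Pi.sub_apply]
        ring
      · ring
  intro x y hx hy
  constructor
  · have h₂ := hmom (⌊x⌋₊ + 1)
    push_cast at h₂
    have h := integral_abs_convexComb_pow_le hk (hY ⌊x⌋₊) (hY (⌊x⌋₊ + 1)) ha.le
      (by positivity) (by positivity) (hfl x hx).1 (hfl x hx).2 (by ring) (hmom ⌊x⌋₊) h₂
    convert h using 4 with ω
    · rw [hbar x hx]
    · ring
  · rcases le_total x y with hxy | hxy
    · rw [abs_sub_comm x y, abs_of_nonneg (sub_nonneg.2 hxy)]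
      simpa only [abs_sub_comm] using hincr x y hx hxy
    · rw [abs_of_nonneg (sub_nonneg.2 hxy)]
      exact hincr y x hy hxy
end

section
/- Let ε ∈ (0, 1] and let g : ℝ → ℝ satisfy: g(x) = 0 for all x ≤ 0, g is affine on each interval [εn, ε(n+1)] for n ∈ ℕ, and g is Lebesgue integrable on ℝ. Then the series Σ_{n=0}^∞ |g(εn)| converges, and for every ζ ∈ ℝ with ζ ≠ 0, the Fourier transform of g satisfies ∫_ℝ g(x)·e^{−iζx} dx = c_{ζ,ε} · Σ_{n=0}^∞ e^{−iζεn}·g(εn), where c_{ζ,ε} := 2(1 − cos(ζε))/(ε ζ²); moreover 0 ≤ c_{ζ,ε} ≤ ε. -/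
open MeasureTheory Complex

/-- The integral of an affine function against an exponential, via an explicit antiderivative. -/
theorem integral_affine_mul_cexp (a s x₀ x₁ w : ℂ) (hw : w ≠ 0) (u v : ℝ) (hu : x₀ = u)
    (hv : x₁ = v) :
    (∫ x in u..v, (a + s * ((x : ℂ) - x₀)) * Complex.exp (w * x)) =
      ((a + s * (x₁ - x₀)) * Complex.exp (w * x₁) - a * Complex.exp (w * x₀)) / w
        - s * (Complex.exp (w * x₁) - Complex.exp (w * x₀)) / w ^ 2 := by
  have hd : ∀ x ∈ Set.uIcc u v, HasDerivAt
      (fun x : ℝ => (a + s * ((x : ℂ) - x₀)) * Complex.exp (w * x) / w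
        - s * Complex.exp (w * x) / w ^ 2)
      ((a + s * ((x : ℂ) - x₀)) * Complex.exp (w * x)) x := by
    intro x _
    have hx : HasDerivAt (fun x : ℝ => (x : ℂ)) 1 x := Complex.ofRealCLM.hasDerivAt
    have he : HasDerivAt (fun x : ℝ => Complex.exp (w * x))
        (Complex.exp (w * x) * (w * 1)) x := (hx.const_mul w).cexp
    have hl : HasDerivAt (fun x : ℝ => a + s * ((x : ℂ) - x₀)) (s * 1) x :=
      ((hx.sub_const x₀).const_mul s).const_add a
    refine (((hl.mul he).div_const w).sub ((he.const_mul s).div_const (w ^ 2))).congr_deriv ?_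
    field_simp
    ring
  rw [intervalIntegral.integral_eq_sub_of_hasDerivAt hd
    (Continuous.intervalIntegrable (by fun_prop) _ _), ← hu, ← hv]
  ring

/-- The left endpoint value of an affine function is controlled by its `L¹` norm. -/
theorem mul_abs_le_integral_abs_affine (a s u ε : ℝ) (hε : 0 < ε) :
    ε * |a| ≤ 4 * ∫ x in u..u + ε, |a + s * (x - u)| := by
  have hd : ∀ x ∈ Set.uIcc u (u + ε), HasDerivAt
      (fun x : ℝ => 4 * a * (x - u) + (4 * s - 6 * a / ε) * (x - u) ^ 2 / 2
        - 6 * s / ε * (x - u) ^ 3 / 3)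
      ((a + s * (x - u)) * (4 - 6 * (x - u) / ε)) x := by
    intro x _
    have hx : HasDerivAt (fun x : ℝ => x - u) 1 x := (hasDerivAt_id x).sub_const u
    refine (((hx.const_mul (4 * a)).add
      (((hx.pow 2).const_mul (4 * s - 6 * a / ε)).div_const 2)).sub
      (((hx.pow 3).const_mul (6 * s / ε)).div_const 3)).congr_deriv ?_
    push_cast
    field_simp
    ring
  have hval : (∫ x in u..u + ε, (a + s * (x - u)) * (4 - 6 * (x - u) / ε)) = ε * a := by
    rw [intervalIntegral.integral_eq_sub_of_hasDerivAt hd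
      (Continuous.intervalIntegrable (by fun_prop) _ _)]
    field_simp
    ring
  rw [← abs_of_pos hε, ← abs_mul, abs_of_pos hε, ← hval,
    ← intervalIntegral.integral_const_mul]
  refine (intervalIntegral.abs_integral_le_integral_abs (by linarith)).trans ?_
  refine intervalIntegral.integral_mono_on (by linarith)
    (Continuous.intervalIntegrable (by fun_prop) _ _)
    (Continuous.intervalIntegrable (by fun_prop) _ _) fun x hx => ?_
  rw [abs_mul, mul_comm]
  refine mul_le_mul_of_nonneg_right ?_ (abs_nonneg _)
  have h0 : 0 ≤ (x - u) / ε := div_nonneg (by linarith [hx.1]) hε.le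
  have h1 : (x - u) / ε ≤ 1 := (div_le_one hε).2 (by linarith [hx.2])
  rw [mul_div_assoc, abs_le]
  constructor <;> linarith

/-- Fourier transform of a piecewise affine integrable function on the lattice `εℕ`
vanishing on `(-∞, 0]`: the series of lattice values converges absolutely and
`∫ g(x) e^{-iζx} dx = c_{ζ,ε} Σ_n e^{-iζεn} g(εn)` with
`c_{ζ,ε} = 2(1 - cos(ζε))/(εζ²) ∈ [0, ε]`. -/
theorem stmt14 (ε : ℝ) (hε : ε ∈ Set.Ioc (0 : ℝ) 1) (g : ℝ → ℝ)
    (hzero : ∀ x : ℝ, x ≤ 0 → g x = 0)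
    (haffine : ∀ n : ℕ, ∀ x ∈ Set.Icc (ε * n) (ε * (n + 1)),
      g x = g (ε * n) + (x - ε * n) / ε * (g (ε * (n + 1)) - g (ε * n)))
    (hint : Integrable g) :
    Summable (fun n : ℕ => |g (ε * n)|) ∧
    ∀ ζ : ℝ, ζ ≠ 0 →
      (∫ x : ℝ, (g x : ℂ) * Complex.exp (-(ζ * x : ℝ) * Complex.I)) =
        ((2 * (1 - Real.cos (ζ * ε)) / (ε * ζ ^ 2) : ℝ) : ℂ) *
          ∑' n : ℕ, Complex.exp (-(ζ * (ε * n) : ℝ) * Complex.I) * (g (ε * n) : ℂ) ∧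
      0 ≤ 2 * (1 - Real.cos (ζ * ε)) / (ε * ζ ^ 2) ∧
      2 * (1 - Real.cos (ζ * ε)) / (ε * ζ ^ 2) ≤ ε := by
  obtain ⟨hε0, -⟩ := hε
  have hline : ∀ n : ℕ, ∀ x ∈ Set.uIcc (ε * n) (ε * (n + 1)),
      g x = g (ε * n) + (g (ε * (n + 1)) - g (ε * n)) / ε * (x - ε * n) := by
    intro n x hx
    rw [Set.uIcc_of_le (by nlinarith)] at hx
    rw [haffine n x hx]
    ring
  have hg0 : g 0 = 0 := hzero 0 le_rfl
  have hsum : Summable (fun n : ℕ => |g (ε * n)|) := by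
    refine summable_of_sum_range_le (c := 4 / ε * ∫ x, |g x|) (fun _ => abs_nonneg _) fun N => ?_
    have hstep : ∀ n : ℕ, |g (ε * n)| ≤
        4 / ε * ∫ x in (ε * n)..(ε * ((n + 1 : ℕ) : ℝ)), |g x| := by
      intro n
      have h := mul_abs_le_integral_abs_affine (g (ε * n))
        ((g (ε * (n + 1)) - g (ε * n)) / ε) (ε * n) ε hε0
      rw [show ε * (n : ℝ) + ε = ε * (n + 1) by ring] at h
      push_cast
      rw [intervalIntegral.integral_congr (fun x hx => congrArg abs (hline n x hx)),
        div_mul_eq_mul_div, le_div_iff₀ hε0]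
      linarith
    calc ∑ n ∈ Finset.range N, |g (ε * n)|
        ≤ ∑ n ∈ Finset.range N,
            4 / ε * ∫ x in (ε * n)..(ε * ((n + 1 : ℕ) : ℝ)), |g x| :=
          Finset.sum_le_sum fun n _ => hstep n
      _ = 4 / ε * ∫ x in (ε * (0 : ℕ))..(ε * N), |g x| := by
          rw [← Finset.mul_sum, intervalIntegral.sum_integral_adjacent_intervals
            (a := fun n : ℕ => ε * (n : ℝ)) fun k _ => hint.abs.intervalIntegrable]
      _ ≤ 4 / ε * ∫ x, |g x| := by
          refine mul_le_mul_of_nonneg_left ?_ (by positivity)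
          rw [intervalIntegral.integral_of_le (by simp; positivity)]
          exact setIntegral_le_integral hint.abs (Filter.Eventually.of_forall fun _ => abs_nonneg _)
  refine ⟨hsum, fun ζ hζ => ⟨?_, ?_, ?_⟩⟩
  · obtain ⟨w, hw⟩ : ∃ w : ℂ, w = -(ζ * Complex.I) := ⟨_, rfl⟩
    have hw0 : w ≠ 0 := by simp [hw, hζ]
    have hεc : (ε : ℂ) ≠ 0 := by exact_mod_cast hε0.ne'
    have hexp : ∀ x : ℝ, Complex.exp (-(ζ * x : ℝ) * Complex.I) = Complex.exp (w * x) := by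
      intro x
      rw [hw]
      push_cast
      ring_nf
    simp_rw [hexp]
    set q : ℂ := Complex.exp (w * ε) with hq
    have hq0 : q ≠ 0 := Complex.exp_ne_zero _
    have hc : ((2 * (1 - Real.cos (ζ * ε)) / (ε * ζ ^ 2) : ℝ) : ℂ) =
        -(2 - q - q⁻¹) / (ε * w ^ 2) := by
      have hζc : (ζ : ℂ) ≠ 0 := by exact_mod_cast hζ
      have hcos : 2 * Complex.cos (ζ * ε) = q + q⁻¹ := by
        rw [Complex.two_cos, hq, ← Complex.exp_neg, hw, add_comm]
        ring_nf
      have hw2 : w ^ 2 = -(ζ : ℂ) ^ 2 := by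
        rw [hw, neg_sq, mul_pow, Complex.I_sq]
        ring
      push_cast
      rw [hw2, mul_sub, hcos]
      field_simp
      ring
    rw [hc]
    set c : ℂ := -(2 - q - q⁻¹) / (ε * w ^ 2) with hcdef
    have hnorm : ∀ x : ℝ, ‖Complex.exp (w * x)‖ = 1 := fun x => by
      rw [← hexp, ← Complex.ofReal_neg, Complex.norm_exp_ofReal_mul_I]
    have hfint : Integrable fun x : ℝ => (g x : ℂ) * Complex.exp (w * x) :=
      hint.ofReal.mul_bdd (c := 1) (Continuous.aestronglyMeasurable (by fun_prop))
        (Filter.Eventually.of_forall fun x => (hnorm x).le)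
    have hpart : ∀ N : ℕ, (∫ x in (0 : ℝ)..(ε * N), (g x : ℂ) * Complex.exp (w * x)) =
        Complex.exp (w * (ε * N : ℝ)) * (g (ε * N) : ℂ) * (1 / w - (1 - q⁻¹) / (ε * w ^ 2)) +
          c * ∑ n ∈ Finset.range N, Complex.exp (w * (ε * n : ℝ)) * (g (ε * n) : ℂ) := by
      intro N
      induction N with
      | zero => simp [hg0]
      | succ n ih =>
        rw [← intervalIntegral.integral_add_adjacent_intervals (b := ε * n)
          hfint.intervalIntegrable hfint.intervalIntegrable, ih, Finset.sum_range_succ]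
        have hE : Complex.exp (w * (ε * (n + 1) : ℝ)) = Complex.exp (w * (ε * n : ℝ)) * q := by
          rw [hq, ← Complex.exp_add]
          push_cast
          ring_nf
        have hcell : (∫ x in (ε * n)..(ε * (n + 1)), (g x : ℂ) * Complex.exp (w * x)) =
            ∫ x in (ε * n)..(ε * (n + 1)), ((g (ε * n) : ℂ) +
              ((g (ε * (n + 1)) : ℂ) - g (ε * n)) / ε * ((x : ℂ) - (ε * n : ℝ))) *
                Complex.exp (w * x) := by
          refine intervalIntegral.integral_congr fun x hx => ?_
          rw [hline n x hx]
          push_cast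
          ring
        rw [Nat.cast_succ, hcell, integral_affine_mul_cexp _ _ _ (ε * (n + 1) : ℝ) w hw0 _ _
          rfl rfl, hE, hcdef]
        push_cast
        field_simp
        ring
    have hsumc : Summable fun n : ℕ => Complex.exp (w * (ε * n : ℝ)) * (g (ε * n) : ℂ) := by
      refine Summable.of_norm (hsum.congr fun n => ?_)
      rw [norm_mul, hnorm, one_mul, Complex.norm_real, Real.norm_eq_abs]
    have hlim := (hsumc.tendsto_atTop_zero.mul_const
      (1 / w - (1 - q⁻¹) / (ε * w ^ 2))).add (hsumc.hasSum.tendsto_sum_nat.const_mul c)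
    rw [zero_mul, zero_add] at hlim
    have hint_lim := intervalIntegral_tendsto_integral_Ioi 0 hfint.integrableOn
      (tendsto_natCast_atTop_atTop.const_mul_atTop hε0)
    rw [setIntegral_eq_integral_of_forall_compl_eq_zero fun x hx => by
      rw [hzero x (not_lt.1 hx)]; simp] at hint_lim
    exact tendsto_nhds_unique (hint_lim.congr hpart) hlim
  · have := Real.cos_le_one (ζ * ε)
    exact div_nonneg (by linarith) (by positivity)
  · rw [div_le_iff₀ (by positivity)]
    nlinarith [Real.one_sub_sq_div_two_le_cos (x := ζ * ε)]
end

section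
/- Let ε ∈ (0, 1], A ≥ 1, let h : ℝ → ℝ be continuous with h(x) = 0 for x ≤ 0 (in particular h(0) = 0) and affine on each interval [εk, ε(k+1)] for k ∈ ℕ, and let φ : ℝ → ℝ be three times continuously differentiable with support contained in [0, A] and φ(0) = 0. Then | ε·Σ_{k=1}^∞ ε^{−2}·( h(ε(k+1)) + h(ε(k−1)) − 2h(εk) )·φ(εk) − ∫_0^∞ h(x)·φ''(x) dx | ≤ 2ε(A + 2)·( sup_{x∈[0,A+2]} |h(x)| )·( sup_{x∈ℝ} |φ'''(x)| ). -/
open MeasureTheory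

/-- Integration by parts for an affine function `h` on `[a, b]` against a second derivative. -/
theorem integral_mul_deriv_deriv_of_affine {a b c s : ℝ} (hab : a ≤ b) {h φ : ℝ → ℝ}
    (haff : ∀ x ∈ Set.Icc a b, h x = c + (x - a) * s) (hφ : ContDiff ℝ 2 φ) :
    ∫ x in a..b, h x * deriv (deriv φ) x =
      h b * deriv φ b - h a * deriv φ a - s * (φ b - φ a) := by
  have hφ' : ContDiff ℝ 1 (deriv φ) := hφ.deriv' (n := 1)
  have hφ'' : Continuous (deriv (deriv φ)) := hφ'.continuous_deriv le_rfl
  have hd (x : ℝ) : HasDerivAt φ (deriv φ x) x :=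
    (hφ.differentiable (by norm_num) x).hasDerivAt
  have hd' (x : ℝ) : HasDerivAt (deriv φ) (deriv (deriv φ) x) x :=
    (hφ'.differentiable (by norm_num) x).hasDerivAt
  have hF (x : ℝ) : HasDerivAt (fun x ↦ (c + (x - a) * s) * deriv φ x - s * φ x)
      ((c + (x - a) * s) * deriv (deriv φ) x) x := by
    have hlin : HasDerivAt (fun x ↦ c + (x - a) * s) s x := by
      simpa using (((hasDerivAt_id x).sub_const a).mul_const s).const_add c
    exact ((hlin.mul (hd' x)).sub ((hd x).const_mul s)).congr_deriv (by ring)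
  rw [intervalIntegral.integral_congr
      (g := fun x ↦ (c + (x - a) * s) * deriv (deriv φ) x)
      (fun x hx ↦ by
        rw [Set.uIcc_of_le hab] at hx
        simp only [haff x hx]),
    intervalIntegral.integral_eq_sub_of_hasDerivAt (fun x _ ↦ hF x)
      (Continuous.intervalIntegrable (by fun_prop) _ _),
    haff b (Set.right_mem_Icc.2 hab), haff a (Set.left_mem_Icc.2 hab)]
  ring

/-- Summation by parts on `[0, εN]` for a function that is affine between lattice points. -/
theorem integral_mul_deriv_deriv_of_piecewise_affine {ε : ℝ} (hε : 0 < ε) {h φ : ℝ → ℝ}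
    (hcont : Continuous h) (hh0 : h 0 = 0)
    (haffine : ∀ k : ℕ, ∀ x ∈ Set.Icc (ε * k) (ε * (k + 1)),
      h x = h (ε * k) + (x - ε * k) / ε * (h (ε * (k + 1)) - h (ε * k)))
    (hφ : ContDiff ℝ 2 φ) (hφ0 : φ 0 = 0) (N : ℕ) :
    ∫ x in (0 : ℝ)..(ε * N), h x * deriv (deriv φ) x =
      h (ε * N) * deriv φ (ε * N) - (h (ε * (N + 1)) - h (ε * N)) / ε * φ (ε * N) +
      ε * ∑ k ∈ Finset.range (N + 1), if 1 ≤ k then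
        ε⁻¹ ^ 2 * (h (ε * (k + 1)) + h (ε * (k - 1)) - 2 * h (ε * k)) * φ (ε * k) else 0 := by
  have hint : Continuous fun x ↦ h x * deriv (deriv φ) x :=
    hcont.mul ((hφ.deriv' (n := 1)).continuous_deriv le_rfl)
  induction N with
  | zero => simp [hh0, hφ0]
  | succ N ih =>
    have step := integral_mul_deriv_deriv_of_affine (a := ε * N) (b := ε * (N + 1))
      (c := h (ε * N)) (s := (h (ε * (N + 1)) - h (ε * N)) / ε) (h := h)
      (by nlinarith) (fun x hx ↦ by rw [haffine N x hx]; ring) hφ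
    rw [Finset.sum_range_succ, if_pos (Nat.le_add_left 1 N)]
    push_cast
    rw [← intervalIntegral.integral_add_adjacent_intervals
      (hint.intervalIntegrable 0 (ε * N)) (hint.intervalIntegrable _ _), ih, step,
      add_sub_cancel_right (N : ℝ) 1]
    field_simp
    ring

/-- Discretization error for the Laplacian pairing: for a continuous, piecewise affine
(on the lattice `εℕ`) function `h` vanishing on `(-∞, 0]` and a `C³` function `φ`
supported in `[0, A]` with `φ(0) = 0`, the discrete summation-by-parts approximation of
`∫ h φ''` is accurate up to `2ε(A+2)·sup_{[0,A+2]}|h|·sup|φ'''|`. -/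
theorem stmt16 (ε A : ℝ) (hε : ε ∈ Set.Ioc (0 : ℝ) 1) (hA : 1 ≤ A)
    (h : ℝ → ℝ) (hcont : Continuous h) (hzero : ∀ x : ℝ, x ≤ 0 → h x = 0)
    (haffine : ∀ k : ℕ, ∀ x ∈ Set.Icc (ε * k) (ε * (k + 1)),
      h x = h (ε * k) + (x - ε * k) / ε * (h (ε * (k + 1)) - h (ε * k)))
    (φ : ℝ → ℝ) (hφ : ContDiff ℝ 3 φ) (hφ0 : φ 0 = 0)
    (hφsupp : Function.support φ ⊆ Set.Icc 0 A) :
    |ε * (∑' k : ℕ, if 1 ≤ k then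
        ε⁻¹ ^ 2 * (h (ε * (k + 1)) + h (ε * (k - 1)) - 2 * h (ε * k)) * φ (ε * k) else 0)
      - ∫ x in Set.Ioi (0 : ℝ), h x * iteratedDeriv 2 φ x| ≤
      2 * ε * (A + 2) * (⨆ x : Set.Icc (0 : ℝ) (A + 2), |h x|) *
        (⨆ x : ℝ, |iteratedDeriv 3 φ x|) := by
  have hεpos : 0 < ε := hε.1
  have hvan (x : ℝ) (hx : A < x) : φ x = 0 := by
    by_contra hne
    exact absurd (hφsupp hne).2 (not_le.2 hx)
  have hvan' (x : ℝ) (hx : A < x) : deriv φ x = 0 := by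
    have heq : φ =ᶠ[nhds x] fun _ ↦ 0 := by
      filter_upwards [lt_mem_nhds hx] with y hy using hvan y hy
    rw [heq.deriv_eq, deriv_const]
  have hvan'' (x : ℝ) (hx : A < x) : deriv (deriv φ) x = 0 := by
    have heq : deriv φ =ᶠ[nhds x] fun _ ↦ 0 := by
      filter_upwards [lt_mem_nhds hx] with y hy using hvan' y hy
    rw [heq.deriv_eq, deriv_const]
  have hiter : iteratedDeriv 2 φ = deriv (deriv φ) := by
    rw [iteratedDeriv_succ, iteratedDeriv_one]
  obtain ⟨N, hN⟩ := exists_nat_gt (A / ε)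
  have hAN : A < ε * N := by rwa [div_lt_iff₀' hεpos] at hN
  have hparts := integral_mul_deriv_deriv_of_piecewise_affine hεpos hcont (hzero 0 le_rfl)
    haffine (hφ.of_le (by norm_num)) hφ0 N
  have hint : ∫ x in Set.Ioi (0 : ℝ), h x * deriv (deriv φ) x =
      ∫ x in (0 : ℝ)..(ε * N), h x * deriv (deriv φ) x := by
    rw [intervalIntegral.integral_of_le (by positivity)]
    refine setIntegral_eq_of_subset_of_forall_sdiff_eq_zero measurableSet_Ioi
      Set.Ioc_subset_Ioi_self fun x hx ↦ ?_
    rw [hvan'' x (hAN.trans (not_le.1 fun hle ↦ hx.2 ⟨hx.1, hle⟩)), mul_zero]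
  have hexact : ε * (∑' k : ℕ, if 1 ≤ k then
        ε⁻¹ ^ 2 * (h (ε * (k + 1)) + h (ε * (k - 1)) - 2 * h (ε * k)) * φ (ε * k) else 0) =
      ∫ x in Set.Ioi (0 : ℝ), h x * iteratedDeriv 2 φ x := by
    rw [hiter, hint, hparts, hvan _ hAN, hvan' _ hAN, tsum_eq_sum (s := Finset.range (N + 1))]
    · ring
    · intro k hk
      have hNk : (N : ℝ) ≤ k := by
        exact_mod_cast (Nat.lt_of_succ_le (by simpa using hk)).le
      rw [hvan (ε * k) (hAN.trans_le (by gcongr))]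
      simp
  rw [hexact, sub_self, abs_zero]
  have hsup_h : 0 ≤ ⨆ x : Set.Icc (0 : ℝ) (A + 2), |h x| :=
    Real.iSup_nonneg fun _ ↦ abs_nonneg _
  have hsup_φ : 0 ≤ ⨆ x : ℝ, |iteratedDeriv 3 φ x| := Real.iSup_nonneg fun _ ↦ abs_nonneg _
  have hA2 : 0 ≤ A + 2 := by linarith
  positivity
end

section
/- For every Schwartz function φ : ℝ → ℝ, one has ε · Σ_{n=1}^∞ π( X_n + ΔX_n < 0 ) · φ(εn)² → 0 as ε → 0⁺. -/
open MeasureTheory Filter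
open scoped ENNReal Topology

/-- The upper bound `C(2m, m) ≤ 4 ^ m / √(2m + 1)`, in squared form. -/
theorem centralBinom_sq_mul_le (m : ℕ) :
    Nat.centralBinom m ^ 2 * (2 * m + 1) ≤ (4 ^ m) ^ 2 := by
  induction m with
  | zero => simp
  | succ m ih =>
    have h := Nat.succ_mul_centralBinom_succ m
    have hpos : 0 < (m + 1) ^ 2 := by positivity
    refine Nat.le_of_mul_le_mul_left ?_ hpos
    calc (m + 1) ^ 2 * (Nat.centralBinom (m + 1) ^ 2 * (2 * (m + 1) + 1))
        = ((m + 1) * Nat.centralBinom (m + 1)) ^ 2 * (2 * m + 3) := by ring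
      _ = (Nat.centralBinom m ^ 2 * (2 * m + 1)) * (4 * ((2 * m + 1) * (2 * m + 3))) := by
          rw [h]; ring
      _ ≤ (4 ^ m) ^ 2 * (4 * (2 * m + 2) ^ 2) := by
          gcongr
          nlinarith
      _ = (m + 1) ^ 2 * (4 ^ (m + 1)) ^ 2 := by ring

/-- Nonnegative nearest-neighbour paths started at `0`. -/
def nonnegPaths : Set (ℕ → ℕ) :=
  {h | h 0 = 0 ∧ ∀ n : ℕ, |((h (n + 1) : ℤ)) - (h n : ℤ)| = 1}

theorem measurableSet_nonnegPaths : MeasurableSet nonnegPaths := by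
  have hX (n : ℕ) : Measurable fun h : ℕ → ℕ => (h n : ℤ) :=
    measurable_from_top.comp (measurable_pi_apply n)
  refine MeasurableSet.inter (measurable_pi_apply 0 (measurableSet_singleton 0)) ?_
  change MeasurableSet {h : ℕ → ℕ | ∀ n : ℕ, |((h (n + 1) : ℤ)) - (h n : ℤ)| = 1}
  rw [Set.ofPred_forall]
  refine MeasurableSet.iInter fun n => ?_
  have : Measurable fun h : ℕ → ℕ => |((h (n + 1) : ℤ)) - (h n : ℤ)| :=
    (measurable_from_top (f := fun z : ℤ => |z|)).comp ((hX (n + 1)).sub (hX n))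
  exact this (measurableSet_singleton 1)

/-- The up-steps of a path before time `N`. -/
def upSteps (N : ℕ) (g : ℕ → ℕ) : Finset ℕ :=
  (Finset.range N).filter fun i => g (i + 1) = g i + 1

theorem step_of_mem_nonnegPaths {g : ℕ → ℕ} (hg : g ∈ nonnegPaths) (n : ℕ) :
    g (n + 1) = g n + 1 ∨ g n = g (n + 1) + 1 := by
  rcases (abs_eq (zero_le_one' ℤ)).1 (hg.2 n) with h | h <;> omega

theorem two_mul_card_upSteps {g : ℕ → ℕ} (hg : g ∈ nonnegPaths) (N : ℕ) :
    2 * (upSteps N g).card = N + g N := by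
  induction N with
  | zero => simp [upSteps, hg.1]
  | succ N ih =>
    unfold upSteps at ih ⊢
    rw [Finset.range_add_one, Finset.filter_insert]
    split_ifs with h
    · rw [Finset.card_insert_of_notMem (by simp)]
      omega
    · have := step_of_mem_nonnegPaths hg N
      omega

theorem eq_of_upSteps_eq {g h : ℕ → ℕ} (hg : g ∈ nonnegPaths) (hh : h ∈ nonnegPaths) {N : ℕ}
    (hgh : upSteps N g = upSteps N h) {i : ℕ} (hi : i ≤ N) : g i = h i := by
  induction i with
  | zero => rw [hg.1, hh.1]
  | succ i ih =>
    have hmem : i ∈ upSteps N g ↔ i ∈ upSteps N h := by rw [hgh]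
    simp only [upSteps, Finset.mem_filter, Finset.mem_range] at hmem
    have := step_of_mem_nonnegPaths hg i
    have := step_of_mem_nonnegPaths hh i
    have := ih (by omega)
    omega

/-- A measure giving mass at most `2 ^ (-N)` to each cylinder of paths returning to `0` at time `N`
gives mass at most `C(N, N / 2) 2 ^ (-N)` to the return event. -/
theorem measure_return_le (π : Measure (ℕ → ℕ)) (N : ℕ)
    (hcyl : ∀ h ∈ nonnegPaths, h N = 0 →
      π {g : ℕ → ℕ | ∀ i, 1 ≤ i → i ≤ N → g i = h i} ≤ (2 ^ N)⁻¹) :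
    π {g | g ∈ nonnegPaths ∧ g N = 0} ≤ (N.choose (N / 2) : ℝ≥0∞) * (2 ^ N)⁻¹ := by
  have hsub : {g | g ∈ nonnegPaths ∧ g N = 0} ⊆
      ⋃ T ∈ Finset.powersetCard (N / 2) (Finset.range N),
        {g | (g ∈ nonnegPaths ∧ g N = 0) ∧ upSteps N g = T} := by
    intro g hg
    have hcard := two_mul_card_upSteps hg.1 N
    have h0 : g N = 0 := hg.2
    simp only [Set.mem_iUnion, Finset.mem_powersetCard]
    exact ⟨upSteps N g, ⟨Finset.filter_subset _ _, by omega⟩, hg, rfl⟩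
  calc _ ≤ _ := measure_mono hsub
    _ ≤ ∑ T ∈ Finset.powersetCard (N / 2) (Finset.range N),
        π {g | (g ∈ nonnegPaths ∧ g N = 0) ∧ upSteps N g = T} := measure_biUnion_finset_le _ _
    _ ≤ ∑ T ∈ Finset.powersetCard (N / 2) (Finset.range N), (2 ^ N)⁻¹ := by
        refine Finset.sum_le_sum fun T _ => ?_
        rcases Set.eq_empty_or_nonempty
          {g | (g ∈ nonnegPaths ∧ g N = 0) ∧ upSteps N g = T} with he | ⟨h, ⟨hh, h0⟩, hT⟩
        · simp [he]
        · refine (measure_mono ?_).trans (hcyl h hh h0)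
          rintro g ⟨⟨hg, -⟩, hgT⟩ i - hi
          exact eq_of_upSteps_eq hg hh (hgT.trans hT.symm) hi
    _ = _ := by simp

/-- The return probability at time `N` is at most `1 / √N`. -/
theorem toReal_measure_return_le (π : Measure (ℕ → ℕ)) {N : ℕ} (hN : 1 ≤ N)
    (hcyl : ∀ h ∈ nonnegPaths, h N = 0 →
      π {g : ℕ → ℕ | ∀ i, 1 ≤ i → i ≤ N → g i = h i} ≤ (2 ^ N)⁻¹) :
    (π {g | g ∈ nonnegPaths ∧ g N = 0}).toReal ≤ (N : ℝ) ^ (-(1 / 2) : ℝ) := by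
  rcases Nat.even_or_odd' N with ⟨m, rfl | rfl⟩
  · have h := ENNReal.toReal_mono (by finiteness) (measure_return_le π _ hcyl)
    refine h.trans ?_
    rw [Nat.mul_div_cancel_left _ two_pos, ← Nat.centralBinom_eq_two_mul_choose]
    have hm : (0 : ℝ) < (2 * m : ℕ) := by exact_mod_cast hN
    have hc : ((m.centralBinom : ℝ)) ^ 2 * (2 * m + 1) ≤ (4 ^ m) ^ 2 := by
      exact_mod_cast centralBinom_sq_mul_le m
    rw [Real.rpow_neg hm.le, ← Real.sqrt_eq_rpow, ← Real.sqrt_inv]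
    refine Real.le_sqrt_of_sq_le ?_
    simp only [ENNReal.toReal_mul, ENNReal.toReal_inv, ENNReal.toReal_pow, ENNReal.toReal_natCast,
      ENNReal.toReal_ofNat, pow_mul]
    norm_num at hm ⊢
    have hm' : (0 : ℝ) < m := by exact_mod_cast hm
    rw [mul_pow, inv_pow, ← div_eq_mul_inv, div_le_iff₀ (by positivity),
      show (m : ℝ)⁻¹ * (1 / 2) * (4 ^ m) ^ 2 = (4 ^ m) ^ 2 / (2 * m) by field_simp,
      le_div_iff₀ (by positivity)]
    nlinarith [sq_nonneg (m.centralBinom : ℝ)]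
  · have he : {g : ℕ → ℕ | g ∈ nonnegPaths ∧ g (2 * m + 1) = 0} = ∅ := by
      ext g
      simp only [Set.mem_ofPred_eq, Set.mem_empty_iff_false, iff_false, not_and]
      intro hg h0
      have := two_mul_card_upSteps hg (2 * m + 1)
      omega
    rw [he]
    simp only [measure_empty, ENNReal.toReal_zero]
    positivity

/-- A Schwartz function satisfies `φ(x)² ≤ C x ^ (-3/4)` on the positive half-line. -/
theorem SchwartzMap.exists_sq_le_rpow (φ : SchwartzMap ℝ ℝ) :
    ∃ C : ℝ, ∀ x : ℝ, 0 < x → φ x ^ 2 ≤ C * x ^ (-(3 / 4) : ℝ) := by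
  obtain ⟨A, hA⟩ := φ.decay 0 0
  obtain ⟨B, hB⟩ := φ.decay 1 0
  refine ⟨A * (A + B), fun x hx => ?_⟩
  have hA := hA.2 x
  have hB := hB.2 x
  simp only [pow_zero, one_mul, norm_iteratedFDeriv_zero, pow_one, Real.norm_eq_abs,
    abs_of_pos hx] at hA hB
  have hx34 : x ^ (3 / 4 : ℝ) ≤ 1 + x := by
    rcases le_total x 1 with h | h
    · linarith [Real.rpow_le_one hx.le h (by norm_num : (0 : ℝ) ≤ 3 / 4)]
    · have := Real.rpow_le_rpow_of_exponent_le h (by norm_num : (3 / 4 : ℝ) ≤ 1)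
      rw [Real.rpow_one] at this
      linarith
  have hpos : 0 < x ^ (3 / 4 : ℝ) := Real.rpow_pos_of_pos hx _
  rw [Real.rpow_neg hx.le, ← div_eq_mul_inv, le_div_iff₀ hpos, ← sq_abs]
  have h0 := abs_nonneg (φ x)
  have hA0 : 0 ≤ A := h0.trans hA
  calc |φ x| ^ 2 * x ^ (3 / 4 : ℝ) ≤ |φ x| ^ 2 * (1 + x) := by gcongr
    _ = |φ x| * (|φ x| + x * |φ x|) := by ring
    _ ≤ A * (A + B) := by gcongr

/-- If `p n ≤ n ^ (-1/2)`, then the Riemann-type sums `ε ∑ p n φ(εn)²` tend to `0`. -/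
theorem tendsto_mul_tsum_sq_schwartz {p : ℕ → ℝ} (hp0 : ∀ n, 0 ≤ p n)
    (hp : ∀ n, 1 ≤ n → p n ≤ (n : ℝ) ^ (-(1 / 2) : ℝ)) (φ : SchwartzMap ℝ ℝ) :
    Tendsto (fun ε : ℝ => ε * ∑' n : ℕ, if 1 ≤ n then p n * φ (ε * n) ^ 2 else 0)
      (𝓝[>] 0) (𝓝 0) := by
  obtain ⟨C, hC⟩ := φ.exists_sq_le_rpow
  have hsum : Summable fun n : ℕ => (n : ℝ) ^ (-(5 / 4) : ℝ) :=
    Real.summable_nat_rpow.2 (by norm_num)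
  have hlim : Tendsto (fun ε : ℝ => ε ^ (1 / 4 : ℝ) * (C * ∑' n : ℕ, (n : ℝ) ^ (-(5 / 4) : ℝ)))
      (𝓝[>] 0) (𝓝 0) := by
    have h : Tendsto (fun ε : ℝ => ε ^ (1 / 4 : ℝ)) (𝓝[>] 0) (𝓝 0) := by
      have := (Real.continuousAt_rpow_const 0 (1 / 4 : ℝ) (Or.inr (by norm_num))).tendsto
      rw [Real.zero_rpow (by norm_num)] at this
      exact this.mono_left nhdsWithin_le_nhds
    simpa using h.mul_const (C * ∑' n : ℕ, (n : ℝ) ^ (-(5 / 4) : ℝ))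
  have hterm0 (ε : ℝ) (n : ℕ) : 0 ≤ if 1 ≤ n then p n * φ (ε * n) ^ 2 else 0 := by
    split_ifs
    · exact mul_nonneg (hp0 n) (sq_nonneg _)
    · exact le_rfl
  refine tendsto_of_tendsto_of_tendsto_of_le_of_le' tendsto_const_nhds hlim ?_ ?_
  · filter_upwards [self_mem_nhdsWithin] with ε hε
    exact mul_nonneg (le_of_lt hε) (tsum_nonneg (hterm0 ε))
  · filter_upwards [self_mem_nhdsWithin] with ε hε
    have hε : 0 < ε := hε
    have hbound (n : ℕ) : (if 1 ≤ n then p n * φ (ε * n) ^ 2 else 0) ≤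
        C * ε ^ (-(3 / 4) : ℝ) * (n : ℝ) ^ (-(5 / 4) : ℝ) := by
      split_ifs with hn
      · have hn0 : (0 : ℝ) < n := by exact_mod_cast hn
        calc p n * φ (ε * n) ^ 2
            ≤ (n : ℝ) ^ (-(1 / 2) : ℝ) * (C * (ε * n) ^ (-(3 / 4) : ℝ)) :=
              mul_le_mul (hp n hn) (hC _ (by positivity)) (sq_nonneg _) (by positivity)
          _ = C * ε ^ (-(3 / 4) : ℝ) * ((n : ℝ) ^ (-(1 / 2) : ℝ) * (n : ℝ) ^ (-(3 / 4) : ℝ)) := by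
              rw [Real.mul_rpow hε.le hn0.le]; ring
          _ = C * ε ^ (-(3 / 4) : ℝ) * (n : ℝ) ^ (-(5 / 4) : ℝ) := by
              rw [← Real.rpow_add hn0]; norm_num
      · have : n = 0 := by omega
        subst this
        rw [Nat.cast_zero, Real.zero_rpow (by norm_num), mul_zero]
    have hsum' := hsum.mul_left (C * ε ^ (-(3 / 4) : ℝ))
    have hle := (Summable.of_nonneg_of_le (hterm0 ε) hbound hsum').tsum_le_tsum hbound hsum'
    rw [tsum_mul_left] at hle
    have hpow : ε * ε ^ (-(3 / 4) : ℝ) = ε ^ (1 / 4 : ℝ) := by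
      nth_rewrite 1 [← Real.rpow_one ε]
      rw [← Real.rpow_add hε]; norm_num
    calc _ ≤ ε * (C * ε ^ (-(3 / 4) : ℝ) * ∑' n : ℕ, (n : ℝ) ^ (-(5 / 4) : ℝ)) := by gcongr
      _ = _ := by rw [← hpow]; ring

/-- Vanishing of the rescaled expected number of wall contacts under the invariant
measure: for every Schwartz `φ`, `ε Σ_{n ≥ 1} π(X_n + ΔX_n < 0) φ(εn)² → 0` as `ε → 0⁺`. -/
theorem stmt17 (π : Measure (ℕ → ℕ)) [IsProbabilityMeasure π]
    (hsupp : π {h : ℕ → ℕ | h 0 = 0 ∧ ∀ n : ℕ, |((h (n + 1) : ℤ)) - (h n : ℤ)| = 1} = 1)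
    (hcyl : ∀ N : ℕ, 1 ≤ N → ∀ h : ℕ → ℕ, h 0 = 0 →
      (∀ n : ℕ, |((h (n + 1) : ℤ)) - (h n : ℤ)| = 1) →
      π {g : ℕ → ℕ | ∀ i, 1 ≤ i → i ≤ N → g i = h i} = ((h N : ℝ≥0∞) + 1) / 2 ^ N)
    (φ : SchwartzMap ℝ ℝ) :
    Tendsto
      (fun ε : ℝ => ε * ∑' n : ℕ,
        if 1 ≤ n then
          (π {h : ℕ → ℕ |
            (h n : ℤ) + ((h (n + 1) : ℤ) + (h (n - 1) : ℤ) - 2 * (h n : ℤ)) < 0}).toReal *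
            (φ (ε * n)) ^ 2
        else 0)
      (nhdsWithin 0 (Set.Ioi 0)) (𝓝 0) := by
  refine tendsto_mul_tsum_sq_schwartz (fun n => ENNReal.toReal_nonneg) (fun n hn => ?_) φ
  have hnull : π nonnegPathsᶜ = 0 := (prob_compl_eq_zero_iff measurableSet_nonnegPaths).2 hsupp
  have hle : π {h : ℕ → ℕ |
      (h n : ℤ) + ((h (n + 1) : ℤ) + (h (n - 1) : ℤ) - 2 * (h n : ℤ)) < 0} ≤
      π {g | g ∈ nonnegPaths ∧ g (n + 1) = 0} := by
    refine measure_mono_ae ?_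
    filter_upwards [compl_mem_ae_iff.2 hnull] with h hh hneg
    have hh : h ∈ nonnegPaths := not_not.1 hh
    have hneg : (h n : ℤ) + ((h (n + 1) : ℤ) + (h (n - 1) : ℤ) - 2 * (h n : ℤ)) < 0 := hneg
    have h1 := step_of_mem_nonnegPaths hh n
    have h2 := step_of_mem_nonnegPaths hh (n - 1)
    rw [Nat.sub_add_cancel hn] at h2
    exact ⟨hh, by omega⟩
  have hret := toReal_measure_return_le π (N := n + 1) (by omega) fun h hh h0 => by
    rw [hcyl (n + 1) (by omega) h hh.1 hh.2, h0]
    simp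
  have hn0 : (0 : ℝ) < n := by exact_mod_cast hn
  calc _ ≤ _ := ENNReal.toReal_mono (measure_ne_top _ _) hle
    _ ≤ _ := hret
    _ ≤ _ := Real.rpow_le_rpow_of_nonpos hn0 (by push_cast; linarith) (by norm_num)
end
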